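/- arXiv:1211.3336 — 5 statements merged into one kernel-verified Lean document; each statement's English description precedes it below -/
import Mathlib

section
/- Let w : (0,∞) → ℝ be continuously differentiable with w'(x) > 0 for every x > 0, and let f : (0,∞) → ℂ be continuously differentiable with compact support contained in (0,∞). Then ∫₀^∞ w'(x) |f(x)|² dx ≤ 4 ∫₀^∞ (w(x)² / w'(x)) |f'(x)|² dx. -/
open MeasureTheory Set

/-- A function that is continuous on `s` and vanishes on `s` outside a compact `K ⊆ s` is
integrable on `s`. -/
theorem ContinuousOn.integrableOn_of_forall_sdiff_eq_zero {g : ℝ → ℝ} {s K : Set ℝ}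
    (hg : ContinuousOn g s) (hs : MeasurableSet s) (hK : IsCompact K) (hKs : K ⊆ s)
    (hz : ∀ x ∈ s \ K, g x = 0) : IntegrableOn g s :=
  ((hg.mono hKs).integrableOn_compact hK).of_forall_sdiff_eq_zero hs hz

/-- **Generalized Hardy inequality** (Lemma A.2).
If `w : (0,∞) → ℝ` is continuously differentiable with positive derivative `w'` on `(0,∞)`
and `f : (0,∞) → ℂ` is continuously differentiable with compact support contained in `(0,∞)`,
then `∫₀^∞ w' |f|² ≤ 4 ∫₀^∞ (w²/w') |f'|²`. -/
theorem generalized_hardy_inequality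
    (w w' : ℝ → ℝ) (f f' : ℝ → ℂ)
    (hw : ∀ x ∈ Ioi (0:ℝ), HasDerivAt w (w' x) x)
    (hw'cont : ContinuousOn w' (Ioi 0))
    (hw'pos : ∀ x ∈ Ioi (0:ℝ), 0 < w' x)
    (hf : ∀ x ∈ Ioi (0:ℝ), HasDerivAt f (f' x) x)
    (hf'cont : ContinuousOn f' (Ioi 0))
    (hfc : HasCompactSupport f)
    (hsupp : tsupport f ⊆ Ioi 0) :
    ∫ x in Ioi (0:ℝ), w' x * ‖f x‖ ^ 2
      ≤ 4 * ∫ x in Ioi (0:ℝ), (w x) ^ 2 / w' x * ‖f' x‖ ^ 2 := by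
  have hK : IsCompact (tsupport f) := hfc
  have hwc : ContinuousOn w (Ioi 0) := fun x hx => (hw x hx).continuousAt.continuousWithinAt
  have hfcont : ContinuousOn f (Ioi 0) := fun x hx => (hf x hx).continuousAt.continuousWithinAt
  have hf0 : ∀ x ∉ tsupport f, f x = 0 := fun x hx => image_eq_zero_of_notMem_tsupport hx
  have hf'0 : ∀ x ∈ Ioi (0:ℝ) \ tsupport f, f' x = 0 := fun x hx =>
    (hf x hx.1).unique
      ((hasDerivAt_const x 0).congr_of_eventuallyEq (notMem_tsupport_iff_eventuallyEq.1 hx.2))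
  have hw'ne : ∀ x ∈ Ioi (0:ℝ), w' x ≠ 0 := fun x hx => (hw'pos x hx).ne'
  have hleft : IntegrableOn (fun x => w' x * ‖f x‖ ^ 2) (Ioi 0) :=
    (hw'cont.mul (hfcont.norm.pow 2)).integrableOn_of_forall_sdiff_eq_zero measurableSet_Ioi hK
      hsupp fun x hx => by simp [hf0 x hx.2]
  have hright : IntegrableOn (fun x => (w x) ^ 2 / w' x * ‖f' x‖ ^ 2) (Ioi 0) :=
    (((hwc.pow 2).div hw'cont hw'ne).mul
      (hf'cont.norm.pow 2)).integrableOn_of_forall_sdiff_eq_zero measurableSet_Ioi hK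
      hsupp fun x hx => by simp [hf'0 x hx]
  have hcross : IntegrableOn
      (fun x => w' x * ‖f x‖ ^ 2 + w x * (2 * inner ℝ (f x) (f' x))) (Ioi 0) :=
    hleft.add <| (hwc.mul (continuousOn_const.mul
      (hfcont.inner hf'cont))).integrableOn_of_forall_sdiff_eq_zero measurableSet_Ioi hK
      hsupp fun x hx => by simp [hf0 x hx.2]
  have hzero : ∫ x in Ioi (0:ℝ), (w' x * ‖f x‖ ^ 2 + w x * (2 * inner ℝ (f x) (f' x))) = 0 := by
    have h0 : (0:ℝ) ∉ tsupport f := fun h => lt_irrefl (0:ℝ) (hsupp h)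
    have hcont : ContinuousAt (fun x => w x * ‖f x‖ ^ 2) 0 := by
      refine (continuousAt_const (y := (0:ℝ))).congr ?_
      filter_upwards [notMem_tsupport_iff_eventuallyEq.1 h0] with x hx
      simp [hx]
    have htop : Filter.Tendsto (fun x => w x * ‖f x‖ ^ 2) Filter.atTop (nhds 0) := by
      refine tendsto_const_nhds.congr' ?_
      obtain ⟨b, hb⟩ := hK.bddAbove
      filter_upwards [Filter.eventually_gt_atTop b] with x hx
      simp [hf0 x fun h => hx.not_ge (hb h)]
    have key := integral_Ioi_of_hasDerivAt_of_tendsto hcont.continuousWithinAt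
      (fun x hx => (hw x hx).mul (hf x hx).norm_sq) hcross htop
    simpa [hf0 0 h0] using key
  have hpoint : ∀ x ∈ Ioi (0:ℝ), w' x * ‖f x‖ ^ 2 ≤ 4 * ((w x) ^ 2 / w' x * ‖f' x‖ ^ 2)
      + 2 * (w' x * ‖f x‖ ^ 2 + w x * (2 * inner ℝ (f x) (f' x))) := by
    intro x hx
    have hsq : ‖(w' x) • f x + (2 * w x) • f' x‖ ^ 2 / w' x
        = w' x * ‖f x‖ ^ 2 + 4 * w x * inner ℝ (f x) (f' x)
          + 4 * ((w x) ^ 2 / w' x * ‖f' x‖ ^ 2) := by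
      have := hw'ne x hx
      rw [norm_add_sq_real, norm_smul, norm_smul, real_inner_smul_left, real_inner_smul_right,
        mul_pow, mul_pow, Real.norm_eq_abs, Real.norm_eq_abs, sq_abs, sq_abs]
      field_simp
      ring
    have hnonneg : 0 ≤ ‖(w' x) • f x + (2 * w x) • f' x‖ ^ 2 / w' x :=
      div_nonneg (sq_nonneg _) (hw'pos x hx).le
    linarith
  calc ∫ x in Ioi (0:ℝ), w' x * ‖f x‖ ^ 2
      ≤ ∫ x in Ioi (0:ℝ), (4 * ((w x) ^ 2 / w' x * ‖f' x‖ ^ 2)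
          + 2 * (w' x * ‖f x‖ ^ 2 + w x * (2 * inner ℝ (f x) (f' x)))) :=
        setIntegral_mono_on hleft ((hright.const_mul 4).fun_add (hcross.const_mul 2))
          measurableSet_Ioi hpoint
    _ = 4 * ∫ x in Ioi (0:ℝ), (w x) ^ 2 / w' x * ‖f' x‖ ^ 2 := by
        rw [integral_add (hright.const_mul 4) (hcross.const_mul 2), integral_const_mul,
          integral_const_mul, hzero, mul_zero, add_zero]
end

section
/- Let H be a complex Hilbert space and let J : H → H be a continuous linear map with adjoint J* = −J and with J ∘ J = −id. Let λ ∈ ℂ with Re λ ≠ 0, let ζ, η ∈ H satisfy J η = λ • ζ, and assume the inner product ⟪ζ, η⟫ is real (its imaginary part vanishes). Then ⟪ζ, η⟫ = 0 and ⟪ζ, J ζ⟫ = 0. -/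
open scoped ComplexInnerProductSpace

/-- Abstract Krein-signature lemma (Lemma 5.1). If `J` is a skew-adjoint complex structure
(`J* = −J`, `J² = −1`) on a complex Hilbert space, `Re λ ≠ 0`, `J η = λ • ζ`, and `⟪ζ, η⟫` is
real, then `⟪ζ, η⟫ = 0` and `⟪ζ, J ζ⟫ = 0`. -/
theorem krein_signature_zero
    {H : Type*} [NormedAddCommGroup H] [InnerProductSpace ℂ H] [CompleteSpace H]
    (J : H →L[ℂ] H)
    (hJadj : ContinuousLinearMap.adjoint J = -J)
    (hJ2 : ∀ x, J (J x) = -x)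
    (lam : ℂ) (hlam : lam.re ≠ 0)
    (ζ η : H) (heig : J η = lam • ζ)
    (hreal : (⟪ζ, η⟫).im = 0) :
    ⟪ζ, η⟫ = 0 ∧ ⟪ζ, J ζ⟫ = 0 := by
  have hη : η = -(lam • J ζ) := by
    rw [← map_smul, ← heig, hJ2, neg_neg]
  have hre : (⟪ζ, J ζ⟫).re = 0 := by
    have h := ContinuousLinearMap.adjoint_inner_right J ζ ζ
    rw [hJadj, neg_apply, inner_neg_right, ← inner_conj_symm (J ζ) ζ] at h
    have h' := congrArg Complex.re h
    rw [Complex.neg_re, Complex.conj_re] at h'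
    linarith
  have hinner : ⟪ζ, η⟫ = -(lam * ⟪ζ, J ζ⟫) := by
    rw [hη, inner_neg_right, inner_smul_right]
  have him : (⟪ζ, J ζ⟫).im = 0 := by
    rw [hinner, Complex.neg_im, Complex.mul_im, hre, mul_zero, add_zero, neg_eq_zero] at hreal
    exact (mul_eq_zero.mp hreal).resolve_left hlam
  have hzero : ⟪ζ, J ζ⟫ = 0 := Complex.ext hre him
  exact ⟨by rw [hinner, hzero, mul_zero, neg_zero], hzero⟩
end

section
/- Let H be a complex Hilbert space and let L₊, L₋ : H → H be continuous linear self-adjoint maps, with L₋ positive definite in the sense that there is c > 0 with Re ⟪u, L₋ u⟫ ≥ c ‖u‖² for all u ∈ H. Suppose λ ∈ ℂ and u, v ∈ H are not both zero and satisfy L₋ v = λ • u and L₊ u = −λ • v. Then λ² is real. -/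
open scoped ComplexInnerProductSpace

/-- The quadratic form of a self-adjoint operator is real-valued. -/
theorem ContinuousLinearMap.im_inner_apply_self_of_adjoint_eq
    {H : Type*} [NormedAddCommGroup H] [InnerProductSpace ℂ H] [CompleteSpace H]
    {T : H →L[ℂ] H} (hT : ContinuousLinearMap.adjoint T = T) (x : H) :
    (⟪x, T x⟫).im = 0 := by
  rw [← Complex.conj_eq_iff_im, inner_conj_symm, ← ContinuousLinearMap.adjoint_inner_right, hT]

/-- If `w * z` and `w * conj z` are real and `z ≠ 0`, then `w ^ 2` is real. -/
theorem Complex.im_sq_eq_zero_of_im_mul_eq_zero {w z : ℂ} (hz : z ≠ 0)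
    (h : (w * z).im = 0) (h_conj : (w * starRingEnd ℂ z).im = 0) : (w ^ 2).im = 0 := by
  have key : w ^ 2 * (Complex.normSq z : ℂ) = (w * z) * (w * starRingEnd ℂ z) := by
    rw [← Complex.mul_conj]; ring
  have him : (w ^ 2).im * Complex.normSq z = 0 := by
    rw [← Complex.im_mul_ofReal, key, Complex.mul_im, h, h_conj]; simp
  exact (mul_eq_zero.mp him).resolve_right (by simpa using hz)

/-- Lemma 1.3 (bounded-operator form): for the linearized NLS eigenvalue problem
`L₋ v = λ u`, `L₊ u = −λ v` with `L₊, L₋` self-adjoint and `L₋` positive definite,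
any eigenvalue `λ` satisfies `λ² ∈ ℝ`. -/
theorem nls_linearization_lambda_sq_real
    {H : Type*} [NormedAddCommGroup H] [InnerProductSpace ℂ H] [CompleteSpace H]
    (Lp Lm : H →L[ℂ] H)
    (hLp : ContinuousLinearMap.adjoint Lp = Lp)
    (hLm : ContinuousLinearMap.adjoint Lm = Lm)
    (c : ℝ) (hc : 0 < c)
    (hpos : ∀ u : H, c * ‖u‖ ^ 2 ≤ (⟪u, Lm u⟫).re)
    (lam : ℂ) (u v : H) (huv : ¬(u = 0 ∧ v = 0))
    (h₁ : Lm v = lam • u) (h₂ : Lp u = -lam • v) :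
    (lam ^ 2).im = 0 := by
  by_cases hv : v = 0
  · have hu : u ≠ 0 := fun hu => huv ⟨hu, hv⟩
    have hlam : lam = 0 := by simpa [hv, hu] using h₁.symm
    simp [hlam]
  have hm : ⟪v, Lm v⟫ = lam * ⟪v, u⟫ := by rw [h₁, inner_smul_right]
  have hp : ⟪u, Lp u⟫ = -(lam * starRingEnd ℂ ⟪v, u⟫) := by
    rw [h₂, inner_smul_right, inner_conj_symm, neg_mul]
  refine Complex.im_sq_eq_zero_of_im_mul_eq_zero (z := ⟪v, u⟫) (fun hz => ?_) ?_ ?_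
  · have hle := hpos v
    rw [hm, hz, mul_zero, Complex.zero_re] at hle
    have hlt : 0 < c * ‖v‖ ^ 2 := by positivity
    exact hlt.not_ge hle
  · rw [← hm]
    exact ContinuousLinearMap.im_inner_apply_self_of_adjoint_eq hLm v
  · rw [← neg_eq_zero, ← Complex.neg_im, ← hp]
    exact ContinuousLinearMap.im_inner_apply_self_of_adjoint_eq hLp u
end

section
/- Let K ⊆ ℂ be a closed set with m ∉ K and −m ∉ K. Then for every s > 1/2 there exists C < ∞ such that for every λ ∈ K and every Schwartz function u : ℝⁿ → ℂ^N, ∫_{ℝⁿ} (1+|x|²)^{−s} |u(x)|² dx ≤ C² ∫_{ℝⁿ} (1+|x|²)^{s} |(D_m u)(x) − λ u(x)|² dx. -/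
open MeasureTheory

noncomputable section

/-- The free Dirac operator `D_m u = −i ∑ⱼ αʲ ∂ⱼu + m β u` on functions `ℝⁿ → ℂ^N`. -/
def diracOp {n N : ℕ} (m : ℝ) (α : Fin n → Matrix (Fin N) (Fin N) ℂ)
    (β : Matrix (Fin N) (Fin N) ℂ)
    (u : EuclideanSpace ℝ (Fin n) → EuclideanSpace ℂ (Fin N))
    (x : EuclideanSpace ℝ (Fin n)) : EuclideanSpace ℂ (Fin N) :=
  (-Complex.I) • ∑ j, Matrix.toEuclideanLin (α j) (fderiv ℝ u x (EuclideanSpace.single j 1))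
    + (m : ℂ) • Matrix.toEuclideanLin β (u x)

namespace DiracLAP

section

set_option linter.unusedSectionVars false

open Real Filter Topology
open scoped SchwartzMap LineDeriv FourierTransform ContDiff

/-! ### Functions of temperate growth -/

lemma ofReal_sub_mem_slitPlane {κ : ℂ} (hκ : κ.im ≠ 0) (t : ℝ) :
    (t : ℂ) - κ ∈ Complex.slitPlane := by
  right
  simpa using hκ

lemma hasDerivAt_ofReal_sub_cpow {κ : ℂ} (hκ : κ.im ≠ 0) (r : ℂ) (t : ℝ) :
    HasDerivAt (fun t : ℝ ↦ ((t : ℂ) - κ) ^ r) (r * ((t : ℂ) - κ) ^ (r - 1)) t := by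
  have h : HasDerivAt (fun z : ℂ ↦ (z - κ) ^ r) (r * ((t : ℂ) - κ) ^ (r - 1)) t := by
    simpa using ((hasDerivAt_id (t : ℂ)).sub_const κ).cpow_const (c := r)
      (ofReal_sub_mem_slitPlane hκ t)
  exact h.comp_ofReal

lemma iteratedDeriv_ofReal_sub_cpow {κ : ℂ} (hκ : κ.im ≠ 0) (n : ℕ) (r : ℝ) :
    ∃ c : ℂ, iteratedDeriv n (fun t : ℝ ↦ ((t : ℂ) - κ) ^ (r : ℂ)) =
      fun t : ℝ ↦ c * ((t : ℂ) - κ) ^ ((r - n : ℝ) : ℂ) := by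
  induction n with
  | zero => exact ⟨1, by simp⟩
  | succ n ih =>
    obtain ⟨c, hc⟩ := ih
    refine ⟨c * ((r - n : ℝ) : ℂ), ?_⟩
    rw [iteratedDeriv_succ, hc]
    funext t
    rw [((hasDerivAt_ofReal_sub_cpow hκ _ t).const_mul c).deriv]
    push_cast
    rw [mul_assoc, sub_sub]

lemma norm_ofReal_sub_cpow_le {κ : ℂ} (hκ : κ.im ≠ 0) (r : ℝ) :
    ∃ (k : ℕ) (C : ℝ), ∀ t : ℝ, ‖((t : ℂ) - κ) ^ (r : ℂ)‖ ≤ C * (1 + ‖t‖) ^ k := by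
  have hlow (t : ℝ) : |κ.im| ≤ ‖(t : ℂ) - κ‖ := by
    simpa using Complex.abs_im_le_norm ((t : ℂ) - κ)
  have hup (t : ℝ) : ‖(t : ℂ) - κ‖ ≤ (1 + ‖κ‖) * (1 + ‖t‖) := by
    have : ‖(t : ℂ) - κ‖ ≤ ‖(t : ℂ)‖ + ‖κ‖ := norm_sub_le _ _
    rw [Complex.norm_real] at this
    nlinarith [norm_nonneg κ, norm_nonneg t]
  have hpos : 0 < |κ.im| := abs_pos.mpr hκ
  rcases le_total 0 r with hr | hr
  · refine ⟨⌈r⌉₊, (1 + ‖κ‖) ^ ⌈r⌉₊, fun t ↦ ?_⟩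
    rw [Complex.norm_cpow_real, ← mul_pow, ← Real.rpow_natCast]
    refine (Real.rpow_le_rpow (norm_nonneg _) (hup t) hr).trans ?_
    refine Real.rpow_le_rpow_of_exponent_le ?_ (Nat.le_ceil r)
    nlinarith [norm_nonneg κ, norm_nonneg t]
  · refine ⟨0, |κ.im| ^ r, fun t ↦ ?_⟩
    rw [Complex.norm_cpow_real, pow_zero, mul_one]
    exact Real.rpow_le_rpow_of_nonpos hpos (hlow t) hr

lemma hasTemperateGrowth_ofReal_sub_cpow {κ : ℂ} (hκ : κ.im ≠ 0) (r : ℝ) :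
    (fun t : ℝ ↦ ((t : ℂ) - κ) ^ (r : ℂ)).HasTemperateGrowth := by
  have hd (r : ℝ) : Differentiable ℝ (fun t : ℝ ↦ ((t : ℂ) - κ) ^ (r : ℂ)) := fun t ↦
    (hasDerivAt_ofReal_sub_cpow hκ r t).differentiableAt
  refine ⟨?_, fun n ↦ ?_⟩
  · refine contDiff_of_differentiable_iteratedDeriv fun n _ ↦ ?_
    obtain ⟨c, hc⟩ := iteratedDeriv_ofReal_sub_cpow hκ n r
    rw [hc]
    exact (hd _).const_mul c
  · obtain ⟨c, hc⟩ := iteratedDeriv_ofReal_sub_cpow hκ n r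
    obtain ⟨k, C, h⟩ := norm_ofReal_sub_cpow_le hκ (r - n)
    refine ⟨k, ‖c‖ * C, fun t ↦ ?_⟩
    rw [norm_iteratedFDeriv_eq_norm_iteratedDeriv, hc, norm_mul, mul_assoc]
    gcongr
    exact h t

section

variable {E : Type*} [NormedAddCommGroup E]

lemma _root_.Function.HasTemperateGrowth.ofReal_sub_cpow [NormedSpace ℝ E] {f : E → ℝ}
    (hf : f.HasTemperateGrowth) {κ : ℂ} (hκ : κ.im ≠ 0) (r : ℝ) :
    (fun x ↦ ((f x : ℂ) - κ) ^ (r : ℂ)).HasTemperateGrowth :=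
  (hasTemperateGrowth_ofReal_sub_cpow hκ r).comp hf

lemma _root_.Function.HasTemperateGrowth.ofReal_sub_inv [NormedSpace ℝ E] {f : E → ℝ}
    (hf : f.HasTemperateGrowth) {κ : ℂ} (hκ : κ.im ≠ 0) :
    (fun x ↦ ((f x : ℂ) - κ)⁻¹).HasTemperateGrowth := by
  simpa [Complex.cpow_neg_one] using hf.ofReal_sub_cpow hκ (-1)

end

/-! ### Integrability of products of Schwartz functions -/

variable {E V : Type*} [NormedAddCommGroup E] [InnerProductSpace ℝ E] [FiniteDimensional ℝ E]
  [MeasurableSpace E] [BorelSpace E] [NormedAddCommGroup V] [InnerProductSpace ℂ V]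

lemma integrable_norm_mul_norm (f g : 𝓢(E, V)) : Integrable (fun x ↦ ‖f x‖ * ‖g x‖) :=
  (f.memLp 2).norm.integrable_mul (g.memLp 2).norm

lemma integrable_norm_sq (f : 𝓢(E, V)) : Integrable (fun x ↦ ‖f x‖ ^ 2) := by
  simpa [pow_two] using integrable_norm_mul_norm f f

lemma integrable_inner (f g : 𝓢(E, V)) : Integrable (fun x ↦ inner ℂ (f x) (g x)) := by
  refine (integrable_norm_mul_norm f g).mono' (by fun_prop) (.of_forall fun x ↦ ?_)
  exact norm_inner_le_norm _ _

lemma integrable_mul_norm_mul_norm {φ : E → ℝ} (hφ : φ.HasTemperateGrowth) (f g : 𝓢(E, V)) :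
    Integrable (fun x ↦ φ x * (‖f x‖ * ‖g x‖)) := by
  refine (integrable_norm_mul_norm (SchwartzMap.smulLeftCLM V φ f) g).mono'
    (hφ.1.continuous.mul (by fun_prop)).aestronglyMeasurable (.of_forall fun x ↦ ?_)
  rw [SchwartzMap.smulLeftCLM_apply_apply hφ]
  simp [norm_smul, mul_assoc]

lemma integrable_mul_norm_sq {φ : E → ℝ} (hφ : φ.HasTemperateGrowth) (f : 𝓢(E, V)) :
    Integrable (fun x ↦ φ x * ‖f x‖ ^ 2) := by
  simpa [pow_two] using integrable_mul_norm_mul_norm hφ f f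

lemma re_integral_inner (f g : 𝓢(E, V)) :
    (∫ x, inner ℂ (f x) (g x)).re = ∫ x, (inner ℂ (f x) (g x)).re :=
  (integral_re (integrable_inner f g)).symm

/-- Integration by parts for the complex inner product of Schwartz functions. -/
lemma integral_inner_lineDerivOp (f g : 𝓢(E, V)) (e : E) :
    ∫ x, inner ℂ (f x) (∂_{e} g x) = -∫ x, inner ℂ (∂_{e} f x) (g x) := by
  let L : V →L[ℝ] V →L[ℝ] ℂ :=
    (isBoundedBilinearMap_inner (𝕜 := ℂ) (E := V)).toContinuousLinearMap
  exact SchwartzMap.integral_bilinear_lineDerivOp_right_eq_neg_left f g L e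

lemma lineDerivOp_smulLeftCLM_apply {φ : E → ℂ} (hφ : φ.HasTemperateGrowth) (f : 𝓢(E, V)) (e x : E)
    {φ' : ℂ} (hφ' : HasLineDerivAt ℝ φ φ' x e) :
    ∂_{e} (SchwartzMap.smulLeftCLM V φ f) x = φ x • ∂_{e} f x + φ' • f x := by
  have h1 : HasLineDerivAt ℝ f (∂_{e} f x) x e := (SchwartzMap.hasFDerivAt f x).hasLineDerivAt e
  have h2 : HasLineDerivAt ℝ (fun x ↦ φ x • f x) (φ x • ∂_{e} f x + φ' • f x) x e := by
    have := HasDerivAt.smul hφ' h1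
    simpa [HasLineDerivAt, Pi.smul_def'] using this
  rw [SchwartzMap.lineDerivOp_apply]
  rw [← h2.lineDeriv]
  congr 1
  ext y
  exact SchwartzMap.smulLeftCLM_apply_apply hφ f y

/-! ### The transport estimate -/

/-- The function `x ↦ (⟨x, e⟩ - t + i)⁻¹`, whose squared modulus is a translated Cauchy kernel. -/
def cauchyFactor (e : E) (t : ℝ) (x : E) : ℂ :=
  (((inner ℝ x e : ℝ) : ℂ) - (t - Complex.I))⁻¹

lemma hasTemperateGrowth_cauchyFactor (e : E) (t : ℝ) :
    (cauchyFactor e t).HasTemperateGrowth :=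
  Function.HasTemperateGrowth.ofReal_sub_inv (f := fun x : E ↦ inner ℝ x e) (by fun_prop)
    (by simp)

lemma cauchyFactor_denom_ne_zero (a t : ℝ) : (a : ℂ) - (t - Complex.I) ≠ 0 := by
  intro h
  simpa using congrArg Complex.im h

lemma norm_sq_cauchyFactor (e : E) (t : ℝ) (x : E) :
    ‖cauchyFactor e t x‖ ^ 2 = (1 + (inner ℝ x e - t) ^ 2)⁻¹ := by
  rw [cauchyFactor, norm_inv, inv_pow, Complex.sq_norm, Complex.normSq_apply]
  simp
  ring

lemma re_cauchyFactor (e : E) (t : ℝ) (x : E) :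
    (cauchyFactor e t x).re = (inner ℝ x e - t) * (1 + (inner ℝ x e - t) ^ 2)⁻¹ := by
  rw [cauchyFactor, Complex.inv_re, Complex.normSq_apply, div_eq_mul_inv]
  simp
  ring_nf
  simp

lemma hasLineDerivAt_cauchyFactor {e : E} (he : ‖e‖ = 1) (t : ℝ) (x : E) :
    HasLineDerivAt ℝ (cauchyFactor e t) (-(cauchyFactor e t x) ^ 2) x e := by
  have h1 : HasDerivAt (fun r : ℝ ↦ (((inner ℝ (x + r • e) e : ℝ) : ℂ) - (t - Complex.I)))
      1 0 := by
    have h2 : (fun r : ℝ ↦ (((inner ℝ (x + r • e) e : ℝ) : ℂ) - (t - Complex.I))) =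
        fun r : ℝ ↦ (r : ℂ) + (((inner ℝ x e : ℝ) : ℂ) - (t - Complex.I)) := by
      funext r
      rw [inner_add_left, real_inner_smul_left, real_inner_self_eq_norm_sq, he]
      push_cast
      ring
    rw [h2]
    exact (Complex.ofRealCLM.hasDerivAt (x := (0 : ℝ))).add_const _
  have h3 := h1.fun_inv (cauchyFactor_denom_ne_zero _ _)
  unfold HasLineDerivAt cauchyFactor
  have h4 : -(((inner ℝ x e : ℝ) : ℂ) - (t - Complex.I))⁻¹ ^ 2 =
      -1 / (((inner ℝ (x + (0 : ℝ) • e) e : ℝ) : ℂ) - (t - Complex.I)) ^ 2 := by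
    simp [neg_div]
  rw [h4]
  exact h3

lemma abs_mul_inv_one_add_sq_sq_le (y : ℝ) : |y * ((1 + y ^ 2)⁻¹) ^ 2| ≤ 1 := by
  rw [abs_mul, abs_of_nonneg (a := _ ^ 2) (by positivity), inv_pow, ← div_eq_mul_inv,
    div_le_one (by positivity), abs_le]
  constructor <;> nlinarith [sq_nonneg (y - 1), sq_nonneg (y + 1), sq_nonneg (y ^ 2)]

lemma continuous_inv_one_add_sq {X : Type*} [TopologicalSpace X] {f : X → ℝ} (hf : Continuous f) :
    Continuous fun x ↦ (1 + f x ^ 2)⁻¹ :=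
  (by fun_prop : Continuous fun x ↦ 1 + f x ^ 2).inv₀ fun x ↦ by positivity

lemma integrable_sub_mul_inv_one_add_sq_sq_mul (e : E) (t : ℝ) (p : 𝓢(E, V)) :
    Integrable fun x ↦ (inner ℝ x e - t) * ((1 + (inner ℝ x e - t) ^ 2)⁻¹) ^ 2 * ‖p x‖ ^ 2 := by
  refine (integrable_norm_sq p).mono' (((Continuous.mul (by fun_prop)
    ((continuous_inv_one_add_sq (by fun_prop)).pow 2)).mul
      (by fun_prop)).aestronglyMeasurable) (.of_forall fun x ↦ ?_)
  rw [norm_mul, norm_pow, norm_norm, Real.norm_eq_abs]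
  exact mul_le_of_le_one_left (by positivity) (abs_mul_inv_one_add_sq_sq_le _)

lemma integral_inner_sub_mul_sq {e : E} (he : ‖e‖ = 1) (t : ℝ) (p : 𝓢(E, V)) :
    ∫ x, (inner ℝ x e - t) * ((1 + (inner ℝ x e - t) ^ 2)⁻¹) ^ 2 * ‖p x‖ ^ 2 =
      ∫ x, (1 + (inner ℝ x e - t) ^ 2)⁻¹ * (inner ℂ (p x) (∂_{e} p x)).re := by
  set h := cauchyFactor e t
  have hh : h.HasTemperateGrowth := hasTemperateGrowth_cauchyFactor e t
  set g := SchwartzMap.smulLeftCLM V h p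
  have hg (x : E) : g x = h x • p x := SchwartzMap.smulLeftCLM_apply_apply hh p x
  have hdg (x : E) : ∂_{e} g x = h x • ∂_{e} p x + (-(h x) ^ 2) • p x :=
    lineDerivOp_smulLeftCLM_apply hh p e x (hasLineDerivAt_cauchyFactor he t x)
  have h0 : (∫ x, inner ℂ (g x) (∂_{e} g x)).re = 0 := by
    have h1 := congrArg Complex.re (integral_inner_lineDerivOp g g e)
    have h2 : (∫ x, inner ℂ (∂_{e} g x) (g x)).re = (∫ x, inner ℂ (g x) (∂_{e} g x)).re := by
      rw [re_integral_inner, re_integral_inner]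
      congr 1
      funext x
      exact inner_re_symm (𝕜 := ℂ) _ _
    rw [Complex.neg_re, h2] at h1
    linarith
  have hpt (x : E) : (inner ℂ (g x) (∂_{e} g x)).re =
      (1 + (inner ℝ x e - t) ^ 2)⁻¹ * (inner ℂ (p x) (∂_{e} p x)).re -
      (inner ℝ x e - t) * ((1 + (inner ℝ x e - t) ^ 2)⁻¹) ^ 2 * ‖p x‖ ^ 2 := by
    have hn : ((starRingEnd ℂ) (h x)) * h x = (((1 + (inner ℝ x e - t) ^ 2)⁻¹ : ℝ) : ℂ) := by
      rw [← norm_sq_cauchyFactor e t x, Complex.conj_mul']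
      push_cast
      rfl
    have e1 : inner ℂ (g x) (∂_{e} g x) =
        (((1 + (inner ℝ x e - t) ^ 2)⁻¹ : ℝ) : ℂ) * inner ℂ (p x) (∂_{e} p x) -
        (((1 + (inner ℝ x e - t) ^ 2)⁻¹ * ‖p x‖ ^ 2 : ℝ) : ℂ) * h x := by
      rw [hg, hdg, inner_add_right, inner_smul_left, inner_smul_left, inner_smul_right,
        inner_smul_right, inner_self_eq_norm_sq_to_K]
      push_cast at hn ⊢
      rw [← hn]
      simp only [Complex.coe_algebraMap]
      ring
    rw [e1, Complex.sub_re, Complex.re_ofReal_mul, Complex.re_ofReal_mul, re_cauchyFactor]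
    ring
  rw [re_integral_inner] at h0
  simp_rw [hpt] at h0
  have i1 := integrable_sub_mul_inv_one_add_sq_sq_mul e t p
  have i2 : Integrable fun x ↦ (1 + (inner ℝ x e - t) ^ 2)⁻¹ * (inner ℂ (p x) (∂_{e} p x)).re := by
    have i3 := (integrable_inner g (∂_{e} g)).re.add i1
    refine i3.congr (.of_forall fun x ↦ ?_)
    have := hpt x
    simp only [Pi.add_apply, RCLike.re_to_complex]
    linarith
  rw [integral_sub i2 i1] at h0
  linarith

lemma inv_one_add_sq_le_one (y : ℝ) : (1 + y ^ 2)⁻¹ ≤ 1 :=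
  inv_le_one_of_one_le₀ (by nlinarith [sq_nonneg y])

lemma integrable_inv_one_add_sq_mul {e : E} (t : ℝ) {f : E → ℝ} (hf : Integrable f) :
    Integrable fun x ↦ (1 + (inner ℝ x e - t) ^ 2)⁻¹ * f x := by
  refine hf.norm.mono' ((continuous_inv_one_add_sq
    (by fun_prop)).aestronglyMeasurable.mul hf.1) (.of_forall fun x ↦ ?_)
  rw [norm_mul, Real.norm_of_nonneg (by positivity)]
  exact mul_le_of_le_one_left (norm_nonneg _) (inv_one_add_sq_le_one _)

lemma hasDerivAt_inv_one_add_sub_sq (a t : ℝ) :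
    HasDerivAt (fun t ↦ (1 + (a - t) ^ 2)⁻¹) (2 * ((a - t) * ((1 + (a - t) ^ 2)⁻¹) ^ 2)) t := by
  have h := ((((hasDerivAt_id t).const_sub a).fun_pow 2).const_add 1).fun_inv
    (by simp; positivity)
  refine h.congr_deriv ?_
  simp only [id_eq]
  field_simp
  simp [mul_comm]

lemma hasDerivAt_arctan_const_sub (a t : ℝ) :
    HasDerivAt (fun t ↦ arctan (a - t)) (-(1 + (a - t) ^ 2)⁻¹) t := by
  simpa using ((hasDerivAt_id t).const_sub a).arctan

/-- If `∂ₑ p + q = F` and `q` is accretive relative to `p` in all the weights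
`(1 + (⟨x, e⟩ - t)²)⁻¹`, then `p` is controlled by `F` on slabs orthogonal to `e`. -/
lemma integral_inv_one_add_sq_mul_le {e : E} (he : ‖e‖ = 1) {p q F : 𝓢(E, V)}
    (hpq : ∂_{e} p + q = F)
    (hpos : ∀ t, 0 ≤ ∫ x, (1 + (inner ℝ x e - t) ^ 2)⁻¹ * (inner ℂ (p x) (q x)).re) (t : ℝ) :
    ∫ x, (1 + (inner ℝ x e - t) ^ 2)⁻¹ * ‖p x‖ ^ 2 ≤ 2 * π * ∫ x, ‖F x‖ * ‖p x‖ := by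
  have iFp := integrable_norm_mul_norm F p
  have ip := integrable_norm_sq p
  have mA (t : ℝ) : AEStronglyMeasurable (fun x : E ↦ arctan (inner ℝ x e - t)) :=
    (continuous_arctan.comp (by fun_prop)).aestronglyMeasurable
  have iA (t : ℝ) : Integrable fun x ↦ arctan (inner ℝ x e - t) * (‖F x‖ * ‖p x‖) := by
    refine (iFp.const_mul (π / 2)).mono' ((mA t).mul iFp.1) (.of_forall fun x ↦ ?_)
    rw [norm_mul, Real.norm_of_nonneg (by positivity : 0 ≤ ‖F x‖ * ‖p x‖)]
    gcongr
    exact (abs_le.mpr ⟨(neg_pi_div_two_lt_arctan _).le, (arctan_lt_pi_div_two _).le⟩)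
  set G : ℝ → E → ℝ := fun t x ↦
    (1 + (inner ℝ x e - t) ^ 2)⁻¹ * ‖p x‖ ^ 2 + 2 * (arctan (inner ℝ x e - t) * (‖F x‖ * ‖p x‖))
  set G' : ℝ → E → ℝ := fun t x ↦
    2 * ((inner ℝ x e - t) * ((1 + (inner ℝ x e - t) ^ 2)⁻¹) ^ 2 * ‖p x‖ ^ 2) -
      2 * ((1 + (inner ℝ x e - t) ^ 2)⁻¹ * (‖F x‖ * ‖p x‖))
  have iG (t : ℝ) : Integrable (G t) :=
    (integrable_inv_one_add_sq_mul t ip).add ((iA t).const_mul 2)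
  have iQ (t : ℝ) := integrable_sub_mul_inv_one_add_sq_sq_mul e t p
  have iP := fun t ↦ integrable_inv_one_add_sq_mul (e := e) t iFp
  have iG' (t : ℝ) : Integrable (G' t) := ((iQ t).const_mul 2).sub ((iP t).const_mul 2)
  have hderiv (t : ℝ) : HasDerivAt (fun t ↦ ∫ x, G t x) (∫ x, G' t x) t := by
    refine (hasDerivAt_integral_of_dominated_loc_of_deriv_le (s := Set.univ)
      (bound := fun x ↦ 2 * ‖p x‖ ^ 2 + 2 * (‖F x‖ * ‖p x‖)) univ_mem (.of_forall fun t ↦ (iG t).1)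
      (iG t) (iG' t).1 (.of_forall fun x t _ ↦ ?_) ((ip.const_mul 2).add (iFp.const_mul 2))
      (.of_forall fun x t _ ↦ ?_)).2
    · refine (norm_sub_le _ _).trans ?_
      simp only [norm_mul, Real.norm_ofNat, norm_norm, norm_pow]
      gcongr 2 * ?_ + 2 * ?_
      · refine mul_le_of_le_one_left (by positivity) ?_
        simpa using abs_mul_inv_one_add_sq_sq_le (inner ℝ x e - t)
      · refine mul_le_of_le_one_left (by positivity) ?_
        rw [Real.norm_of_nonneg (by positivity)]
        exact inv_one_add_sq_le_one _
    · have h := ((hasDerivAt_inv_one_add_sub_sq (inner ℝ x e) t).mul_const (‖p x‖ ^ 2)).add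
        (((hasDerivAt_arctan_const_sub (inner ℝ x e) t).mul_const (‖F x‖ * ‖p x‖)).const_mul 2)
      refine h.congr_deriv ?_
      simp only [G']
      ring
  have hle (t : ℝ) : ∫ x, G' t x ≤ 0 := by
    have i1 := integrable_inv_one_add_sq_mul (e := e) t (integrable_inner p (∂_{e} p)).re
    have i2 := integrable_inv_one_add_sq_mul (e := e) t (integrable_inner p q).re
    simp only [RCLike.re_to_complex] at i1 i2
    have h1 : ∫ x, (1 + (inner ℝ x e - t) ^ 2)⁻¹ * (inner ℂ (p x) (∂_{e} p x)).re +
        (1 + (inner ℝ x e - t) ^ 2)⁻¹ * (inner ℂ (p x) (q x)).re ≤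
        ∫ x, (1 + (inner ℝ x e - t) ^ 2)⁻¹ * (‖F x‖ * ‖p x‖) := by
      refine integral_mono (i1.add i2) (iP t) fun x ↦ ?_
      dsimp only
      rw [← mul_add, ← Complex.add_re, ← inner_add_right, ← hpq, mul_comm ‖_‖]
      gcongr
      exact re_inner_le_norm (𝕜 := ℂ) (p x) _
    rw [integral_add i1 i2] at h1
    rw [integral_sub ((iQ t).const_mul 2) ((iP t).const_mul 2), integral_const_mul,
      integral_const_mul, integral_inner_sub_mul_sq he]
    linarith [hpos t]
  have hanti : Antitone fun t ↦ ∫ x, G t x :=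
    antitone_of_hasDerivAt_nonpos hderiv hle
  have hlim : Tendsto (fun t ↦ ∫ x, G t x) atBot
      (𝓝 (∫ x, (0 * ‖p x‖ ^ 2 + 2 * (π / 2 * (‖F x‖ * ‖p x‖))))) := by
    refine tendsto_integral_filter_of_dominated_convergence
      (fun x ↦ ‖p x‖ ^ 2 + 2 * (π / 2 * (‖F x‖ * ‖p x‖))) (.of_forall fun t ↦ (iG t).1)
      (.of_forall fun t ↦ .of_forall fun x ↦ ?_) (ip.add ((iFp.const_mul _).const_mul _))
      (.of_forall fun x ↦ ?_)
    · refine (norm_add_le _ _).trans ?_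
      simp only [norm_mul, Real.norm_ofNat, norm_norm, norm_pow]
      gcongr ?_ + 2 * (?_ * _)
      · refine mul_le_of_le_one_left (by positivity) ?_
        rw [Real.norm_of_nonneg (by positivity)]
        exact inv_one_add_sq_le_one _
      · exact (abs_le.mpr ⟨(neg_pi_div_two_lt_arctan _).le, (arctan_lt_pi_div_two _).le⟩)
    · have h1 : Tendsto (fun t : ℝ ↦ inner ℝ x e - t) atBot atTop := by
        simpa [sub_eq_add_neg] using
          tendsto_atTop_add_const_left atBot (inner ℝ x e) (tendsto_neg_atBot_atTop (G := ℝ))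
      refine Tendsto.add (.mul_const _ ?_) (.const_mul _ (.mul_const _ ?_))
      · refine tendsto_inv_atTop_zero.comp ?_
        exact tendsto_atTop_add_const_left _ _ ((tendsto_pow_atTop two_ne_zero).comp h1)
      · exact (tendsto_nhds_of_tendsto_nhdsWithin tendsto_arctan_atTop).comp h1
  have hfin : ∫ x, G t x ≤ π * ∫ x, ‖F x‖ * ‖p x‖ := by
    refine (hanti.ge_of_tendsto hlim t).trans_eq ?_
    rw [← integral_const_mul]
    congr 1
    funext x
    ring
  have hlow : -(π / 2 * ∫ x, ‖F x‖ * ‖p x‖) ≤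
      ∫ x, arctan (inner ℝ x e - t) * (‖F x‖ * ‖p x‖) := by
    rw [← integral_const_mul, ← integral_neg]
    refine integral_mono (iFp.const_mul _).neg (iA t) fun x ↦ ?_
    dsimp only
    rw [← neg_mul]
    gcongr
    exact (neg_pi_div_two_lt_arctan _).le
  rw [integral_add (integrable_inv_one_add_sq_mul t ip) ((iA t).const_mul 2),
    integral_const_mul] at hfin
  linarith

/-! ### Weighted estimates -/

lemma integrable_one_add_sq_rpow {s : ℝ} (hs : 1 / 2 < s) :
    Integrable fun t : ℝ ↦ (1 + t ^ 2) ^ (-s) := by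
  have h := integrable_rpow_neg_one_add_norm_sq (E := ℝ) (μ := volume) (r := 2 * s)
    (by simp; linarith)
  simpa [neg_div] using h

lemma one_add_sq_rpow_le_integral {s : ℝ} (hs : 1 / 2 < s) (a : ℝ) :
    (1 + a ^ 2) ^ (-s) ≤
      2 ^ (s + 1) * ∫ t, (1 + t ^ 2) ^ (-s) * (1 + (a - t) ^ 2)⁻¹ := by
  have hi : Integrable fun t : ℝ ↦ (1 + t ^ 2) ^ (-s) * (1 + (a - t) ^ 2)⁻¹ := by
    refine (integrable_one_add_sq_rpow hs).mono' ((integrable_one_add_sq_rpow hs).1.mul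
      (continuous_inv_one_add_sq (by fun_prop)).aestronglyMeasurable) (.of_forall fun t ↦ ?_)
    rw [Real.norm_of_nonneg (by positivity)]
    exact mul_le_of_le_one_right (by positivity) (inv_one_add_sq_le_one _)
  have hlow (t : ℝ) (ht : t ∈ Set.Icc (a - 1 / 2) (a + 1 / 2)) :
      (2 * (1 + a ^ 2)) ^ (-s) * 2⁻¹ ≤ (1 + t ^ 2) ^ (-s) * (1 + (a - t) ^ 2)⁻¹ := by
    obtain ⟨h1, h2⟩ := ht
    have h3 : (a - t) ^ 2 ≤ 1 / 4 := by nlinarith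
    gcongr ?_ * ?_
    · refine Real.rpow_le_rpow_of_nonpos (by positivity) ?_ (by linarith)
      nlinarith [sq_nonneg (a + (a - t))]
    · gcongr
      linarith
  have h1 : (2 * (1 + a ^ 2)) ^ (-s) * 2⁻¹ ≤ ∫ t, (1 + t ^ 2) ^ (-s) * (1 + (a - t) ^ 2)⁻¹ := by
    calc (2 * (1 + a ^ 2)) ^ (-s) * 2⁻¹
        = ∫ t in Set.Icc (a - 1 / 2) (a + 1 / 2), (2 * (1 + a ^ 2)) ^ (-s) * 2⁻¹ := by
          rw [setIntegral_const]
          simp [Measure.real]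
          norm_num
      _ ≤ ∫ t in Set.Icc (a - 1 / 2) (a + 1 / 2), (1 + t ^ 2) ^ (-s) * (1 + (a - t) ^ 2)⁻¹ :=
          setIntegral_mono_on (integrableOn_const (by simp)) hi.integrableOn measurableSet_Icc hlow
      _ ≤ _ := setIntegral_le_integral hi (.of_forall fun t ↦ by positivity)
  calc (1 + a ^ 2) ^ (-s) = 2 ^ (s + 1) * ((2 * (1 + a ^ 2)) ^ (-s) * 2⁻¹) := by
        rw [Real.mul_rpow zero_le_two (by positivity), Real.rpow_add zero_lt_two,
          Real.rpow_neg zero_le_two s, Real.rpow_one]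
        have : (2 : ℝ) ^ s ≠ 0 := by positivity
        field_simp
    _ ≤ _ := by gcongr

lemma hasTemperateGrowth_one_add_inner_sq_rpow (e : E) (r : ℝ) :
    (fun x : E ↦ (1 + (inner ℝ x e) ^ 2) ^ r).HasTemperateGrowth := by
  have h : (fun x : E ↦ inner ℝ x e).HasTemperateGrowth := by fun_prop
  simpa [Function.comp_def] using
    (Function.hasTemperateGrowth_one_add_norm_sq_rpow ℝ r).comp h

/-- A bound for all Cauchy weights gives a bound for the weight `(1 + ⟨x, e⟩²)⁻ˢ`. -/
lemma integral_one_add_sq_rpow_mul_le {s : ℝ} (hs : 1 / 2 < s) {e : E} (p : 𝓢(E, V)) {B : ℝ}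
    (hB : ∀ t, ∫ x, (1 + (inner ℝ x e - t) ^ 2)⁻¹ * ‖p x‖ ^ 2 ≤ B) :
    ∫ x, (1 + (inner ℝ x e) ^ 2) ^ (-s) * ‖p x‖ ^ 2 ≤
      2 ^ (s + 1) * (∫ t : ℝ, (1 + t ^ 2) ^ (-s)) * B := by
  have hw := integrable_one_add_sq_rpow hs
  have hi : Integrable (Function.uncurry fun (x : E) (t : ℝ) ↦
      (1 + t ^ 2) ^ (-s) * (1 + (inner ℝ x e - t) ^ 2)⁻¹ * ‖p x‖ ^ 2)
      (volume.prod volume) := by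
    have h := (integrable_norm_sq p).mul_prod hw
    refine h.mono' ?_ (.of_forall fun z ↦ ?_)
    · refine Continuous.aestronglyMeasurable ?_
      refine ((Continuous.rpow_const (by fun_prop) fun z ↦ .inl (by positivity)).mul
        (continuous_inv_one_add_sq (by fun_prop))).mul ?_
      fun_prop
    · simp only [Function.uncurry]
      rw [Real.norm_of_nonneg (by positivity), mul_comm]
      gcongr
      exact mul_le_of_le_one_right (by positivity) (inv_one_add_sq_le_one _)
  calc ∫ x, (1 + (inner ℝ x e) ^ 2) ^ (-s) * ‖p x‖ ^ 2
      ≤ ∫ x, 2 ^ (s + 1) *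
          ∫ t, (1 + t ^ 2) ^ (-s) * (1 + (inner ℝ x e - t) ^ 2)⁻¹ * ‖p x‖ ^ 2 := by
        refine integral_mono (integrable_mul_norm_sq
          (hasTemperateGrowth_one_add_inner_sq_rpow e _) p)
          (hi.integral_prod_left.const_mul _) fun x ↦ ?_
        dsimp only
        rw [integral_mul_const, ← mul_assoc]
        gcongr
        exact one_add_sq_rpow_le_integral hs _
    _ = 2 ^ (s + 1) * ∫ t : ℝ, ∫ x, (1 + t ^ 2) ^ (-s) *
          (1 + (inner ℝ x e - t) ^ 2)⁻¹ * ‖p x‖ ^ 2 := by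
        rw [integral_const_mul, integral_integral_swap hi]
    _ ≤ 2 ^ (s + 1) * ∫ t : ℝ, (1 + t ^ 2) ^ (-s) * B := by
        gcongr ?_ * ?_
        refine integral_mono hi.integral_prod_right (hw.mul_const B) fun t ↦ ?_
        simp only [mul_assoc]
        rw [integral_const_mul]
        gcongr
        exact hB t
    _ = _ := by rw [integral_mul_const, mul_assoc]

/-- The weighted transport estimate. -/
lemma integral_rpow_mul_norm_sq_le_of_transport {s : ℝ} (hs : 1 / 2 < s) {e : E} (he : ‖e‖ = 1)
    {p q F : 𝓢(E, V)} (hpq : ∂_{e} p + q = F)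
    (hpos : ∀ t, 0 ≤ ∫ x, (1 + (inner ℝ x e - t) ^ 2)⁻¹ * (inner ℂ (p x) (q x)).re) :
    ∫ x, (1 + (inner ℝ x e) ^ 2) ^ (-s) * ‖p x‖ ^ 2 ≤
      (2 ^ (s + 1) * (∫ t : ℝ, (1 + t ^ 2) ^ (-s)) * (2 * π)) ^ 2 *
        ∫ x, (1 + (inner ℝ x e) ^ 2) ^ s * ‖F x‖ ^ 2 := by
  set A := 2 ^ (s + 1) * (∫ t : ℝ, (1 + t ^ 2) ^ (-s)) * (2 * π) with hA
  have hA0 : 0 ≤ A := by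
    have : 0 ≤ ∫ t : ℝ, (1 + t ^ 2) ^ (-s) := integral_nonneg fun t ↦ by positivity
    positivity
  have i1 := integrable_mul_norm_sq (hasTemperateGrowth_one_add_inner_sq_rpow e (-s)) p
  have i2 := integrable_mul_norm_sq (hasTemperateGrowth_one_add_inner_sq_rpow e s) F
  have h1 : ∫ x, (1 + (inner ℝ x e) ^ 2) ^ (-s) * ‖p x‖ ^ 2 ≤ A * ∫ x, ‖F x‖ * ‖p x‖ := by
    refine (integral_one_add_sq_rpow_mul_le hs p
      (integral_inv_one_add_sq_mul_le he hpq hpos)).trans_eq ?_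
    rw [hA]
    ring
  have h2 : ∫ x, 2 * (A * (‖F x‖ * ‖p x‖)) ≤ ∫ x, (A ^ 2 * ((1 + (inner ℝ x e) ^ 2) ^ s * ‖F x‖ ^ 2)
      + (1 + (inner ℝ x e) ^ 2) ^ (-s) * ‖p x‖ ^ 2) := by
    refine integral_mono (((integrable_norm_mul_norm F p).const_mul A).const_mul 2)
      ((i2.const_mul _).add i1) fun x ↦ ?_
    dsimp only
    have hρ : 0 < (1 + (inner ℝ x e) ^ 2) ^ s := by positivity
    rw [Real.rpow_neg (by positivity)]
    set ρ := (1 + (inner ℝ x e) ^ 2) ^ s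
    have h3 : 0 ≤ ρ⁻¹ * (A * ρ * ‖F x‖ - ‖p x‖) ^ 2 := by positivity
    have h4 : ρ⁻¹ * (A * ρ * ‖F x‖ - ‖p x‖) ^ 2 =
        A ^ 2 * (ρ * ‖F x‖ ^ 2) + ρ⁻¹ * ‖p x‖ ^ 2 - 2 * (A * (‖F x‖ * ‖p x‖)) := by
      field_simp
      ring
    linarith
  rw [integral_const_mul, integral_const_mul, integral_add (i2.const_mul _) i1,
    integral_const_mul] at h2
  linarith

/-! ### Fourier multipliers -/

section Multiplier

open scoped Laplacian

variable [CompleteSpace V]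

lemma fourier_injective : Function.Injective (𝓕 : 𝓢(E, V) → 𝓢(E, V)) := fun f g h ↦ by
  rw [← FourierTransform.fourierInv_fourier_eq (F := 𝓢(E, V)) f, h,
    FourierTransform.fourierInv_fourier_eq]

lemma fourier_fourierMultiplierCLM_apply {b : E → ℂ} (hb : b.HasTemperateGrowth) (f : 𝓢(E, V))
    (ξ : E) : 𝓕 (SchwartzMap.fourierMultiplierCLM V b f) ξ = b ξ • 𝓕 f ξ := by
  rw [SchwartzMap.fourierMultiplierCLM_apply, FourierTransform.fourier_fourierInv_eq,
    SchwartzMap.smulLeftCLM_apply_apply hb]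

lemma fourier_lineDerivOp_apply (f : 𝓢(E, V)) (e ξ : E) :
    𝓕 (∂_{e} f) ξ = (2 * π * Complex.I * inner ℝ ξ e) • 𝓕 f ξ := by
  rw [SchwartzMap.fourier_lineDerivOp_eq, smul_apply,
    SchwartzMap.smulLeftCLM_apply_apply (by fun_prop), ← Complex.coe_smul, smul_smul]

lemma fourier_laplacian_apply (f : 𝓢(E, V)) (ξ : E) :
    𝓕 (Δ f) ξ = (-(4 * π ^ 2 * ‖ξ‖ ^ 2) : ℂ) • 𝓕 f ξ := by
  rw [SchwartzMap.laplacian_eq_fourierMultiplierCLM, SchwartzMap.fourierMultiplierCLM_apply,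
    FourierTransform.fourier_smul, FourierTransform.fourier_fourierInv_eq, smul_apply,
    SchwartzMap.smulLeftCLM_apply_apply (by fun_prop), smul_smul, ← Complex.coe_smul]
  congr 1
  push_cast
  ring

/-- A multiplier whose symbol does not depend on the direction `e` commutes with multiplication
by `⟨x, e⟩`. -/
lemma fourierMultiplierCLM_smulLeftCLM_inner {b : E → ℂ} (hb : b.HasTemperateGrowth) {e : E}
    (hbe : ∀ ξ, HasLineDerivAt ℝ b 0 ξ e) (g : 𝓢(E, V)) :
    SchwartzMap.fourierMultiplierCLM V b (SchwartzMap.smulLeftCLM V (inner ℝ · e) g) =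
      SchwartzMap.smulLeftCLM V (inner ℝ · e) (SchwartzMap.fourierMultiplierCLM V b g) := by
  have h1 := SchwartzMap.lineDerivOp_fourier_eq g e
  have h2 := SchwartzMap.fourierInv_lineDerivOp_eq (SchwartzMap.smulLeftCLM V b (𝓕 g)) e
  have h3 : ∂_{e} (SchwartzMap.smulLeftCLM V b (𝓕 g)) =
      SchwartzMap.smulLeftCLM V b (∂_{e} (𝓕 g)) := by
    ext ξ
    rw [lineDerivOp_smulLeftCLM_apply hb _ _ _ (hbe ξ), zero_smul, add_zero,
      SchwartzMap.smulLeftCLM_apply_apply hb]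
  rw [h3, h1, FourierTransform.fourier_smul, map_smul, FourierTransform.fourierInv_smul,
    ← SchwartzMap.fourierMultiplierCLM_apply, ← SchwartzMap.fourierMultiplierCLM_apply] at h2
  exact smul_right_injective _ (by simp [Real.pi_ne_zero]) h2

lemma fourierMultiplierCLM_cauchyFactor {b : E → ℂ} (hb : b.HasTemperateGrowth) {e : E}
    (hbe : ∀ ξ, HasLineDerivAt ℝ b 0 ξ e) (t : ℝ) (p : 𝓢(E, V)) :
    SchwartzMap.fourierMultiplierCLM V b (SchwartzMap.smulLeftCLM V (cauchyFactor e t) p) =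
      SchwartzMap.smulLeftCLM V (cauchyFactor e t) (SchwartzMap.fourierMultiplierCLM V b p) := by
  have hh := hasTemperateGrowth_cauchyFactor e t
  have hi : (fun x : E ↦ inner ℝ x e).HasTemperateGrowth := by fun_prop
  set g := SchwartzMap.smulLeftCLM V (cauchyFactor e t) p
  have hp : p = SchwartzMap.smulLeftCLM V (inner ℝ · e) g - ((t : ℂ) - Complex.I) • g := by
    ext x
    rw [sub_apply, smul_apply, SchwartzMap.smulLeftCLM_apply_apply hi,
      ← Complex.coe_smul, ← sub_smul, SchwartzMap.smulLeftCLM_apply_apply hh, smul_smul,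
      cauchyFactor, mul_inv_cancel₀ (cauchyFactor_denom_ne_zero _ _), one_smul]
  ext x
  conv_rhs => rw [hp]
  rw [map_sub, map_smul, fourierMultiplierCLM_smulLeftCLM_inner hb hbe,
    SchwartzMap.smulLeftCLM_apply_apply hh, sub_apply, smul_apply,
    SchwartzMap.smulLeftCLM_apply_apply hi, ← Complex.coe_smul, ← sub_smul, smul_smul,
    cauchyFactor, inv_mul_cancel₀ (cauchyFactor_denom_ne_zero _ _), one_smul]

lemma re_integral_inner_fourierMultiplierCLM_nonneg {b : E → ℂ} (hb : b.HasTemperateGrowth)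
    (hre : ∀ ξ, 0 ≤ (b ξ).re) (g : 𝓢(E, V)) :
    0 ≤ ∫ x, (inner ℂ (g x) (SchwartzMap.fourierMultiplierCLM V b g x)).re := by
  rw [← re_integral_inner, ← SchwartzMap.integral_inner_fourier_fourier, re_integral_inner]
  refine integral_nonneg fun ξ ↦ ?_
  rw [Pi.zero_apply, fourier_fourierMultiplierCLM_apply hb, inner_smul_right,
    inner_self_eq_norm_sq_to_K]
  have : (b ξ * ((‖𝓕 g ξ‖ : ℝ) : ℂ) ^ 2).re = (b ξ).re * ‖𝓕 g ξ‖ ^ 2 := by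
    rw [← Complex.ofReal_pow, Complex.re_mul_ofReal]
  refine this.symm ▸ mul_nonneg (hre ξ) (by positivity)

/-- A multiplier whose symbol does not depend on `e` and has nonnegative real part is accretive
in the weights `(1 + (⟨x, e⟩ - t)²)⁻¹`. -/
lemma integral_inv_one_add_sq_mul_inner_fourierMultiplierCLM_nonneg {b : E → ℂ}
    (hb : b.HasTemperateGrowth) (hre : ∀ ξ, 0 ≤ (b ξ).re) {e : E}
    (hbe : ∀ ξ, HasLineDerivAt ℝ b 0 ξ e) (p : 𝓢(E, V)) (t : ℝ) :
    0 ≤ ∫ x, (1 + (inner ℝ x e - t) ^ 2)⁻¹ *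
      (inner ℂ (p x) (SchwartzMap.fourierMultiplierCLM V b p x)).re := by
  have hh := hasTemperateGrowth_cauchyFactor e t
  refine (re_integral_inner_fourierMultiplierCLM_nonneg hb hre
    (SchwartzMap.smulLeftCLM V (cauchyFactor e t) p)).trans_eq ?_
  congr 1
  funext x
  rw [fourierMultiplierCLM_cauchyFactor hb hbe, SchwartzMap.smulLeftCLM_apply_apply hh,
    SchwartzMap.smulLeftCLM_apply_apply hh, inner_smul_left, inner_smul_right, ← mul_assoc,
    Complex.conj_mul', ← norm_sq_cauchyFactor, ← Complex.ofReal_pow, Complex.re_ofReal_mul]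

/-! ### Directional derivatives of solutions of the Helmholtz equation -/

/-- The symbol `(4π²(‖ξ‖² - ⟨ξ, e⟩²) - κ)^(1/2)`. -/
def transverseRoot (e : E) (κ : ℂ) (ξ : E) : ℂ :=
  (((4 * π ^ 2 * (‖ξ‖ ^ 2 - (inner ℝ ξ e) ^ 2) : ℝ) : ℂ) - κ) ^ ((1 / 2 : ℝ) : ℂ)

lemma hasTemperateGrowth_transverseRoot (e : E) {κ : ℂ} (hκ : κ.im ≠ 0) :
    (transverseRoot e κ).HasTemperateGrowth :=
  Function.HasTemperateGrowth.ofReal_sub_cpow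
    (f := fun ξ : E ↦ 4 * π ^ 2 * (‖ξ‖ ^ 2 - (inner ℝ ξ e) ^ 2)) (by fun_prop) hκ _

lemma transverseRoot_mul_self (e : E) (κ : ℂ) (ξ : E) :
    transverseRoot e κ ξ * transverseRoot e κ ξ =
      4 * π ^ 2 * (‖ξ‖ ^ 2 - (inner ℝ ξ e) ^ 2) - κ := by
  rw [← pow_two, transverseRoot]
  have := Complex.cpow_nat_inv_pow
    (((4 * π ^ 2 * (‖ξ‖ ^ 2 - (inner ℝ ξ e) ^ 2) : ℝ) : ℂ) - κ) two_ne_zero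
  push_cast at this ⊢
  simp

lemma re_transverseRoot_nonneg (e : E) (κ : ℂ) (ξ : E) : 0 ≤ (transverseRoot e κ ξ).re := by
  have h : (((1 / 2 : ℝ) : ℂ)) = 2⁻¹ := by simp
  rw [transverseRoot, h, Complex.cpow_inv_two_re]
  exact Real.sqrt_nonneg _

lemma transverseRoot_neg (e : E) (κ : ℂ) : transverseRoot (-e) κ = transverseRoot e κ := by
  funext ξ
  simp [transverseRoot]

lemma hasLineDerivAt_transverseRoot {e : E} (he : ‖e‖ = 1) (κ : ℂ) (ξ : E) :
    HasLineDerivAt ℝ (transverseRoot e κ) 0 ξ e := by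
  have h : (fun r : ℝ ↦ transverseRoot e κ (ξ + r • e)) = fun _ ↦ transverseRoot e κ ξ := by
    funext r
    have : ‖ξ + r • e‖ ^ 2 - (inner ℝ (ξ + r • e) e) ^ 2 = ‖ξ‖ ^ 2 - (inner ℝ ξ e) ^ 2 := by
      rw [norm_add_sq_real, inner_add_left, inner_smul_left, inner_smul_right,
        real_inner_self_eq_norm_sq, norm_smul, he]
      simp
      ring
    rw [transverseRoot, this, transverseRoot]
  rw [HasLineDerivAt, h]
  exact hasDerivAt_const _ _

lemma integral_norm_sq_lineDerivOp_add_le {s : ℝ} (hs : 1 / 2 < s) {e : E} (he : ‖e‖ = 1) {κ : ℂ}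
    (hκ : κ.im ≠ 0) (w : 𝓢(E, V)) :
    ∫ x, (1 + (inner ℝ x e) ^ 2) ^ (-s) *
        ‖(SchwartzMap.fourierMultiplierCLM V (transverseRoot e κ) w - ∂_{e} w) x‖ ^ 2 ≤
      (2 ^ (s + 1) * (∫ t : ℝ, (1 + t ^ 2) ^ (-s)) * (2 * π)) ^ 2 *
        ∫ x, (1 + (inner ℝ x e) ^ 2) ^ s * ‖(-Δ w - κ • w) x‖ ^ 2 := by
  have hb := hasTemperateGrowth_transverseRoot e hκ
  refine integral_rpow_mul_norm_sq_le_of_transport hs he ?_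
    (integral_inv_one_add_sq_mul_inner_fourierMultiplierCLM_nonneg hb
      (re_transverseRoot_nonneg e κ) (hasLineDerivAt_transverseRoot he κ) _)
  refine fourier_injective ?_
  ext ξ
  simp only [sub_eq_add_neg, FourierTransform.fourier_add, FourierTransform.fourier_smul,
    FourierTransform.fourier_neg, add_apply, smul_apply, neg_apply,
    fourier_fourierMultiplierCLM_apply hb, fourier_lineDerivOp_apply, fourier_laplacian_apply]
  simp only [← neg_smul, ← add_smul, smul_smul]
  congr 1
  have := transverseRoot_mul_self e κ ξ
  linear_combination this - 4 * π ^ 2 * (inner ℝ ξ e : ℂ) ^ 2 * Complex.I_sq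

/-- Directional derivatives of `w` are controlled by `-Δw - κw`, uniformly in `κ`. -/
lemma integral_rpow_mul_norm_sq_lineDerivOp_le {s : ℝ} (hs : 1 / 2 < s) {e : E} (he : ‖e‖ = 1)
    {κ : ℂ} (hκ : κ.im ≠ 0) (w : 𝓢(E, V)) :
    ∫ x, (1 + (inner ℝ x e) ^ 2) ^ (-s) * ‖∂_{e} w x‖ ^ 2 ≤
      (2 ^ (s + 1) * (∫ t : ℝ, (1 + t ^ 2) ^ (-s)) * (2 * π)) ^ 2 *
        ∫ x, (1 + (inner ℝ x e) ^ 2) ^ s * ‖(-Δ w - κ • w) x‖ ^ 2 := by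
  have h1 := integral_norm_sq_lineDerivOp_add_le hs he hκ w
  have h2 := integral_norm_sq_lineDerivOp_add_le hs (e := -e) (by rwa [norm_neg]) hκ w
  rw [transverseRoot_neg, LineDeriv.lineDerivOp_left_neg, sub_neg_eq_add] at h2
  simp only [inner_neg_right, neg_sq] at h2
  set b := SchwartzMap.fourierMultiplierCLM V (transverseRoot e κ) w
  have hρ := hasTemperateGrowth_one_add_inner_sq_rpow e (-s)
  have h3 : ∫ x, 2 * ((1 + (inner ℝ x e) ^ 2) ^ (-s) * ‖∂_{e} w x‖ ^ 2) ≤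
      ∫ x, ((1 + (inner ℝ x e) ^ 2) ^ (-s) * ‖(b - ∂_{e} w) x‖ ^ 2 +
        (1 + (inner ℝ x e) ^ 2) ^ (-s) * ‖(b + ∂_{e} w) x‖ ^ 2) := by
    refine integral_mono ((integrable_mul_norm_sq hρ _).const_mul 2)
      ((integrable_mul_norm_sq hρ _).add (integrable_mul_norm_sq hρ _)) fun x ↦ ?_
    dsimp only
    rw [← mul_add, mul_left_comm]
    gcongr
    have h4 := parallelogram_law_with_norm ℂ (b x) (∂_{e} w x)
    rw [sub_apply, add_apply]
    nlinarith [sq_nonneg ‖b x‖]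
  rw [integral_const_mul, integral_add (integrable_mul_norm_sq hρ _)
    (integrable_mul_norm_sq hρ _)] at h3
  linarith

end Multiplier

/-! ### The Helmholtz equation -/

section Helmholtz

open scoped Laplacian

variable [CompleteSpace V]

lemma integrable_one_add_norm_sq_rpow_mul_norm_sq (r : ℝ) (f : 𝓢(E, V)) :
    Integrable fun x ↦ (1 + ‖x‖ ^ 2) ^ r * ‖f x‖ ^ 2 :=
  integrable_mul_norm_sq (Function.hasTemperateGrowth_one_add_norm_sq_rpow E r) f

lemma integral_one_add_norm_sq_rpow_mul_norm_sq_lineDerivOp_le {s : ℝ} (hs : 1 / 2 < s) :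
    ∃ A : ℝ, 0 ≤ A ∧ ∀ (e : E), ‖e‖ = 1 → ∀ (κ : ℂ), κ.im ≠ 0 → ∀ (w : 𝓢(E, V)),
      ∫ x, (1 + ‖x‖ ^ 2) ^ (-s) * ‖∂_{e} w x‖ ^ 2 ≤
        A * ∫ x, (1 + ‖x‖ ^ 2) ^ s * ‖(-Δ w - κ • w) x‖ ^ 2 := by
  refine ⟨(2 ^ (s + 1) * (∫ t : ℝ, (1 + t ^ 2) ^ (-s)) * (2 * π)) ^ 2, by positivity,
    fun e he κ hκ w ↦ ?_⟩
  have hle (x : E) : 1 + (inner ℝ x e) ^ 2 ≤ 1 + ‖x‖ ^ 2 := by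
    have := abs_real_inner_le_norm x e
    rw [he, mul_one] at this
    gcongr 1 + ?_
    rw [← sq_abs]
    gcongr
  refine le_trans ?_ ((integral_rpow_mul_norm_sq_lineDerivOp_le hs he hκ w).trans ?_)
  · refine integral_mono (integrable_one_add_norm_sq_rpow_mul_norm_sq _ _)
      (integrable_mul_norm_sq (hasTemperateGrowth_one_add_inner_sq_rpow e _) _) fun x ↦ ?_
    dsimp only
    gcongr ?_ * _
    exact Real.rpow_le_rpow_of_nonpos (by positivity) (hle x) (by linarith)
  · gcongr ?_ * ?_
    refine integral_mono (integrable_mul_norm_sq (hasTemperateGrowth_one_add_inner_sq_rpow e _) _)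
      (integrable_one_add_norm_sq_rpow_mul_norm_sq _ _) fun x ↦ ?_
    dsimp only
    gcongr ?_ * _
    exact Real.rpow_le_rpow (by positivity) (hle x) (by linarith)

lemma hasLineDerivAt_one_add_norm_sq_rpow (r : ℝ) (x e : E) :
    HasLineDerivAt ℝ (fun x : E ↦ (((1 + ‖x‖ ^ 2) ^ r : ℝ) : ℂ))
      ((2 * inner ℝ x e * r * (1 + ‖x‖ ^ 2) ^ (r - 1) : ℝ) : ℂ) x e := by
  have h1 : HasLineDerivAt ℝ (fun x : E ↦ ‖x‖ ^ 2) (2 * inner ℝ x e) x e := by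
    simpa using (hasStrictFDerivAt_norm_sq x).hasFDerivAt.hasLineDerivAt e
  have h2 := HasDerivAt.rpow_const (p := r) (HasDerivAt.const_add 1 h1) (.inl (by positivity))
  simpa [HasLineDerivAt] using h2.ofReal_comp

lemma abs_lineDeriv_one_add_norm_sq_rpow_le (r : ℝ) (x : E) {e : E} (he : ‖e‖ = 1) :
    |2 * inner ℝ x e * r * (1 + ‖x‖ ^ 2) ^ (r - 1)| ≤ |r| * (1 + ‖x‖ ^ 2) ^ r := by
  have h1 : |inner ℝ x e| ≤ ‖x‖ := by simpa [he] using abs_real_inner_le_norm x e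
  have h2 : 2 * |inner ℝ x e| ≤ 1 + ‖x‖ ^ 2 := by nlinarith [sq_nonneg (‖x‖ - 1)]
  rw [abs_mul, abs_mul, abs_mul, abs_two, abs_of_nonneg (a := (1 + ‖x‖ ^ 2) ^ (r - 1))
    (by positivity), mul_right_comm, mul_comm _ |r|]
  gcongr ?_ * ?_
  calc 2 * |inner ℝ x e| * (1 + ‖x‖ ^ 2) ^ (r - 1)
      ≤ (1 + ‖x‖ ^ 2) * (1 + ‖x‖ ^ 2) ^ (r - 1) := by gcongr
    _ = (1 + ‖x‖ ^ 2) ^ r := by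
        rw [Real.rpow_sub_one (by positivity)]
        field_simp

lemma norm_integral_inner_lineDerivOp_lineDerivOp_le (r : ℝ) {e : E} (he : ‖e‖ = 1) {η : ℝ}
    (hη : 0 < η) (w : 𝓢(E, V)) :
    ‖∫ x, (((1 + ‖x‖ ^ 2) ^ r : ℝ) : ℂ) * inner ℂ (w x) (∂_{e} (∂_{e} w) x)‖ ≤
      (1 + r ^ 2 / η) * (∫ x, (1 + ‖x‖ ^ 2) ^ r * ‖∂_{e} w x‖ ^ 2) +
        η * ∫ x, (1 + ‖x‖ ^ 2) ^ r * ‖w x‖ ^ 2 := by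
  have hφ : (fun x : E ↦ (((1 + ‖x‖ ^ 2) ^ r : ℝ) : ℂ)).HasTemperateGrowth := by
    have := Function.hasTemperateGrowth_one_add_norm_sq_rpow E r
    fun_prop
  set W := SchwartzMap.smulLeftCLM V (fun x : E ↦ (((1 + ‖x‖ ^ 2) ^ r : ℝ) : ℂ)) w with hW
  have i1 := integrable_one_add_norm_sq_rpow_mul_norm_sq r (∂_{e} w)
  have i2 := integrable_one_add_norm_sq_rpow_mul_norm_sq r w
  have h1 : ∫ x, (((1 + ‖x‖ ^ 2) ^ r : ℝ) : ℂ) * inner ℂ (w x) (∂_{e} (∂_{e} w) x) =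
      -∫ x, inner ℂ (∂_{e} W x) (∂_{e} w x) := by
    rw [← integral_inner_lineDerivOp]
    congr 1
    funext x
    rw [hW, SchwartzMap.smulLeftCLM_apply_apply hφ, inner_smul_left, Complex.conj_ofReal]
  rw [h1, norm_neg, ← integral_const_mul, ← integral_const_mul,
    ← integral_add (i1.const_mul _) (i2.const_mul _)]
  refine norm_integral_le_of_norm_le ((i1.const_mul _).add (i2.const_mul _))
    (.of_forall fun x ↦ (norm_inner_le_norm _ _).trans ?_)
  have h2 : ‖∂_{e} W x‖ ≤
      (1 + ‖x‖ ^ 2) ^ r * ‖∂_{e} w x‖ + |r| * (1 + ‖x‖ ^ 2) ^ r * ‖w x‖ := by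
    rw [hW, lineDerivOp_smulLeftCLM_apply hφ w e x (hasLineDerivAt_one_add_norm_sq_rpow r x e)]
    refine (norm_add_le _ _).trans ?_
    rw [norm_smul, norm_smul, Complex.norm_real, Complex.norm_real, Real.norm_of_nonneg
      (by positivity : 0 ≤ (1 + ‖x‖ ^ 2) ^ r), Real.norm_eq_abs]
    gcongr
    exact abs_lineDeriv_one_add_norm_sq_rpow_le r x he
  have hρ : 0 ≤ (1 + ‖x‖ ^ 2) ^ r := by positivity
  have h3 : |r| * ‖w x‖ * ‖∂_{e} w x‖ ≤ r ^ 2 / η * ‖∂_{e} w x‖ ^ 2 + η * ‖w x‖ ^ 2 := by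
    have h4 : 0 ≤ η⁻¹ * (|r| * ‖∂_{e} w x‖ - η * ‖w x‖) ^ 2 := by positivity
    have h5 : η⁻¹ * (|r| * ‖∂_{e} w x‖ - η * ‖w x‖) ^ 2 =
        r ^ 2 / η * ‖∂_{e} w x‖ ^ 2 + η * ‖w x‖ ^ 2 - 2 * (|r| * ‖w x‖ * ‖∂_{e} w x‖) := by
      rw [← sq_abs r]
      field_simp
      ring
    have h6 : 0 ≤ |r| * ‖w x‖ * ‖∂_{e} w x‖ := by positivity
    linarith
  calc ‖∂_{e} W x‖ * ‖∂_{e} w x‖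
      ≤ ((1 + ‖x‖ ^ 2) ^ r * ‖∂_{e} w x‖ + |r| * (1 + ‖x‖ ^ 2) ^ r * ‖w x‖) * ‖∂_{e} w x‖ := by
        gcongr
    _ = (1 + ‖x‖ ^ 2) ^ r * (‖∂_{e} w x‖ ^ 2 + |r| * ‖w x‖ * ‖∂_{e} w x‖) := by ring
    _ ≤ (1 + ‖x‖ ^ 2) ^ r *
          (‖∂_{e} w x‖ ^ 2 + (r ^ 2 / η * ‖∂_{e} w x‖ ^ 2 + η * ‖w x‖ ^ 2)) := by gcongr
    _ = _ := by ring

lemma integrable_ofReal_mul_inner {φ : E → ℝ} (hφ : φ.HasTemperateGrowth) (f g : 𝓢(E, V)) :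
    Integrable fun x ↦ (φ x : ℂ) * inner ℂ (f x) (g x) := by
  refine (integrable_inner (SchwartzMap.smulLeftCLM V φ f) g).congr (.of_forall fun x ↦ ?_)
  dsimp only
  rw [SchwartzMap.smulLeftCLM_apply_apply hφ, ← Complex.coe_smul, inner_smul_left,
    Complex.conj_ofReal]

/-- Weighted `L²` bounds for `w` in terms of its gradient and `-Δw - κw`. -/
lemma norm_mul_integral_le {ι : Type*} [Fintype ι] (b : OrthonormalBasis ι ℝ E) {r : ℝ}
    {η : ℝ} (hη : 0 < η) (κ : ℂ) (w : 𝓢(E, V)) :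
    ‖κ‖ * ∫ x, (1 + ‖x‖ ^ 2) ^ r * ‖w x‖ ^ 2 ≤
      (1 + r ^ 2 / η) * (∑ j, ∫ x, (1 + ‖x‖ ^ 2) ^ r * ‖∂_{b j} w x‖ ^ 2) +
        η⁻¹ * (∫ x, (1 + ‖x‖ ^ 2) ^ r * ‖(-Δ w - κ • w) x‖ ^ 2) +
        (Fintype.card ι + 1) * η * ∫ x, (1 + ‖x‖ ^ 2) ^ r * ‖w x‖ ^ 2 := by
  have hφ := Function.hasTemperateGrowth_one_add_norm_sq_rpow E r
  have iw := integrable_one_add_norm_sq_rpow_mul_norm_sq r w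
  set F := -Δ w - κ • w with hF
  have iF := integrable_one_add_norm_sq_rpow_mul_norm_sq r F
  have h1 : κ * ((∫ x, (1 + ‖x‖ ^ 2) ^ r * ‖w x‖ ^ 2 : ℝ) : ℂ) =
      -((∑ j, ∫ x, (((1 + ‖x‖ ^ 2) ^ r : ℝ) : ℂ) * inner ℂ (w x) (∂_{b j} (∂_{b j} w) x)) +
        ∫ x, (((1 + ‖x‖ ^ 2) ^ r : ℝ) : ℂ) * inner ℂ (w x) (F x)) := by
    rw [← integral_finsetSum _ fun j _ ↦ integrable_ofReal_mul_inner hφ w _,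
      ← integral_add (integrable_finsetSum _ fun j _ ↦ integrable_ofReal_mul_inner hφ w _)
        (integrable_ofReal_mul_inner hφ w F), ← integral_neg, ← integral_complex_ofReal,
      ← integral_const_mul]
    congr 1
    funext x
    rw [hF, SchwartzMap.laplacian_eq_sum b, sub_apply, smul_apply, neg_apply, sum_apply,
      inner_sub_right, inner_neg_right, inner_sum, inner_smul_right, inner_self_eq_norm_sq_to_K,
      ← Finset.mul_sum]
    push_cast
    simp only [Complex.coe_algebraMap]
    ring
  have h2 : ‖∫ x, (((1 + ‖x‖ ^ 2) ^ r : ℝ) : ℂ) * inner ℂ (w x) (F x)‖ ≤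
      η⁻¹ * (∫ x, (1 + ‖x‖ ^ 2) ^ r * ‖F x‖ ^ 2) +
        η * ∫ x, (1 + ‖x‖ ^ 2) ^ r * ‖w x‖ ^ 2 := by
    rw [← integral_const_mul, ← integral_const_mul,
      ← integral_add (iF.const_mul _) (iw.const_mul _)]
    refine norm_integral_le_of_norm_le ((iF.const_mul _).add (iw.const_mul _))
      (.of_forall fun x ↦ ?_)
    have hρ : 0 ≤ (1 + ‖x‖ ^ 2) ^ r := by positivity
    rw [norm_mul, Complex.norm_real, Real.norm_of_nonneg hρ]
    have h4 : 0 ≤ η⁻¹ * (‖F x‖ - η * ‖w x‖) ^ 2 := by positivity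
    have h5 : η⁻¹ * (‖F x‖ - η * ‖w x‖) ^ 2 =
        η⁻¹ * ‖F x‖ ^ 2 + η * ‖w x‖ ^ 2 - 2 * (‖w x‖ * ‖F x‖) := by
      field_simp
      ring
    have h6 : 0 ≤ ‖w x‖ * ‖F x‖ := by positivity
    calc (1 + ‖x‖ ^ 2) ^ r * ‖inner ℂ (w x) (F x)‖
        ≤ (1 + ‖x‖ ^ 2) ^ r * (η⁻¹ * ‖F x‖ ^ 2 + η * ‖w x‖ ^ 2) := by
          gcongr
          refine (norm_inner_le_norm _ _).trans ?_
          linarith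
      _ = _ := by ring
  have h3 : ‖∑ j, ∫ x, (((1 + ‖x‖ ^ 2) ^ r : ℝ) : ℂ) * inner ℂ (w x) (∂_{b j} (∂_{b j} w) x)‖ ≤
      (1 + r ^ 2 / η) * (∑ j, ∫ x, (1 + ‖x‖ ^ 2) ^ r * ‖∂_{b j} w x‖ ^ 2) +
        Fintype.card ι * (η * ∫ x, (1 + ‖x‖ ^ 2) ^ r * ‖w x‖ ^ 2) := by
    refine (norm_sum_le_of_le _ fun j _ ↦ norm_integral_inner_lineDerivOp_lineDerivOp_le r
      (b.norm_eq_one j) hη w).trans_eq ?_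
    rw [Finset.sum_add_distrib, ← Finset.mul_sum, Finset.sum_const, nsmul_eq_mul,
      Finset.card_univ]
  have h0 : 0 ≤ ∫ x, (1 + ‖x‖ ^ 2) ^ r * ‖w x‖ ^ 2 := integral_nonneg fun x ↦ by positivity
  have h4 := congrArg norm h1
  rw [norm_mul, Complex.norm_real, Real.norm_of_nonneg h0] at h4
  rw [h4]
  rw [norm_neg]
  refine (norm_add_le _ _).trans ?_
  linarith

/-- The limiting absorption estimate for the Helmholtz equation, with the gradient included. -/
lemma exists_helmholtz_estimate {ι : Type*} [Fintype ι] (b : OrthonormalBasis ι ℝ E) {s : ℝ}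
    (hs : 1 / 2 < s) {δ : ℝ} (hδ : 0 < δ) :
    ∃ B : ℝ, 0 ≤ B ∧ ∀ (κ : ℂ), κ.im ≠ 0 → δ ≤ ‖κ‖ → ∀ (w : 𝓢(E, V)),
      ‖κ‖ * (∫ x, (1 + ‖x‖ ^ 2) ^ (-s) * ‖w x‖ ^ 2) +
        (∑ j, ∫ x, (1 + ‖x‖ ^ 2) ^ (-s) * ‖∂_{b j} w x‖ ^ 2) ≤
        B * ∫ x, (1 + ‖x‖ ^ 2) ^ s * ‖(-Δ w - κ • w) x‖ ^ 2 := by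
  obtain ⟨A, hA, h⟩ := integral_one_add_norm_sq_rpow_mul_norm_sq_lineDerivOp_le (E := E) (V := V) hs
  set d := (Fintype.card ι : ℝ)
  have hd : 0 ≤ d := Nat.cast_nonneg _
  set c := 2 * (d + 1) / δ with hc
  have hc0 : 0 ≤ c := by positivity
  refine ⟨2 * ((1 + s ^ 2 * c) * (d * A) + c) + d * A, by positivity, fun κ hκ hκδ w ↦ ?_⟩
  have hκ0 : 0 < ‖κ‖ := hδ.trans_le hκδ
  set Φ := ∫ x, (1 + ‖x‖ ^ 2) ^ s * ‖(-Δ w - κ • w) x‖ ^ 2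
  have hΦ : 0 ≤ Φ := integral_nonneg fun x ↦ by positivity
  have h1 : ∑ j, ∫ x, (1 + ‖x‖ ^ 2) ^ (-s) * ‖∂_{b j} w x‖ ^ 2 ≤ d * A * Φ := by
    refine (Finset.sum_le_sum fun j _ ↦ h (b j) (b.norm_eq_one j) κ hκ w).trans_eq ?_
    rw [Finset.sum_const, nsmul_eq_mul, Finset.card_univ, mul_assoc]
  have h2 : ∫ x, (1 + ‖x‖ ^ 2) ^ (-s) * ‖(-Δ w - κ • w) x‖ ^ 2 ≤ Φ := by
    refine integral_mono (integrable_one_add_norm_sq_rpow_mul_norm_sq _ _)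
      (integrable_one_add_norm_sq_rpow_mul_norm_sq _ _) fun x ↦ ?_
    dsimp only
    gcongr ?_ * _
    exact Real.rpow_le_rpow_of_exponent_le (by nlinarith [sq_nonneg ‖x‖]) (by linarith)
  have hη : 0 < ‖κ‖ / (2 * (d + 1)) := by positivity
  have h3 := norm_mul_integral_le b (r := -s) hη κ w
  have hηc : (‖κ‖ / (2 * (d + 1)))⁻¹ ≤ c := by
    rw [inv_div, hc]
    gcongr
  rw [div_eq_mul_inv _ (‖κ‖ / _), neg_sq] at h3
  have h4 : (d + 1) * (‖κ‖ / (2 * (d + 1))) = ‖κ‖ / 2 := by field_simp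
  rw [h4] at h3
  have hS : 0 ≤ ∑ j, ∫ x, (1 + ‖x‖ ^ 2) ^ (-s) * ‖∂_{b j} w x‖ ^ 2 :=
    Finset.sum_nonneg fun j _ ↦ integral_nonneg fun x ↦ by positivity
  have hF : 0 ≤ ∫ x, (1 + ‖x‖ ^ 2) ^ (-s) * ‖(-Δ w - κ • w) x‖ ^ 2 :=
    integral_nonneg fun x ↦ by positivity
  have h5 : (1 + s ^ 2 * (‖κ‖ / (2 * (d + 1)))⁻¹) *
      (∑ j, ∫ x, (1 + ‖x‖ ^ 2) ^ (-s) * ‖∂_{b j} w x‖ ^ 2) ≤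
      (1 + s ^ 2 * c) * (d * A * Φ) := by gcongr
  have h6 : (‖κ‖ / (2 * (d + 1)))⁻¹ * ∫ x, (1 + ‖x‖ ^ 2) ^ (-s) * ‖(-Δ w - κ • w) x‖ ^ 2 ≤
      c * Φ := by gcongr
  linarith

end Helmholtz

/-! ### The Dirac operator on Schwartz functions -/

section Dirac

open scoped Laplacian

lemma lineDerivOp_postcompCLM (L : V →L[ℂ] V) (f : 𝓢(E, V)) (e : E) :
    ∂_{e} (SchwartzMap.postcompCLM L f) = SchwartzMap.postcompCLM L (∂_{e} f) := by
  ext x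
  have h : HasFDerivAt (SchwartzMap.postcompCLM L f)
      ((L.restrictScalars ℝ).comp (fderiv ℝ f x)) x :=
    (L.restrictScalars ℝ).hasFDerivAt.comp x f.differentiableAt.hasFDerivAt
  rw [SchwartzMap.lineDerivOp_apply_eq_fderiv, h.fderiv, SchwartzMap.postcompCLM_apply,
    SchwartzMap.lineDerivOp_apply_eq_fderiv]
  rfl

lemma lineDerivOp_comm [CompleteSpace V] (f : 𝓢(E, V)) (e e' : E) :
    ∂_{e} (∂_{e'} f) = ∂_{e'} (∂_{e} f) := by
  refine fourier_injective (SchwartzMap.ext fun ξ ↦ ?_)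
  simp only [fourier_lineDerivOp_apply, smul_smul]
  rw [mul_comm]

variable {ι : Type*} [Fintype ι] (b : OrthonormalBasis ι ℝ E) (a : ι → V →L[ℂ] V) (B : V →L[ℂ] V)
  (m : ℝ)

/-- The Dirac operator `-i ∑ⱼ aⱼ ∂ⱼ + m B` on Schwartz functions. -/
def diracCLM : 𝓢(E, V) →L[ℂ] 𝓢(E, V) :=
  (-Complex.I) • ∑ j, SchwartzMap.postcompCLM (a j) ∘L LineDeriv.lineDerivOpCLM ℂ 𝓢(E, V) (b j) +
    (m : ℂ) • SchwartzMap.postcompCLM B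

lemma diracCLM_apply_apply (w : 𝓢(E, V)) (x : E) :
    diracCLM b a B m w x = (-Complex.I) • ∑ j, a j (∂_{b j} w x) + (m : ℂ) • B (w x) := by
  simp [diracCLM, sum_apply]

lemma lineDerivOp_diracCLM_apply [CompleteSpace V] (w : 𝓢(E, V)) (e x : E) :
    ∂_{e} (diracCLM b a B m w) x = diracCLM b a B m (∂_{e} w) x := by
  have h : diracCLM b a B m w = (-Complex.I) •
      ∑ j, SchwartzMap.postcompCLM (a j) (∂_{b j} w) + (m : ℂ) • SchwartzMap.postcompCLM B w := by
    ext x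
    simp [diracCLM_apply_apply, sum_apply]
  rw [h, diracCLM_apply_apply, LineDeriv.lineDerivOp_add, LineDeriv.lineDerivOp_smul,
    LineDeriv.lineDerivOp_smul, LineDeriv.lineDerivOp_sum]
  simp only [lineDerivOp_postcompCLM, add_apply, smul_apply, sum_apply,
    SchwartzMap.postcompCLM_apply, lineDerivOp_comm w e]

variable {b a B m}

lemma sum_sum_anticomm (ha : ∀ j v, a j (a j v) = v)
    (haa : ∀ j k, j ≠ k → ∀ v, a j (a k v) + a k (a j v) = 0) (h : ι → ι → V)
    (hsymm : ∀ j k, h j k = h k j) : ∑ j, ∑ k, a j (a k (h j k)) = ∑ j, h j j := by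
  have h1 : ∑ j, ∑ k, a j (a k (h j k)) = ∑ j, ∑ k, a k (a j (h j k)) := by
    rw [Finset.sum_comm]
    simp only [hsymm]
  have h2 : (∑ j, ∑ k, a j (a k (h j k))) + ∑ j, ∑ k, a k (a j (h j k)) =
      (2 : ℂ) • ∑ j, h j j := by
    rw [← Finset.sum_add_distrib, Finset.smul_sum]
    refine Finset.sum_congr rfl fun j _ ↦ ?_
    rw [← Finset.sum_add_distrib, Finset.sum_eq_single j]
    · rw [ha, two_smul]
    · exact fun k _ hk ↦ haa j k hk.symm _
    · simp
  rw [← h1, ← two_smul ℂ] at h2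
  exact smul_right_injective V two_ne_zero h2

lemma diracCLM_diracCLM [CompleteSpace V] (ha : ∀ j v, a j (a j v) = v)
    (haa : ∀ j k, j ≠ k → ∀ v, a j (a k v) + a k (a j v) = 0) (hB : ∀ v, B (B v) = v)
    (haB : ∀ j v, a j (B v) + B (a j v) = 0) (w : 𝓢(E, V)) :
    diracCLM b a B m (diracCLM b a B m w) = -Δ w + ((m : ℂ) ^ 2) • w := by
  ext x
  have h1 := sum_sum_anticomm ha haa (fun j k ↦ ∂_{b k} (∂_{b j} w) x)
    fun j k ↦ by rw [lineDerivOp_comm]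
  have h2 : ∑ j, a j (B (∂_{b j} w x)) = -∑ j, B (a j (∂_{b j} w x)) := by
    rw [← Finset.sum_neg_distrib]
    exact Finset.sum_congr rfl fun j _ ↦ eq_neg_of_add_eq_zero_left (haB j _)
  rw [diracCLM_apply_apply]
  simp only [lineDerivOp_diracCLM_apply, diracCLM_apply_apply, map_add, map_smul, map_sum,
    Finset.sum_add_distrib, ← Finset.smul_sum, h1, h2, hB, smul_add, smul_smul, smul_neg]
  rw [SchwartzMap.laplacian_eq_sum b, add_apply, neg_apply, smul_apply, sum_apply]
  have h3 : -Complex.I * -Complex.I = -1 := by simp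
  rw [h3, mul_comm (m : ℂ) (-Complex.I), pow_two]
  module

/-- Every Schwartz function `u` is `(D + λ) w` with `(-Δ - (λ² - m²)) w = (D - λ) u`. -/
lemma exists_diracCLM_add_smul_eq [CompleteSpace V] (ha : ∀ j v, a j (a j v) = v)
    (haa : ∀ j k, j ≠ k → ∀ v, a j (a k v) + a k (a j v) = 0) (hB : ∀ v, B (B v) = v)
    (haB : ∀ j v, a j (B v) + B (a j v) = 0) {lam : ℂ} (hlam : (lam ^ 2 - (m : ℂ) ^ 2).im ≠ 0)
    (u : 𝓢(E, V)) :
    ∃ w : 𝓢(E, V), diracCLM b a B m w + lam • w = u ∧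
      -Δ w - (lam ^ 2 - (m : ℂ) ^ 2) • w = diracCLM b a B m u - lam • u := by
  set κ := lam ^ 2 - (m : ℂ) ^ 2
  have hg : (fun ξ : E ↦ (((4 * π ^ 2 * ‖ξ‖ ^ 2 : ℝ) : ℂ) - κ)⁻¹).HasTemperateGrowth :=
    Function.HasTemperateGrowth.ofReal_sub_inv (f := fun ξ : E ↦ 4 * π ^ 2 * ‖ξ‖ ^ 2)
      (by fun_prop) hlam
  set v := SchwartzMap.fourierMultiplierCLM V
    (fun ξ : E ↦ (((4 * π ^ 2 * ‖ξ‖ ^ 2 : ℝ) : ℂ) - κ)⁻¹) u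
  have hv : -Δ v - κ • v = u := by
    refine fourier_injective (SchwartzMap.ext fun ξ ↦ ?_)
    have hne : ((4 * π ^ 2 * ‖ξ‖ ^ 2 : ℝ) : ℂ) - κ ≠ 0 :=
      Complex.slitPlane_ne_zero (ofReal_sub_mem_slitPlane hlam _)
    simp only [sub_eq_add_neg, FourierTransform.fourier_add, FourierTransform.fourier_smul,
      FourierTransform.fourier_neg, add_apply, smul_apply, neg_apply, fourier_laplacian_apply]
    rw [fourier_fourierMultiplierCLM_apply hg]
    simp only [← neg_smul, ← add_smul, smul_smul]
    convert one_smul ℂ _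
    rw [← mul_inv_cancel₀ hne]
    push_cast
    ring
  have hDD := diracCLM_diracCLM (b := b) (m := m) ha haa hB haB
  set D := diracCLM b a B m
  have hu : D (D v - lam • v) + lam • (D v - lam • v) = u := by
    rw [map_sub, map_smul, hDD]
    conv_rhs => rw [← hv]
    module
  refine ⟨D v - lam • v, hu, ?_⟩
  set w := D v - lam • v
  rw [← hu, map_add, map_smul, hDD]
  module

end Dirac

/-! ### The limiting absorption principle -/

section LimitingAbsorption

open scoped Laplacian

variable [CompleteSpace V] {ι : Type*} [Fintype ι] (b : OrthonormalBasis ι ℝ E)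
  {a : ι → V →L[ℂ] V} {B : V →L[ℂ] V} {m : ℝ}

lemma norm_diracCLM_add_smul_sq_le (w : 𝓢(E, V)) (lam : ℂ) (x : E) :
    ‖(diracCLM b a B m w + lam • w) x‖ ^ 2 ≤ 2 * (∑ j, ‖a j‖ ^ 2) * (∑ j, ‖∂_{b j} w x‖ ^ 2) +
      2 * (|m| * ‖B‖ + ‖lam‖) ^ 2 * ‖w x‖ ^ 2 := by
  have h1 : ‖∑ j, a j (∂_{b j} w x)‖ ≤ ∑ j, ‖a j‖ * ‖∂_{b j} w x‖ :=
    (norm_sum_le _ _).trans (Finset.sum_le_sum fun j _ ↦ (a j).le_opNorm _)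
  have h2 : ‖∑ j, a j (∂_{b j} w x)‖ ^ 2 ≤ (∑ j, ‖a j‖ ^ 2) * ∑ j, ‖∂_{b j} w x‖ ^ 2 :=
    (pow_le_pow_left₀ (norm_nonneg _) h1 2).trans (Finset.sum_mul_sq_le_sq_mul_sq _ _ _)
  have h3 : ‖(diracCLM b a B m w + lam • w) x‖ ≤
      ‖∑ j, a j (∂_{b j} w x)‖ + (|m| * ‖B‖ + ‖lam‖) * ‖w x‖ := by
    rw [add_apply, smul_apply, diracCLM_apply_apply, add_assoc]
    refine (norm_add_le _ _).trans <| add_le_add ?_ ?_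
    · simp [norm_smul]
    refine (norm_add_le _ _).trans ?_
    rw [add_mul, norm_smul, norm_smul, Complex.norm_real, Real.norm_eq_abs, mul_assoc]
    gcongr
    exact B.le_opNorm _
  calc ‖(diracCLM b a B m w + lam • w) x‖ ^ 2
      ≤ (‖∑ j, a j (∂_{b j} w x)‖ + (|m| * ‖B‖ + ‖lam‖) * ‖w x‖) ^ 2 :=
        pow_le_pow_left₀ (norm_nonneg _) h3 2
    _ ≤ 2 * (‖∑ j, a j (∂_{b j} w x)‖ ^ 2 + ((|m| * ‖B‖ + ‖lam‖) * ‖w x‖) ^ 2) := add_sq_le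
    _ ≤ _ := by
      rw [mul_pow]
      linarith

/-- The limiting absorption estimate away from the real and imaginary axes. -/
lemma exists_dirac_estimate_of_im_ne_zero (ha : ∀ j v, a j (a j v) = v)
    (haa : ∀ j k, j ≠ k → ∀ v, a j (a k v) + a k (a j v) = 0) (hB : ∀ v, B (B v) = v)
    (haB : ∀ j v, a j (B v) + B (a j v) = 0) {s δ : ℝ} (hs : 1 / 2 < s) (hδ : 0 < δ) :
    ∃ C : ℝ, 0 ≤ C ∧ ∀ lam : ℂ, (lam ^ 2 - (m : ℂ) ^ 2).im ≠ 0 → δ ≤ ‖lam ^ 2 - (m : ℂ) ^ 2‖ →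
      ∀ u : 𝓢(E, V), ∫ x, (1 + ‖x‖ ^ 2) ^ (-s) * ‖u x‖ ^ 2 ≤
        C * ∫ x, (1 + ‖x‖ ^ 2) ^ s * ‖(diracCLM b a B m u - lam • u) x‖ ^ 2 := by
  obtain ⟨C, hC, h⟩ := exists_helmholtz_estimate (V := V) b hs hδ
  set A := ∑ j, ‖a j‖ ^ 2
  have hA : 0 ≤ A := by positivity
  set M := 2 * m ^ 2 * (‖B‖ ^ 2 + 1) / δ + 2
  have hM : 0 ≤ M := by positivity
  refine ⟨(2 * A + 2 * M) * C, by positivity, fun lam hlam hlam' u ↦ ?_⟩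
  obtain ⟨w, hwu, hw⟩ := exists_diracCLM_add_smul_eq (b := b) ha haa hB haB hlam u
  have hest := h _ hlam hlam' w
  rw [hw] at hest
  set κ := lam ^ 2 - (m : ℂ) ^ 2 with hκ
  have hcoef : (|m| * ‖B‖ + ‖lam‖) ^ 2 ≤ M * ‖κ‖ := by
    have h1 : ‖lam‖ ^ 2 ≤ ‖κ‖ + m ^ 2 := by
      have : lam ^ 2 = κ + (m : ℂ) ^ 2 := by rw [hκ]; ring
      rw [← norm_pow, this]
      refine (norm_add_le _ _).trans (by simp)
    have h2 : 2 * m ^ 2 * (‖B‖ ^ 2 + 1) ≤ 2 * m ^ 2 * (‖B‖ ^ 2 + 1) / δ * ‖κ‖ := by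
      rw [div_mul_eq_mul_div, le_div_iff₀ hδ]
      gcongr
    have h3 : (|m| * ‖B‖ + ‖lam‖) ^ 2 ≤ 2 * ((|m| * ‖B‖) ^ 2 + ‖lam‖ ^ 2) := add_sq_le
    rw [mul_pow, sq_abs] at h3
    simp only [M, add_mul]
    linarith
  have hpt (x : E) : ‖u x‖ ^ 2 ≤
      (2 * A + 2 * M) * (‖κ‖ * ‖w x‖ ^ 2 + ∑ j, ‖∂_{b j} w x‖ ^ 2) := by
    have h1 := norm_diracCLM_add_smul_sq_le (a := a) (B := B) (m := m) b w lam x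
    rw [hwu] at h1
    have h2 : (|m| * ‖B‖ + ‖lam‖) ^ 2 * ‖w x‖ ^ 2 ≤ M * ‖κ‖ * ‖w x‖ ^ 2 := by gcongr
    have h3 : 0 ≤ A * (‖κ‖ * ‖w x‖ ^ 2) := by positivity
    have h4 : 0 ≤ M * ∑ j, ‖∂_{b j} w x‖ ^ 2 := by positivity
    linarith
  have hiw := integrable_one_add_norm_sq_rpow_mul_norm_sq (-s) w
  have hid (j : ι) := integrable_one_add_norm_sq_rpow_mul_norm_sq (-s) (∂_{b j} w)
  have hsum : ∫ x, (2 * A + 2 * M) * (‖κ‖ * ((1 + ‖x‖ ^ 2) ^ (-s) * ‖w x‖ ^ 2) +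
      ∑ j, (1 + ‖x‖ ^ 2) ^ (-s) * ‖∂_{b j} w x‖ ^ 2) =
      (2 * A + 2 * M) * (‖κ‖ * (∫ x, (1 + ‖x‖ ^ 2) ^ (-s) * ‖w x‖ ^ 2) +
        ∑ j, ∫ x, (1 + ‖x‖ ^ 2) ^ (-s) * ‖∂_{b j} w x‖ ^ 2) := by
    rw [integral_const_mul, integral_add (hiw.const_mul _) (integrable_finsetSum _ fun j _ ↦ hid j),
      integral_const_mul, integral_finsetSum _ fun j _ ↦ hid j]
  calc ∫ x, (1 + ‖x‖ ^ 2) ^ (-s) * ‖u x‖ ^ 2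
      ≤ ∫ x, (2 * A + 2 * M) * (‖κ‖ * ((1 + ‖x‖ ^ 2) ^ (-s) * ‖w x‖ ^ 2) +
        ∑ j, (1 + ‖x‖ ^ 2) ^ (-s) * ‖∂_{b j} w x‖ ^ 2) := by
        refine integral_mono (integrable_one_add_norm_sq_rpow_mul_norm_sq (-s) u)
          (((hiw.const_mul _).add (integrable_finsetSum _ fun j _ ↦ hid j)).const_mul _)
          fun x ↦ ?_
        have h1 := mul_le_mul_of_nonneg_left (hpt x)
          (by positivity : (0 : ℝ) ≤ (1 + ‖x‖ ^ 2) ^ (-s))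
        refine h1.trans_eq ?_
        simp only [← Finset.mul_sum]
        ring
    _ ≤ _ := by
      rw [hsum, mul_assoc]
      gcongr

lemma eventually_add_ne_zero (c : ℝ) : ∀ᶠ ε : ℝ in 𝓝[>] 0, c + ε ≠ 0 := by
  by_cases hc : c = 0
  · filter_upwards [self_mem_nhdsWithin] with ε (hε : 0 < ε)
    simpa [hc] using hε.ne'
  · have h : Tendsto (fun ε : ℝ ↦ c + ε) (𝓝[>] 0) (𝓝 c) :=
      ((by fun_prop : Continuous fun ε : ℝ ↦ c + ε).tendsto' 0 c (by simp)).mono_left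
        nhdsWithin_le_nhds
    exact h.eventually_ne hc

/-- The uniform limiting absorption principle for the Dirac operator. -/
theorem exists_dirac_estimate (ha : ∀ j v, a j (a j v) = v)
    (haa : ∀ j k, j ≠ k → ∀ v, a j (a k v) + a k (a j v) = 0) (hB : ∀ v, B (B v) = v)
    (haB : ∀ j v, a j (B v) + B (a j v) = 0) {s δ : ℝ} (hs : 1 / 2 < s) (hδ : 0 < δ) :
    ∃ C : ℝ, 0 ≤ C ∧ ∀ lam : ℂ, δ ≤ ‖lam - m‖ → δ ≤ ‖lam + m‖ →
      ∀ u : 𝓢(E, V), ∫ x, (1 + ‖x‖ ^ 2) ^ (-s) * ‖u x‖ ^ 2 ≤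
        C * ∫ x, (1 + ‖x‖ ^ 2) ^ s * ‖(diracCLM b a B m u - lam • u) x‖ ^ 2 := by
  obtain ⟨C, hC, h⟩ := exists_dirac_estimate_of_im_ne_zero (m := m) b ha haa hB haB hs
    (by positivity : 0 < δ / 2 * (δ / 2))
  refine ⟨C * 2, by positivity, fun lam h1 h2 u ↦ ?_⟩
  set D := diracCLM b a B m
  set X := ∫ x, (1 + ‖x‖ ^ 2) ^ s * ‖(D u - lam • u) x‖ ^ 2
  set Y := ∫ x, (1 + ‖x‖ ^ 2) ^ s * ‖u x‖ ^ 2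
  let z (ε : ℝ) : ℂ := ε * (1 + Complex.I)
  have hz : Continuous z := by fun_prop
  have hlim : Tendsto (fun ε ↦ C * (2 * X + 2 * ‖z ε‖ ^ 2 * Y)) (𝓝[>] 0) (𝓝 (C * 2 * X)) :=
    ((by fun_prop : Continuous fun ε ↦ C * (2 * X + 2 * ‖z ε‖ ^ 2 * Y)).tendsto' 0 _
      (by simp [z, mul_assoc])).mono_left nhdsWithin_le_nhds
  have hnear (c : ℂ) (hc : δ ≤ ‖lam + c‖) : ∀ᶠ ε in 𝓝[>] 0, δ / 2 < ‖lam + z ε + c‖ := by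
    have hc' : Tendsto (fun ε ↦ ‖lam + z ε + c‖) (𝓝[>] 0) (𝓝 ‖lam + c‖) :=
      ((by fun_prop : Continuous fun ε ↦ ‖lam + z ε + c‖).tendsto' 0 _
        (by simp [z])).mono_left nhdsWithin_le_nhds
    exact hc'.eventually_const_lt (by linarith)
  refine ge_of_tendsto hlim ?_
  filter_upwards [hnear (-m) (by simpa [sub_eq_add_neg] using h1), hnear m h2,
    eventually_add_ne_zero lam.re, eventually_add_ne_zero lam.im] with ε e1 e2 e3 e4
  have hfac : (lam + z ε) ^ 2 - (m : ℂ) ^ 2 = (lam + z ε + -m) * (lam + z ε + m) := by ring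
  have him : ((lam + z ε) ^ 2 - (m : ℂ) ^ 2).im ≠ 0 := by
    have : ((lam + z ε) ^ 2 - (m : ℂ) ^ 2).im = 2 * ((lam.re + ε) * (lam.im + ε)) := by
      simp [z, pow_two]
      ring
    rw [this]
    positivity
  have hnorm : δ / 2 * (δ / 2) ≤ ‖(lam + z ε) ^ 2 - (m : ℂ) ^ 2‖ := by
    rw [hfac, norm_mul]
    gcongr
  refine (h _ him hnorm u).trans (mul_le_mul_of_nonneg_left ?_ hC)
  have hi (f : 𝓢(E, V)) := integrable_one_add_norm_sq_rpow_mul_norm_sq s f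
  calc ∫ x, (1 + ‖x‖ ^ 2) ^ s * ‖(D u - (lam + z ε) • u) x‖ ^ 2
      ≤ ∫ x, (2 * ((1 + ‖x‖ ^ 2) ^ s * ‖(D u - lam • u) x‖ ^ 2) +
        2 * ‖z ε‖ ^ 2 * ((1 + ‖x‖ ^ 2) ^ s * ‖u x‖ ^ 2)) := by
        refine integral_mono (hi _) (((hi _).const_mul _).add ((hi _).const_mul _)) fun x ↦ ?_
        have h3 : ‖(D u - (lam + z ε) • u) x‖ ≤ ‖(D u - lam • u) x‖ + ‖z ε‖ * ‖u x‖ := by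
          rw [add_smul, ← sub_sub, sub_apply, smul_apply, ← norm_smul]
          exact norm_sub_le _ _
        have h4 : ‖(D u - (lam + z ε) • u) x‖ ^ 2 ≤
            2 * (‖(D u - lam • u) x‖ ^ 2 + (‖z ε‖ * ‖u x‖) ^ 2) :=
          (pow_le_pow_left₀ (norm_nonneg _) h3 2).trans add_sq_le
        refine (mul_le_mul_of_nonneg_left h4
          (by positivity : (0 : ℝ) ≤ (1 + ‖x‖ ^ 2) ^ s)).trans_eq ?_
        ring
    _ = 2 * X + 2 * ‖z ε‖ ^ 2 * Y := by
      rw [integral_add ((hi _).const_mul _) ((hi _).const_mul _), integral_const_mul,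
        integral_const_mul]

end LimitingAbsorption

end

end DiracLAP

/-- Lemma 6.1: uniform limiting absorption principle for the free Dirac operator.  For a
closed set `K ⊆ ℂ` avoiding the thresholds `±m` and any `s > 1/2` there is `C < ∞` such that
`‖u‖_{L²_{−s}} ≤ C ‖(D_m − λ)u‖_{L²_s}` uniformly in `λ ∈ K`, for Schwartz `u`. -/
theorem dirac_limiting_absorption
    (n N : ℕ) (hn : 1 ≤ n) (m : ℝ) (hm : 0 < m)
    (α : Fin n → Matrix (Fin N) (Fin N) ℂ) (β : Matrix (Fin N) (Fin N) ℂ)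
    (hαh : ∀ j, (α j).IsHermitian) (hβh : β.IsHermitian)
    (hα2 : ∀ j, α j * α j = 1) (hβ2 : β * β = 1)
    (hαα : ∀ j k, j ≠ k → α j * α k + α k * α j = 0)
    (hαβ : ∀ j, α j * β + β * α j = 0)
    (K : Set ℂ) (hK : IsClosed K) (hKm : (m : ℂ) ∉ K) (hKm' : (-m : ℂ) ∉ K) :
    ∀ s : ℝ, 1 / 2 < s → ∃ C : ℝ,
      ∀ lam ∈ K, ∀ u : SchwartzMap (EuclideanSpace ℝ (Fin n)) (EuclideanSpace ℂ (Fin N)),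
        ∫ x, (1 + ‖x‖ ^ 2) ^ (-s) * ‖u x‖ ^ 2
          ≤ C ^ 2 * ∫ x, (1 + ‖x‖ ^ 2) ^ (s : ℝ) * ‖diracOp m α β (⇑u) x - lam • u x‖ ^ 2 := by
  intro s hs
  let a (j : Fin n) := (Matrix.toEuclideanLin (α j)).toContinuousLinearMap
  let B := (Matrix.toEuclideanLin β).toContinuousLinearMap
  have hmul (P Q : Matrix (Fin N) (Fin N) ℂ) (v : EuclideanSpace ℂ (Fin N)) :
      Matrix.toEuclideanLin P (Matrix.toEuclideanLin Q v) = Matrix.toEuclideanLin (P * Q) v := by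
    simp [Matrix.toLpLin_apply]
  have hone (v : EuclideanSpace ℂ (Fin N)) : Matrix.toEuclideanLin 1 v = v := by
    simp
  have hanti {P Q : Matrix (Fin N) (Fin N) ℂ} (h : P * Q + Q * P = 0)
      (v : EuclideanSpace ℂ (Fin N)) : Matrix.toEuclideanLin P (Matrix.toEuclideanLin Q v) +
        Matrix.toEuclideanLin Q (Matrix.toEuclideanLin P v) = 0 := by
    rw [hmul, hmul, ← LinearMap.add_apply, ← map_add, h, map_zero, LinearMap.zero_apply]
  obtain ⟨δ₁, hδ₁, h₁⟩ := Metric.isOpen_iff.mp hK.isOpen_compl _ hKm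
  obtain ⟨δ₂, hδ₂, h₂⟩ := Metric.isOpen_iff.mp hK.isOpen_compl _ hKm'
  obtain ⟨C, hC, h⟩ := DiracLAP.exists_dirac_estimate (m := m) (a := a) (B := B)
    (EuclideanSpace.basisFun (Fin n) ℝ)
    (fun j v ↦ (hmul _ _ v).trans (by rw [hα2, hone]))
    (fun j k hjk v ↦ hanti (hαα j k hjk) v) (fun v ↦ (hmul _ _ v).trans (by rw [hβ2, hone]))
    (fun j v ↦ hanti (hαβ j) v) hs (lt_min hδ₁ hδ₂)
  refine ⟨√C, fun lam hlam u ↦ ?_⟩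
  have hm₁ : δ₁ ≤ ‖lam - m‖ := by
    by_contra! hlt
    exact h₁ (by simpa [dist_eq_norm] using hlt) hlam
  have hm₂ : δ₂ ≤ ‖lam + m‖ := by
    by_contra! hlt
    exact h₂ (by simpa [dist_eq_norm] using hlt) hlam
  rw [Real.sq_sqrt hC]
  refine (h lam ((min_le_left _ _).trans hm₁) ((min_le_right _ _).trans hm₂) u).trans_eq ?_
  congr! 6 with x
  rw [sub_apply, smul_apply, DiracLAP.diracCLM_apply_apply]
  simp [diracOp, a, B, SchwartzMap.lineDerivOp_apply_eq_fderiv]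
end
end

section
/- Let n ≥ 2, λ ∈ ℂ with λ ≠ m and λ ≠ −m, and s > −1/2. Then there exists c < ∞ such that for every Schwartz function u : ℝⁿ → ℂ^N, writing v(x) = (1+|x|²)^{s/2} u(x), one has ∫_{ℝⁿ} (|v(x)|² + ‖Dv(x)‖²) dx ≤ c² ∫_{ℝⁿ} (1+|x|²)^{s+1} |(D_m u)(x) − λ u(x)|² dx, where Dv(x) denotes the total (Fréchet) derivative of v at x. -/
open MeasureTheory

noncomputable section

section AbstractDirac

variable {V : Type*} [AddCommGroup V] [Module ℂ V] {n : ℕ}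

/-- The operator `−i ∑ⱼ Mⱼ Pⱼ + m B` built from abstract derivatives `Pⱼ` and matrices
`Mⱼ`, `B`. -/
def abstractDirac (P M : Fin n → Module.End ℂ V) (B : Module.End ℂ V) (m : ℝ) :
    Module.End ℂ V :=
  (-Complex.I) • ∑ j, M j * P j + (m : ℂ) • B

/-- The Clifford and commutation relations satisfied by derivatives and Dirac matrices,
together with their symmetry with respect to a Hermitian form. -/
structure IsDiracSystem (H : V →ₗ⋆[ℂ] V →ₗ[ℂ] ℂ) (P M : Fin n → Module.End ℂ V)
    (B : Module.End ℂ V) : Prop where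
  herm : ∀ u v, H u v = starRingEnd ℂ (H v u)
  P_antisymm : ∀ j u v, H (P j u) v = -H u (P j v)
  M_symm : ∀ j u v, H (M j u) v = H u (M j v)
  B_symm : ∀ u v, H (B u) v = H u (B v)
  P_comm : ∀ j k, P j * P k = P k * P j
  PM_comm : ∀ j k, P j * M k = M k * P j
  PB_comm : ∀ j, P j * B = B * P j
  M_sq : ∀ j, M j * M j = 1
  B_sq : B * B = 1
  M_anticomm : ∀ j k, j ≠ k → M j * M k + M k * M j = 0
  MB_anticomm : ∀ j, M j * B + B * M j = 0

namespace IsDiracSystem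

variable {H : V →ₗ⋆[ℂ] V →ₗ[ℂ] ℂ} {P M : Fin n → Module.End ℂ V} {B : Module.End ℂ V}

theorem dirac_symm (h : IsDiracSystem H P M B) (m : ℝ) (u v : V) :
    H (abstractDirac P M B m u) v = H u (abstractDirac P M B m v) := by
  have key : ∀ j, H (M j (P j u)) v = -H u (M j (P j v)) := fun j => by
    rw [h.M_symm, h.P_antisymm, ← Module.End.mul_apply, h.PM_comm, Module.End.mul_apply]
  simp only [abstractDirac, LinearMap.add_apply, LinearMap.smul_apply, LinearMap.sum_apply,
    Module.End.mul_apply, map_add, map_sum, LinearMap.map_smulₛₗ, map_neg, Complex.conj_I,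
    Complex.conj_ofReal, key, h.B_symm, smul_eq_mul, RingHom.id_apply, Finset.sum_neg_distrib]
  ring

theorem dirac_mul_self (h : IsDiracSystem H P M B) (m : ℝ) :
    abstractDirac P M B m * abstractDirac P M B m
      = -∑ j, P j * P j + ((m : ℂ) ^ 2) • (1 : Module.End ℂ V) := by
  set S := ∑ j, M j * P j with hS
  have hSB : S * B + B * S = 0 := by
    rw [hS, Finset.sum_mul, Finset.mul_sum, ← Finset.sum_add_distrib]
    refine Finset.sum_eq_zero fun j _ => ?_
    rw [mul_assoc, h.PB_comm, ← mul_assoc, ← mul_assoc, ← add_mul, h.MB_anticomm, zero_mul]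
  have hterm : ∀ j k, M j * P j * (M k * P k) = M j * M k * (P j * P k) := fun j k => by
    rw [mul_assoc, ← mul_assoc (P j), h.PM_comm, mul_assoc, mul_assoc]
  have hSS : S * S = ∑ j, P j * P j := by
    have h1 : S * S = ∑ j, ∑ k, M j * M k * (P j * P k) := by
      rw [hS, Finset.sum_mul_sum]
      simp only [hterm]
    have h2 : S * S = ∑ j, ∑ k, M k * M j * (P j * P k) := by
      rw [h1, Finset.sum_comm]
      simp only [h.P_comm]
    have h3 : S * S + S * S = ∑ j, (P j * P j + P j * P j) := by
      nth_rewrite 1 [h1]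
      rw [h2, ← Finset.sum_add_distrib]
      refine Finset.sum_congr rfl fun j _ => ?_
      rw [← Finset.sum_add_distrib, Finset.sum_eq_single j]
      · rw [h.M_sq, one_mul]
      · intro k _ hk
        rw [← add_mul, h.M_anticomm j k hk.symm, zero_mul]
      · simp
    rw [Finset.sum_add_distrib, ← two_smul ℂ, ← two_smul ℂ] at h3
    exact smul_right_injective _ (two_ne_zero (α := ℂ)) h3
  have hII : -Complex.I * -Complex.I = -1 := by simp
  have hBS : B * S = -(S * B) := by rw [eq_neg_iff_add_eq_zero, add_comm, hSB]
  simp only [abstractDirac, ← hS, add_mul, mul_add, smul_mul_smul_comm, hII, hSS, h.B_sq, hBS]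
  rw [mul_comm (m : ℂ), smul_neg, pow_two, neg_one_smul]
  abel

theorem factorization (h : IsDiracSystem H P M B) (m : ℝ) (lam : ℂ) (u v : V) :
    H (abstractDirac P M B m u - lam • u)
        (abstractDirac P M B m v + (starRingEnd ℂ lam) • v)
      = ∑ j, H (P j u) (P j v) - starRingEnd ℂ (lam ^ 2 - (m : ℂ) ^ 2) * H u v := by
  have hDD : H (abstractDirac P M B m u) (abstractDirac P M B m v)
      = ∑ j, H (P j u) (P j v) + (m : ℂ) ^ 2 * H u v := by
    rw [h.dirac_symm, ← Module.End.mul_apply, h.dirac_mul_self]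
    simp only [LinearMap.add_apply, LinearMap.neg_apply, LinearMap.sum_apply,
      Module.End.mul_apply, LinearMap.smul_apply, Module.End.one_apply, map_add, map_neg, map_sum,
      map_smul, smul_eq_mul, h.P_antisymm, Finset.sum_neg_distrib]
  simp only [map_sub, map_add, LinearMap.sub_apply, LinearMap.map_smulₛₗ, LinearMap.smul_apply,
    smul_eq_mul, RingHom.id_apply, hDD, h.dirac_symm m u v, map_pow, Complex.conj_ofReal]
  ring

/-- Virial identity for `D − lam` with an antisymmetric multiplier `A`. -/
theorem virial (h : IsDiracSystem H P M B) (m lam : ℝ) (A : Module.End ℂ V)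
    (hA : ∀ u v, H (A u) v = -H u (A v)) (hMA : ∀ j, M j * A = A * M j) (hBA : B * A = A * B)
    (u : V) (E : Fin n → V) (hE : ∀ j, P j (A u) = A (P j u) + E j) :
    (∑ j, H (P j u) (E j)).re
      = (H (abstractDirac P M B m u - (lam : ℂ) • u)
          ((2 * lam : ℂ) • A u + (-Complex.I) • ∑ j, M j (E j))).re := by
  have hre : ∀ w, (H w (A w)).re = 0 := fun w => by
    have h1 := congrArg Complex.re (hA w w)
    rw [h.herm, Complex.conj_re, Complex.neg_re] at h1
    linarith
  set f := abstractDirac P M B m u - (lam : ℂ) • u with hf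
  have hcomm : abstractDirac P M B m (A u) + (starRingEnd ℂ lam) • A u
      = A f + ((2 * lam : ℂ) • A u + (-Complex.I) • ∑ j, M j (E j)) := by
    have hM : ∀ j w, M j (A w) = A (M j w) := fun j w => by
      rw [← Module.End.mul_apply, hMA, Module.End.mul_apply]
    have hB : B (A u) = A (B u) := by
      rw [← Module.End.mul_apply, hBA, Module.End.mul_apply]
    simp only [hf, abstractDirac, LinearMap.add_apply, LinearMap.smul_apply, LinearMap.sum_apply,
      Module.End.mul_apply, hE, map_add, map_sub, map_sum, map_smul, hM, hB,
      Finset.sum_add_distrib, smul_add, Complex.conj_ofReal, two_mul, add_smul]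
    abel
  have hfac := congrArg Complex.re (h.factorization m lam u (A u))
  rw [hcomm, map_add, Complex.add_re, hre, zero_add, ← hf] at hfac
  have hreal : starRingEnd ℂ ((lam : ℂ) ^ 2 - (m : ℂ) ^ 2) = ((lam ^ 2 - m ^ 2 : ℝ) : ℂ) := by
    simp
  rw [hfac, hreal, Complex.sub_re, Complex.re_ofReal_mul, hre, mul_zero, sub_zero]
  simp only [Complex.re_sum, hE, map_add, Complex.add_re, hre, zero_add]

end IsDiracSystem

end AbstractDirac

section Schwartz

open LineDeriv

/-- Schwartz functions `ℝⁿ → ℂ^N`. -/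
abbrev SchwartzSpinor (n N : ℕ) :=
  SchwartzMap (EuclideanSpace ℝ (Fin n)) (EuclideanSpace ℂ (Fin N))

namespace SchwartzSpinor

variable {n N : ℕ}

/-- The complex inner product as a real bilinear map. -/
def realInner (N : ℕ) :
    EuclideanSpace ℂ (Fin N) →L[ℝ] EuclideanSpace ℂ (Fin N) →L[ℝ] ℂ :=
  LinearMap.mkContinuous₂
    (LinearMap.mk₂ ℝ (fun a b => inner ℂ a b) (fun _ _ _ => inner_add_left _ _ _)
      (fun _ _ _ => inner_smul_left_eq_smul _ _ _) (fun _ _ _ => inner_add_right _ _ _)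
      (fun _ _ _ => inner_smul_right_eq_smul _ _ _))
    1 (fun a b => by simpa using norm_inner_le_norm (𝕜 := ℂ) a b)

theorem integrable_inner (f g : SchwartzSpinor n N) :
    Integrable (fun x => inner ℂ (f x) (g x)) :=
  (SchwartzMap.pairing (realInner N) f g).integrable

/-- The `L²` inner product. -/
def form : SchwartzSpinor n N →ₗ⋆[ℂ] SchwartzSpinor n N →ₗ[ℂ] ℂ :=
  LinearMap.mk₂'ₛₗ _ _ (fun f g => ∫ x, inner ℂ (f x) (g x))
    (fun f f' g => by
      simp only [add_apply, inner_add_left]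
      exact integral_add (integrable_inner f g) (integrable_inner f' g))
    (fun c f g => by
      simp only [smul_apply, inner_smul_left, integral_const_mul, smul_eq_mul])
    (fun f g g' => by
      simp only [add_apply, inner_add_right]
      exact integral_add (integrable_inner f g) (integrable_inner f g'))
    (fun c f g => by
      simp only [smul_apply, inner_smul_right, integral_const_mul, smul_eq_mul,
        RingHom.id_apply])

theorem form_apply (f g : SchwartzSpinor n N) : form f g = ∫ x, inner ℂ (f x) (g x) := rfl

/-- The partial derivative `∂ⱼ`. -/
def partialDeriv (j : Fin n) : Module.End ℂ (SchwartzSpinor n N) :=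
  (lineDerivOpCLM ℂ (SchwartzSpinor n N) (EuclideanSpace.single j (1 : ℝ))).toLinearMap

theorem partialDeriv_apply (j : Fin n) (u : SchwartzSpinor n N) (x : EuclideanSpace ℝ (Fin n)) :
    partialDeriv j u x = fderiv ℝ u x (EuclideanSpace.single j 1) := rfl

/-- Pointwise application of a constant matrix. -/
def matrixOp (M : Matrix (Fin N) (Fin N) ℂ) : Module.End ℂ (SchwartzSpinor n N) :=
  (SchwartzMap.postcompCLM (Matrix.toEuclideanLin M).toContinuousLinearMap).toLinearMap

theorem matrixOp_apply (M : Matrix (Fin N) (Fin N) ℂ) (u : SchwartzSpinor n N)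
    (x : EuclideanSpace ℝ (Fin n)) : matrixOp M u x = Matrix.toEuclideanLin M (u x) := rfl

/-- Multiplication by a real function of temperate growth. -/
def mulOp (g : EuclideanSpace ℝ (Fin n) → ℝ) : Module.End ℂ (SchwartzSpinor n N) :=
  (SchwartzMap.smulLeftCLM (EuclideanSpace ℂ (Fin N)) (fun x => (g x : ℂ))).toLinearMap

theorem mulOp_apply {g : EuclideanSpace ℝ (Fin n) → ℝ} (hg : g.HasTemperateGrowth)
    (u : SchwartzSpinor n N) (x : EuclideanSpace ℝ (Fin n)) :
    mulOp g u x = g x • u x := by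
  have hg' : (fun x => (g x : ℂ)).HasTemperateGrowth :=
    Function.Complex.hasTemperateGrowth_ofReal.comp hg
  change SchwartzMap.smulLeftCLM _ (fun x => (g x : ℂ)) u x = _
  rw [SchwartzMap.smulLeftCLM_apply_apply hg']
  exact (RCLike.real_smul_eq_coe_smul (K := ℂ) _ _).symm

theorem partialDeriv_mulOp {g g' : EuclideanSpace ℝ (Fin n) → ℝ} (hg : g.HasTemperateGrowth)
    (hg' : g'.HasTemperateGrowth) (j : Fin n)
    (hd : ∀ x, fderiv ℝ g x (EuclideanSpace.single j 1) = g' x) (u : SchwartzSpinor n N) :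
    partialDeriv j (mulOp g u) = mulOp g (partialDeriv j u) + mulOp g' u := by
  ext1 x
  have hfun : (mulOp g u : EuclideanSpace ℝ (Fin n) → _) = fun y => g y • u y :=
    funext fun y => mulOp_apply hg u y
  rw [partialDeriv_apply, hfun, fderiv_fun_smul
    (hg.1.differentiable (by simp) x) (u.differentiableAt)]
  simp [mulOp_apply hg, mulOp_apply hg', partialDeriv_apply, hd]

theorem form_mulOp {g : EuclideanSpace ℝ (Fin n) → ℝ} (hg : g.HasTemperateGrowth)
    (u v : SchwartzSpinor n N) : form (mulOp g u) v = form u (mulOp g v) := by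
  simp only [form_apply, mulOp_apply hg, RCLike.real_smul_eq_coe_smul (K := ℂ),
    inner_smul_left, inner_smul_right, RCLike.conj_ofReal]

theorem matrixOp_mulOp {g : EuclideanSpace ℝ (Fin n) → ℝ} (hg : g.HasTemperateGrowth)
    (M : Matrix (Fin N) (Fin N) ℂ) :
    matrixOp M * mulOp (n := n) g = mulOp g * matrixOp M := by
  ext u x : 2
  rw [Module.End.mul_apply, Module.End.mul_apply, matrixOp_apply, mulOp_apply hg, mulOp_apply hg,
    matrixOp_apply, RCLike.real_smul_eq_coe_smul (K := ℂ), map_smul,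
    RCLike.real_smul_eq_coe_smul (K := ℂ)]

theorem partialDeriv_matrixOp (j : Fin n) (M : Matrix (Fin N) (Fin N) ℂ) :
    partialDeriv j * matrixOp M = matrixOp M * partialDeriv j := by
  ext u x : 2
  have hfun : (matrixOp M u : EuclideanSpace ℝ (Fin n) → _)
      = ((Matrix.toEuclideanLin M).toContinuousLinearMap.restrictScalars ℝ) ∘ u := rfl
  rw [Module.End.mul_apply, partialDeriv_apply, hfun, fderiv_comp x
    (ContinuousLinearMap.differentiableAt _) u.differentiableAt, ContinuousLinearMap.fderiv]
  rfl

theorem matrixOp_mul (M M' : Matrix (Fin N) (Fin N) ℂ) :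
    (matrixOp M * matrixOp M' : Module.End ℂ (SchwartzSpinor n N)) = matrixOp (M * M') := by
  ext u x : 2
  simp only [Module.End.mul_apply, matrixOp_apply]
  simp [Matrix.toEuclideanLin, Matrix.toLpLin_apply]

theorem matrixOp_add (M M' : Matrix (Fin N) (Fin N) ℂ) :
    (matrixOp M + matrixOp M' : Module.End ℂ (SchwartzSpinor n N)) = matrixOp (M + M') := by
  ext u x : 2
  simp [matrixOp_apply]

theorem matrixOp_one : (matrixOp 1 : Module.End ℂ (SchwartzSpinor n N)) = 1 := by
  ext u x : 2
  simp [matrixOp_apply, Matrix.toEuclideanLin]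

theorem matrixOp_zero : (matrixOp 0 : Module.End ℂ (SchwartzSpinor n N)) = 0 := by
  ext u x : 2
  simp [matrixOp_apply]

theorem form_matrixOp {M : Matrix (Fin N) (Fin N) ℂ} (hM : M.IsHermitian)
    (u v : SchwartzSpinor n N) : form (matrixOp M u) v = form u (matrixOp M v) := by
  have := Matrix.isSymmetric_toEuclideanLin_iff.mpr hM
  simp only [form_apply, matrixOp_apply]
  congr 1 with x
  exact this _ _

theorem form_partialDeriv (j : Fin n) (u v : SchwartzSpinor n N) :
    form (partialDeriv j u) v = -form u (partialDeriv j v) := by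
  rw [eq_comm, neg_eq_iff_eq_neg]
  exact SchwartzMap.integral_bilinear_lineDerivOp_right_eq_neg_left u v (realInner N)
    (EuclideanSpace.single j (1 : ℝ))

theorem partialDeriv_comm (j k : Fin n) :
    (partialDeriv j * partialDeriv k : Module.End ℂ (SchwartzSpinor n N))
      = partialDeriv k * partialDeriv j := by
  ext u x : 2
  have hsym : IsSymmSndFDerivAt ℝ u x := (u.smooth 2).contDiffAt.isSymmSndFDerivAt (by simp)
  have hiter : ∀ a b : Fin n,
      (partialDeriv a * partialDeriv b : Module.End ℂ (SchwartzSpinor n N)) u x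
      = fderiv ℝ (fderiv ℝ u) x (EuclideanSpace.single a 1) (EuclideanSpace.single b 1) :=
    fun a b => by
      have hfun : (partialDeriv b u : EuclideanSpace ℝ (Fin n) → _)
          = fun y => fderiv ℝ u y (EuclideanSpace.single b 1) := rfl
      have hdiff : DifferentiableAt ℝ (fderiv ℝ u) x :=
        (SchwartzMap.fderivCLM ℝ _ _ u).differentiableAt
      rw [Module.End.mul_apply, partialDeriv_apply, hfun, fderiv_clm_apply hdiff (by fun_prop)]
      simp
  rw [hiter, hiter, hsym]

theorem isDiracSystem {α : Fin n → Matrix (Fin N) (Fin N) ℂ} {β : Matrix (Fin N) (Fin N) ℂ}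
    (hαh : ∀ j, (α j).IsHermitian) (hβh : β.IsHermitian)
    (hα2 : ∀ j, α j * α j = 1) (hβ2 : β * β = 1)
    (hαα : ∀ j k, j ≠ k → α j * α k + α k * α j = 0)
    (hαβ : ∀ j, α j * β + β * α j = 0) :
    IsDiracSystem (form (n := n) (N := N)) partialDeriv (fun j => matrixOp (α j))
      (matrixOp β) where
  herm u v := by
    simp only [form_apply]
    rw [← integral_conj]
    simp only [inner_conj_symm]
  P_antisymm := form_partialDeriv
  M_symm j := form_matrixOp (hαh j)
  B_symm := form_matrixOp hβh
  P_comm := partialDeriv_comm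
  PM_comm j k := partialDeriv_matrixOp j (α k)
  PB_comm j := partialDeriv_matrixOp j β
  M_sq j := by rw [matrixOp_mul, hα2, matrixOp_one]
  B_sq := by rw [matrixOp_mul, hβ2, matrixOp_one]
  M_anticomm j k hjk := by
    rw [matrixOp_mul, matrixOp_mul, matrixOp_add, hαα j k hjk, matrixOp_zero]
  MB_anticomm j := by rw [matrixOp_mul, matrixOp_mul, matrixOp_add, hαβ, matrixOp_zero]

theorem abstractDirac_apply (m : ℝ) (α : Fin n → Matrix (Fin N) (Fin N) ℂ)
    (β : Matrix (Fin N) (Fin N) ℂ) (u : SchwartzSpinor n N) (x : EuclideanSpace ℝ (Fin n)) :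
    abstractDirac partialDeriv (fun j => matrixOp (α j)) (matrixOp β) m u x
      = diracOp m α β u x := by
  simp [abstractDirac, diracOp, matrixOp_apply, partialDeriv_apply, sum_apply]

end SchwartzSpinor

end Schwartz

section Weights

variable {n : ℕ}

/-- The dilated power weight `(1 + ε²|x|²)^t`. -/
def weight (ε t : ℝ) (x : EuclideanSpace ℝ (Fin n)) : ℝ := (1 + ε ^ 2 * ‖x‖ ^ 2) ^ t

theorem weight_pos (ε t : ℝ) (x : EuclideanSpace ℝ (Fin n)) : 0 < weight ε t x := by
  unfold weight; positivity

theorem weight_add_one (ε t : ℝ) (x : EuclideanSpace ℝ (Fin n)) :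
    weight ε (t + 1) x = weight ε t x * (1 + ε ^ 2 * ‖x‖ ^ 2) := by
  unfold weight
  rw [Real.rpow_add_one (by positivity)]

theorem hasTemperateGrowth_weight (ε t : ℝ) :
    (weight (n := n) ε t).HasTemperateGrowth := by
  have h := (Function.hasTemperateGrowth_one_add_norm_sq_rpow
    (EuclideanSpace ℝ (Fin n)) t).comp
      (ε • ContinuousLinearMap.id ℝ (EuclideanSpace ℝ (Fin n))).hasTemperateGrowth
  have heq : weight (n := n) ε t = (fun x : EuclideanSpace ℝ (Fin n) => (1 + ‖x‖ ^ 2) ^ t) ∘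
      ⇑(ε • ContinuousLinearMap.id ℝ (EuclideanSpace ℝ (Fin n))) := by
    funext x
    simp [weight, norm_smul, mul_pow]
  rw [heq]
  exact h

theorem hasTemperateGrowth_coord (k : Fin n) :
    (fun x : EuclideanSpace ℝ (Fin n) => x k).HasTemperateGrowth :=
  (EuclideanSpace.proj k : EuclideanSpace ℝ (Fin n) →L[ℝ] ℝ).hasTemperateGrowth

theorem fderiv_coord (j k : Fin n) (x : EuclideanSpace ℝ (Fin n)) :
    fderiv ℝ (fun y : EuclideanSpace ℝ (Fin n) => y k) x (EuclideanSpace.single j 1)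
      = if j = k then 1 else 0 := by
  have : HasFDerivAt (fun y : EuclideanSpace ℝ (Fin n) => y k)
    (EuclideanSpace.proj k : EuclideanSpace ℝ (Fin n) →L[ℝ] ℝ) x :=
    (EuclideanSpace.proj k : EuclideanSpace ℝ (Fin n) →L[ℝ] ℝ).hasFDerivAt
  rw [this.fderiv]
  simp [eq_comm]

theorem fderiv_weight (ε t : ℝ) (j : Fin n) (x : EuclideanSpace ℝ (Fin n)) :
    fderiv ℝ (weight ε t) x (EuclideanSpace.single j 1)
      = 2 * t * ε ^ 2 * x j * weight ε (t - 1) x := by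
  have h1 : HasFDerivAt (fun y : EuclideanSpace ℝ (Fin n) => 1 + ε ^ 2 * ‖y‖ ^ 2) _ x :=
    ((hasStrictFDerivAt_norm_sq x).hasFDerivAt.const_mul (ε ^ 2)).const_add 1
  have h2 := h1.rpow_const (p := t) (Or.inl (by positivity))
  have h3 : fderiv ℝ (weight ε t) x = _ := h2.fderiv
  rw [h3]
  simp [weight, EuclideanSpace.inner_single_right]
  ring

/-- The vector field `(1 + ε²|x|²)^s x`. -/
def radialField (ε s : ℝ) (k : Fin n) (x : EuclideanSpace ℝ (Fin n)) : ℝ :=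
  weight ε s x * x k

/-- The Jacobian of `radialField`. -/
def radialJacobian (ε s : ℝ) (j k : Fin n) (x : EuclideanSpace ℝ (Fin n)) : ℝ :=
  weight ε s x * (if j = k then 1 else 0) + 2 * s * ε ^ 2 * (x j * x k * weight ε (s - 1) x)

/-- The derivative `∂ₖ` of the `(j, k)` entry of `radialJacobian`. -/
def radialHessian (ε s : ℝ) (j k : Fin n) (x : EuclideanSpace ℝ (Fin n)) : ℝ :=
  2 * s * ε ^ 2 * (2 * (if j = k then 1 else 0) * x k * weight ε (s - 1) x
    + x j * weight ε (s - 1) x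
    + 2 * (s - 1) * ε ^ 2 * (x k * x j * x k * weight ε (s - 1 - 1) x))

theorem hasTemperateGrowth_radialField (ε s : ℝ) (k : Fin n) :
    (radialField ε s k).HasTemperateGrowth :=
  (hasTemperateGrowth_weight ε s).mul (hasTemperateGrowth_coord k)

theorem hasTemperateGrowth_radialJacobian (ε s : ℝ) (j k : Fin n) :
    (radialJacobian ε s j k).HasTemperateGrowth :=
  ((hasTemperateGrowth_weight ε s).mul (.const _)).add
    (.mul (.const _) (((hasTemperateGrowth_coord j).mul (hasTemperateGrowth_coord k)).mul
      (hasTemperateGrowth_weight ε (s - 1))))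

theorem hasTemperateGrowth_radialHessian (ε s : ℝ) (j k : Fin n) :
    (radialHessian ε s j k).HasTemperateGrowth :=
  .mul (.const _) (.add (.add
    (.mul (.mul (.const _) (hasTemperateGrowth_coord k)) (hasTemperateGrowth_weight ε (s - 1)))
    ((hasTemperateGrowth_coord j).mul (hasTemperateGrowth_weight ε (s - 1))))
    (.mul (.const _) ((((hasTemperateGrowth_coord k).mul (hasTemperateGrowth_coord j)).mul
      (hasTemperateGrowth_coord k)).mul (hasTemperateGrowth_weight ε (s - 1 - 1)))))

theorem differentiableAt_weight (ε t : ℝ) (x : EuclideanSpace ℝ (Fin n)) :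
    DifferentiableAt ℝ (weight ε t) x :=
  (hasTemperateGrowth_weight ε t).1.differentiable (by simp) x

theorem differentiableAt_coord (k : Fin n) (x : EuclideanSpace ℝ (Fin n)) :
    DifferentiableAt ℝ (fun y : EuclideanSpace ℝ (Fin n) => y k) x :=
  (hasTemperateGrowth_coord k).1.differentiable (by simp) x

theorem fderiv_radialField (ε s : ℝ) (j k : Fin n) (x : EuclideanSpace ℝ (Fin n)) :
    fderiv ℝ (radialField ε s k) x (EuclideanSpace.single j 1) = radialJacobian ε s j k x := by
  have h : radialField (n := n) ε s k = fun y => weight ε s y * y k := rfl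
  rw [h, fderiv_fun_mul (differentiableAt_weight ε s x) (differentiableAt_coord k x)]
  simp only [add_apply, smul_apply, fderiv_coord,
    fderiv_weight, smul_eq_mul, radialJacobian]
  ring

theorem fderiv_radialJacobian (ε s : ℝ) (j k : Fin n) (x : EuclideanSpace ℝ (Fin n)) :
    fderiv ℝ (radialJacobian ε s j k) x (EuclideanSpace.single k 1)
      = radialHessian ε s j k x := by
  have hw := differentiableAt_weight ε s x
  have hw' := differentiableAt_weight ε (s - 1) x
  have hj := differentiableAt_coord j x
  have hk := differentiableAt_coord k x
  have h : radialJacobian (n := n) ε s j k = fun y => weight ε s y * (if j = k then 1 else 0)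
      + 2 * s * ε ^ 2 * (y j * y k * weight ε (s - 1) y) := rfl
  rw [h, fderiv_fun_add (hw.mul_const _) (((hj.fun_mul hk).fun_mul hw').const_mul _),
    fderiv_mul_const hw, fderiv_const_mul ((hj.fun_mul hk).fun_mul hw'),
    fderiv_fun_mul (hj.fun_mul hk) hw', fderiv_fun_mul hj hk]
  simp only [add_apply, smul_apply, fderiv_coord,
    fderiv_weight, smul_eq_mul, radialHessian, if_true]
  by_cases hjk : j = k
  · subst hjk
    simp only [if_true]
    ring
  · rw [if_neg hjk, if_neg (Ne.symm hjk)]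
    ring

theorem abs_coord_le (x : EuclideanSpace ℝ (Fin n)) {ε : ℝ} (hε : 0 ≤ ε) (k : Fin n) :
    |ε * x k| ≤ √(1 + ε ^ 2 * ‖x‖ ^ 2) := by
  apply Real.le_sqrt_of_sq_le
  have h : |x k| ≤ ‖x‖ := by simpa using PiLp.norm_apply_le x k
  have h' : (ε * |x k|) ^ 2 ≤ (ε * ‖x‖) ^ 2 := by gcongr
  rw [abs_mul, abs_of_nonneg hε]
  nlinarith

/-- The square root `h` of `1 + ε²|x|²` together with the weights of exponents `s`, `s - 1`
and `s - 2` expressed through it. -/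
theorem weight_scale (ε s : ℝ) (x : EuclideanSpace ℝ (Fin n)) :
    1 ≤ √(1 + ε ^ 2 * ‖x‖ ^ 2) ∧
    weight ε s x = weight ε (s - 1) x * √(1 + ε ^ 2 * ‖x‖ ^ 2) ^ 2 ∧
    weight ε (s - 1) x = weight ε (s - 1 - 1) x * √(1 + ε ^ 2 * ‖x‖ ^ 2) ^ 2 := by
  have hq : √(1 + ε ^ 2 * ‖x‖ ^ 2) ^ 2 = 1 + ε ^ 2 * ‖x‖ ^ 2 := Real.sq_sqrt (by positivity)
  refine ⟨Real.one_le_sqrt.mpr (by nlinarith [sq_nonneg (ε * ‖x‖)]), ?_, ?_⟩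
  · rw [hq, ← weight_add_one, sub_add_cancel]
  · rw [hq, ← weight_add_one, sub_add_cancel]

theorem abs_radialField_le {ε : ℝ} (hε : 0 < ε) (s : ℝ) (k : Fin n)
    (x : EuclideanSpace ℝ (Fin n)) :
    |radialField ε s k x| ≤ ε⁻¹ * (weight ε s x * √(1 + ε ^ 2 * ‖x‖ ^ 2)) := by
  have h := abs_coord_le x hε.le k
  have hw := weight_pos ε s x
  rw [radialField, abs_mul, abs_of_pos hw, mul_left_comm]
  rw [abs_mul, abs_of_pos hε] at h
  gcongr
  rw [inv_mul_eq_div, le_div_iff₀ hε]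
  linarith

theorem abs_weight_sub_one_le {ε : ℝ} (hε : 0 ≤ ε) (s : ℝ) (k : Fin n)
    (x : EuclideanSpace ℝ (Fin n)) :
    |ε ^ 2 * x k * weight ε (s - 1) x| ≤ ε * weight ε s x := by
  obtain ⟨h1, hw, -⟩ := weight_scale ε s x
  have hk := abs_coord_le x hε k
  have hpos := weight_pos ε (s - 1) x
  set h := √(1 + ε ^ 2 * ‖x‖ ^ 2)
  calc |ε ^ 2 * x k * weight ε (s - 1) x| = ε * |ε * x k| * weight ε (s - 1) x := by
        rw [pow_two, abs_mul, abs_of_pos hpos, mul_assoc ε, abs_mul, abs_of_nonneg hε]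
    _ ≤ ε * h ^ 2 * weight ε (s - 1) x := by
        gcongr
        nlinarith
    _ = ε * weight ε s x := by rw [hw]; ring

theorem abs_radialJacobian_le {ε : ℝ} (hε : 0 ≤ ε) (s : ℝ) (j k : Fin n)
    (x : EuclideanSpace ℝ (Fin n)) :
    |radialJacobian ε s j k x| ≤ (1 + 2 * |s|) * weight ε s x := by
  obtain ⟨h1, hw, -⟩ := weight_scale ε s x
  have hj := abs_coord_le x hε j
  have hk := abs_coord_le x hε k
  have hpos := weight_pos ε (s - 1) x
  have hpos' := weight_pos ε s x
  have h2 : |2 * s * ε ^ 2 * (x j * x k * weight ε (s - 1) x)| ≤ 2 * |s| * weight ε s x := by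
    calc |2 * s * ε ^ 2 * (x j * x k * weight ε (s - 1) x)|
        = 2 * |s| * ((|ε * x j| * |ε * x k|) * weight ε (s - 1) x) := by
          simp only [abs_mul, abs_of_pos hpos, abs_of_nonneg hε, abs_pow, Nat.abs_ofNat]
          ring
      _ ≤ 2 * |s| * ((√(1 + ε ^ 2 * ‖x‖ ^ 2) * √(1 + ε ^ 2 * ‖x‖ ^ 2))
            * weight ε (s - 1) x) := by gcongr
      _ = 2 * |s| * weight ε s x := by rw [hw]; ring
  have h3 : |weight ε s x * (if j = k then 1 else 0)| ≤ weight ε s x := by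
    split_ifs <;> simp [abs_of_pos hpos', hpos'.le]
  calc |radialJacobian ε s j k x| ≤ _ + _ := abs_add_le _ _
    _ ≤ weight ε s x + 2 * |s| * weight ε s x := add_le_add h3 h2
    _ = _ := by ring

theorem abs_radialHessian_le {ε : ℝ} (hε : 0 ≤ ε) (s : ℝ) (j k : Fin n)
    (x : EuclideanSpace ℝ (Fin n)) :
    |radialHessian ε s j k x| ≤ 2 * |s| * (3 + 2 * |s - 1|) * (ε * weight ε s x) := by
  obtain ⟨h1, hw, hw'⟩ := weight_scale ε s x
  have hj := abs_coord_le x hε j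
  have hk := abs_coord_le x hε k
  have hpos := weight_pos ε (s - 1 - 1) x
  have hpos' := weight_pos ε s x
  have e1 : |2 * (ε ^ 2 * x k * weight ε (s - 1) x) * (if j = k then 1 else 0)|
      ≤ 2 * (ε * weight ε s x) := by
    have := abs_weight_sub_one_le hε s k x
    split_ifs
    · simpa [abs_mul] using this
    · simp only [mul_zero, abs_zero]; positivity
  have e2 := abs_weight_sub_one_le hε s j x
  have e3 : |2 * (s - 1) * (ε ^ 2 * ε ^ 2 * (x k * x j * x k * weight ε (s - 1 - 1) x))|
      ≤ 2 * |s - 1| * (ε * weight ε s x) := by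
    rw [hw, hw']
    set h := √(1 + ε ^ 2 * ‖x‖ ^ 2)
    calc |2 * (s - 1) * (ε ^ 2 * ε ^ 2 * (x k * x j * x k * weight ε (s - 1 - 1) x))|
        = 2 * |s - 1| * (ε * ((|ε * x k| * |ε * x j| * |ε * x k|)
            * weight ε (s - 1 - 1) x)) := by
          simp only [abs_mul, abs_of_pos hpos, abs_of_nonneg hε, abs_pow, Nat.abs_ofNat]
          ring
      _ ≤ 2 * |s - 1| * (ε * ((h * h * h) * weight ε (s - 1 - 1) x)) := by gcongr
      _ ≤ 2 * |s - 1| * (ε * ((h * h * h) * h * weight ε (s - 1 - 1) x)) := by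
          have : 0 ≤ h * h * h := by positivity
          gcongr
          nlinarith
      _ = _ := by ring
  have hsplit : radialHessian ε s j k x
      = 2 * s * (2 * (ε ^ 2 * x k * weight ε (s - 1) x) * (if j = k then 1 else 0)
        + ε ^ 2 * x j * weight ε (s - 1) x
        + 2 * (s - 1) * (ε ^ 2 * ε ^ 2 * (x k * x j * x k * weight ε (s - 1 - 1) x))) := by
    rw [radialHessian]; ring
  rw [hsplit, abs_mul, abs_mul, Nat.abs_ofNat, mul_assoc (2 * |s|)]
  gcongr
  refine (abs_add_three _ _ _).trans ?_
  linarith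

end Weights

section PointwiseBounds

variable {n : ℕ}

theorem sq_sum_norm_add_le {F : Type*} [NormedAddCommGroup F] (a : Fin n → F) (b : F) :
    (∑ j, ‖a j‖ + ‖b‖) ^ 2 ≤ 2 * (n + 1) * (∑ j, ‖a j‖ ^ 2 + ‖b‖ ^ 2) := by
  have h1 : (∑ j, ‖a j‖) ^ 2 ≤ n * ∑ j, ‖a j‖ ^ 2 := by
    simpa using sq_sum_le_card_mul_sum_sq (s := Finset.univ) (f := fun j => ‖a j‖)
  have h2 : 0 ≤ ∑ j, ‖a j‖ ^ 2 := by positivity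
  have h3 : (0 : ℝ) ≤ n * ‖b‖ ^ 2 := by positivity
  nlinarith [sq_nonneg (∑ j, ‖a j‖ - ‖b‖)]

variable {F : Type*} [NormedAddCommGroup F] [InnerProductSpace ℂ F]

theorem neg_le_sum_re_inner (a w : Fin n → F) (b : F) {c : ℝ} (hc : 0 ≤ c)
    (hw : ∀ j, ‖w j‖ ≤ c * ‖b‖) :
    -(c * (n + 1) * (∑ j, ‖a j‖ ^ 2 + ‖b‖ ^ 2)) ≤ ∑ j, (inner ℂ (a j) (w j)).re := by
  have h1 : ∀ j, -(c * (‖a j‖ ^ 2 + ‖b‖ ^ 2)) ≤ (inner ℂ (a j) (w j)).re := fun j => by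
    have h2 : |(inner ℂ (a j) (w j)).re| ≤ ‖a j‖ * (c * ‖b‖) :=
      (Complex.abs_re_le_norm _).trans ((norm_inner_le_norm _ _).trans (by gcongr; exact hw j))
    have h3 : ‖a j‖ * ‖b‖ ≤ ‖a j‖ ^ 2 + ‖b‖ ^ 2 := by
      nlinarith [sq_nonneg (‖a j‖ - ‖b‖), sq_nonneg ‖a j‖, sq_nonneg ‖b‖]
    have h4 := mul_le_mul_of_nonneg_left h3 hc
    have h5 := (abs_le.mp h2).1
    linarith
  have h6 := Finset.sum_le_sum fun j (_ : j ∈ Finset.univ) => h1 j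
  refine le_trans ?_ h6
  rw [Finset.sum_neg_distrib, ← Finset.mul_sum, Finset.sum_add_distrib, mul_assoc]
  simp only [Finset.sum_const, Finset.card_univ, Fintype.card_fin, nsmul_eq_mul]
  have h7 : 0 ≤ ∑ j, ‖a j‖ ^ 2 := by positivity
  have h8 : 0 ≤ n * ∑ j, ‖a j‖ ^ 2 := by positivity
  have h9 : 0 ≤ ‖b‖ ^ 2 := by positivity
  exact neg_le_neg (mul_le_mul_of_nonneg_left (by linarith) hc)

theorem norm_sum_smul_le (a : Fin n → F) (g : Fin n → ℝ) {c : ℝ} (hg : ∀ j, |g j| ≤ c) :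
    ‖∑ j, g j • a j‖ ≤ c * ∑ j, ‖a j‖ := by
  rw [Finset.mul_sum]
  refine norm_sum_le_of_le _ fun j _ => ?_
  rw [norm_smul, Real.norm_eq_abs]
  exact mul_le_mul_of_nonneg_right (hg j) (norm_nonneg _)

theorem norm_sum_coord_smul_sq_le (x : EuclideanSpace ℝ (Fin n)) (a : Fin n → F) :
    ‖∑ j, x j • a j‖ ^ 2 ≤ ‖x‖ ^ 2 * ∑ j, ‖a j‖ ^ 2 := by
  have h1 : ‖∑ j, x j • a j‖ ≤ ∑ j, |x j| * ‖a j‖ :=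
    norm_sum_le_of_le _ fun j _ => by rw [norm_smul, Real.norm_eq_abs]
  calc ‖∑ j, x j • a j‖ ^ 2 ≤ (∑ j, |x j| * ‖a j‖) ^ 2 := by gcongr
    _ ≤ (∑ j, |x j| ^ 2) * ∑ j, ‖a j‖ ^ 2 := Finset.sum_mul_sq_le_sq_mul_sq _ _ _
    _ = _ := by simp [EuclideanSpace.real_norm_sq_eq]

theorem sum_radialJacobian_inner (ε s : ℝ) (x : EuclideanSpace ℝ (Fin n)) (a : Fin n → F) :
    ∑ j, (inner ℂ (a j) (∑ k, radialJacobian ε s j k x • a k)).re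
      = weight ε s x * ∑ j, ‖a j‖ ^ 2
        + 2 * s * ε ^ 2 * weight ε (s - 1) x * ‖∑ j, x j • a j‖ ^ 2 := by
  have h1 : ∀ j, ∑ k, radialJacobian ε s j k x • a k
      = weight ε s x • a j + (2 * s * ε ^ 2 * weight ε (s - 1) x) • x j • ∑ k, x k • a k :=
    fun j => by
      simp only [radialJacobian, add_smul, Finset.sum_add_distrib, Finset.smul_sum, smul_smul]
      congr 1
      · simp [mul_ite, ite_smul]
      · refine Finset.sum_congr rfl fun k _ => ?_
        congr 1
        ring
  have h2 : ∀ (r : ℝ) (v w : F), (inner ℂ v (r • w)).re = r * (inner ℂ v w).re :=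
    fun r v w => by
      rw [inner_smul_right_eq_smul, Complex.smul_re, smul_eq_mul]
  have h3 : ∀ v : F, (inner ℂ v v).re = ‖v‖ ^ 2 := fun v => by
    simpa using (norm_sq_eq_re_inner (𝕜 := ℂ) v).symm
  have h4 : ∀ v : F, ∑ j, x j * (inner ℂ (a j) v).re = (inner ℂ (∑ j, x j • a j) v).re :=
    fun v => by
      rw [sum_inner, Complex.re_sum]
      refine Finset.sum_congr rfl fun j _ => ?_
      rw [inner_smul_left_eq_smul, Complex.smul_re, smul_eq_mul]
  simp only [h1, inner_add_right, Complex.add_re, h2, h3, Finset.sum_add_distrib,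
    ← Finset.mul_sum, h4]

theorem le_sum_radialJacobian_inner (ε s : ℝ) (x : EuclideanSpace ℝ (Fin n)) (a : Fin n → F) :
    min 1 (1 + 2 * s) * (weight ε s x * ∑ j, ‖a j‖ ^ 2)
      ≤ ∑ j, (inner ℂ (a j) (∑ k, radialJacobian ε s j k x • a k)).re := by
  rw [sum_radialJacobian_inner]
  set S := ∑ j, ‖a j‖ ^ 2
  have hS : 0 ≤ S := by positivity
  have hw := weight_pos ε s x
  have hw1 := weight_pos ε (s - 1) x
  have hc := norm_sum_coord_smul_sq_le x a
  set Q := ‖∑ j, x j • a j‖ ^ 2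
  have hQ : 0 ≤ Q := by positivity
  have hwS : 0 ≤ weight ε s x * S := by positivity
  have hP : 0 ≤ ε ^ 2 * weight ε (s - 1) x * Q := by positivity
  have hle : ε ^ 2 * weight ε (s - 1) x * Q ≤ weight ε s x * S := by
    have h1 : weight ε s x = weight ε (s - 1) x * (1 + ε ^ 2 * ‖x‖ ^ 2) := by
      rw [← weight_add_one, sub_add_cancel]
    calc ε ^ 2 * weight ε (s - 1) x * Q ≤ ε ^ 2 * weight ε (s - 1) x * (‖x‖ ^ 2 * S) := by gcongr
      _ ≤ ε ^ 2 * weight ε (s - 1) x * (‖x‖ ^ 2 * S) + weight ε (s - 1) x * S := by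
        have : 0 ≤ weight ε (s - 1) x * S := by positivity
        linarith
      _ = weight ε s x * S := by rw [h1]; ring
  rcases le_total 0 s with hs | hs
  · have h1 := mul_le_mul_of_nonneg_right (min_le_left 1 (1 + 2 * s)) hwS
    have h2 := mul_nonneg hs hP
    linarith
  · have h1 := mul_le_mul_of_nonneg_right (min_le_right 1 (1 + 2 * s)) hwS
    have h2 := mul_le_mul_of_nonpos_left hle hs
    linarith

end PointwiseBounds

namespace SchwartzSpinor

section Energy

variable {n N : ℕ}

/-- The squared Euclidean norm `∑ⱼ |∂ⱼu|²` of the gradient. -/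
def gradSq (u : SchwartzSpinor n N) (x : EuclideanSpace ℝ (Fin n)) : ℝ :=
  ∑ j, ‖partialDeriv j u x‖ ^ 2

/-- The sum `∑ⱼ |∂ⱼu| + |u|`. -/
def jetNorm (u : SchwartzSpinor n N) (x : EuclideanSpace ℝ (Fin n)) : ℝ :=
  ∑ j, ‖partialDeriv j u x‖ + ‖u x‖

theorem jetNorm_sq_le (u : SchwartzSpinor n N) (x : EuclideanSpace ℝ (Fin n)) :
    jetNorm u x ^ 2 ≤ 2 * (n + 1) * (gradSq u x + ‖u x‖ ^ 2) :=
  sq_sum_norm_add_le _ _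

theorem jetNorm_nonneg (u : SchwartzSpinor n N) (x : EuclideanSpace ℝ (Fin n)) :
    0 ≤ jetNorm u x := by
  unfold jetNorm; positivity

theorem gradSq_nonneg (u : SchwartzSpinor n N) (x : EuclideanSpace ℝ (Fin n)) :
    0 ≤ gradSq u x := by
  unfold gradSq; positivity

/-- Up to an error of relative size `ε` and a term controlled by `T u`, the density
`(1 + ε²|x|²)^s (p |∇u|² + q |u|²)` is bounded by a function of vanishing integral. -/
def EnergyBound (T : Module.End ℂ (SchwartzSpinor n N)) (s p q : ℝ) : Prop :=
  ∃ C, 0 ≤ C ∧ ∀ ε : ℝ, 0 < ε → ε ≤ 1 → ∃ K, 0 ≤ K ∧ ∀ u : SchwartzSpinor n N,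
    ∃ G : EuclideanSpace ℝ (Fin n) → ℝ, Integrable G ∧ ∫ x, G x = 0 ∧ ∀ x,
      weight ε s x * (p * gradSq u x + q * ‖u x‖ ^ 2)
        - C * ε * (weight ε s x * (gradSq u x + ‖u x‖ ^ 2))
        - K * (weight ε s x * √(1 + ε ^ 2 * ‖x‖ ^ 2) * (‖T u x‖ * jetNorm u x)) ≤ G x

theorem EnergyBound.const_mul_add {T : Module.End ℂ (SchwartzSpinor n N)} {s p q p' q' : ℝ}
    (h : EnergyBound T s p q) (h' : EnergyBound T s p' q') {c : ℝ} (hc : 0 ≤ c) :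
    EnergyBound T s (c * p + p') (c * q + q') := by
  obtain ⟨C, hC, h⟩ := h
  obtain ⟨C', hC', h'⟩ := h'
  refine ⟨c * C + C', by positivity, fun ε hε hε1 => ?_⟩
  obtain ⟨K, hK, h⟩ := h ε hε hε1
  obtain ⟨K', hK', h'⟩ := h' ε hε hε1
  refine ⟨c * K + K', by positivity, fun u => ?_⟩
  obtain ⟨G, hG, hG0, h⟩ := h u
  obtain ⟨G', hG', hG0', h'⟩ := h' u
  refine ⟨fun x => c * G x + G' x, (hG.const_mul c).add hG', ?_, fun x => ?_⟩
  · rw [integral_add (hG.const_mul c) hG', integral_const_mul, hG0, hG0', mul_zero, add_zero]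
  · have h1 := mul_le_mul_of_nonneg_left (h x) hc
    have h2 := h' x
    linarith

theorem integrable_re_inner (f g : SchwartzSpinor n N) :
    Integrable (fun x => (inner ℂ (f x) (g x)).re) :=
  (integrable_inner f g).re

theorem integral_re_inner (f g : SchwartzSpinor n N) :
    ∫ x, (inner ℂ (f x) (g x)).re = (form f g).re := by
  rw [form_apply]
  exact integral_re (integrable_inner f g)

theorem abs_re_inner_le (a b : EuclideanSpace ℂ (Fin N)) :
    |(inner ℂ a b).re| ≤ ‖a‖ * ‖b‖ :=
  (Complex.abs_re_le_norm _).trans (norm_inner_le_norm _ _)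

theorem norm_toEuclideanLin_apply {M : Matrix (Fin N) (Fin N) ℂ} (hM : M.IsHermitian)
    (hM2 : M * M = 1) (v : EuclideanSpace ℂ (Fin N)) : ‖Matrix.toEuclideanLin M v‖ = ‖v‖ := by
  have h1 := Matrix.isSymmetric_toEuclideanLin_iff.mpr hM v (Matrix.toEuclideanLin M v)
  have h2 : Matrix.toEuclideanLin M (Matrix.toEuclideanLin M v) = v := by
    simp [Matrix.toEuclideanLin, Matrix.toLpLin_apply, hM2]
  rw [h2, inner_self_eq_norm_sq_to_K, inner_self_eq_norm_sq_to_K] at h1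
  norm_cast at h1
  exact (sq_eq_sq₀ (norm_nonneg _) (norm_nonneg _)).mp h1

theorem norm_abstractDirac_apply_le {α : Fin n → Matrix (Fin N) (Fin N) ℂ}
    {β : Matrix (Fin N) (Fin N) ℂ} (hαh : ∀ j, (α j).IsHermitian) (hβh : β.IsHermitian)
    (hα2 : ∀ j, α j * α j = 1) (hβ2 : β * β = 1) (m : ℝ) (u : SchwartzSpinor n N)
    (x : EuclideanSpace ℝ (Fin n)) :
    ‖abstractDirac partialDeriv (fun j => matrixOp (α j)) (matrixOp β) m u x‖
      ≤ ∑ j, ‖partialDeriv j u x‖ + |m| * ‖u x‖ := by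
  rw [abstractDirac_apply, diracOp]
  refine (norm_add_le _ _).trans (add_le_add ?_ ?_)
  · rw [norm_smul, norm_neg, Complex.norm_I, one_mul]
    exact norm_sum_le_of_le _ fun j _ => (norm_toEuclideanLin_apply (hαh j) (hα2 j) _).le
  · rw [norm_smul, norm_toEuclideanLin_apply hβh hβ2, Complex.norm_real, Real.norm_eq_abs]

end Energy

end SchwartzSpinor

namespace SchwartzSpinor

section Test

variable {n N : ℕ}

theorem re_inner_smul_self (z : ℂ) (v : EuclideanSpace ℂ (Fin N)) :
    (inner ℂ v (z • v)).re = z.re * ‖v‖ ^ 2 := by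
  have h : inner ℂ v v = ((‖v‖ ^ 2 : ℝ) : ℂ) := by
    rw [inner_self_eq_norm_sq_to_K]
    norm_cast
  rw [inner_smul_right, h, Complex.re_mul_ofReal]

theorem partialDeriv_mulOp_weight_apply (ε s : ℝ) (j : Fin n) (u : SchwartzSpinor n N)
    (x : EuclideanSpace ℝ (Fin n)) :
    partialDeriv j (mulOp (weight ε s) u) x = weight ε s x • partialDeriv j u x
      + (2 * s * (ε ^ 2 * x j * weight ε (s - 1) x)) • u x := by
  have hg' : (fun x : EuclideanSpace ℝ (Fin n) =>
      2 * s * ε ^ 2 * (x j * weight ε (s - 1) x)).HasTemperateGrowth :=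
    .mul (.const _) ((hasTemperateGrowth_coord j).mul (hasTemperateGrowth_weight ε (s - 1)))
  rw [partialDeriv_mulOp (hasTemperateGrowth_weight ε s) hg' j
    (fun x => by rw [fderiv_weight]; ring), add_apply,
    mulOp_apply (hasTemperateGrowth_weight ε s), mulOp_apply hg']
  congr 2
  ring

theorem abs_weight_deriv_le {ε : ℝ} (hε : 0 ≤ ε) (s : ℝ) (j : Fin n)
    (x : EuclideanSpace ℝ (Fin n)) :
    |2 * s * (ε ^ 2 * x j * weight ε (s - 1) x)| ≤ 2 * |s| * (ε * weight ε s x) := by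
  rw [abs_mul, abs_mul, Nat.abs_ofNat]
  exact mul_le_mul_of_nonneg_left (abs_weight_sub_one_le hε s j x) (by positivity)

theorem norm_weight_deriv_smul_le {ε : ℝ} (hε : 0 ≤ ε) (s : ℝ) (ζ : ℂ) (j : Fin n)
    (u : SchwartzSpinor n N) (x : EuclideanSpace ℝ (Fin n)) :
    ‖ζ • (2 * s * (ε ^ 2 * x j * weight ε (s - 1) x)) • u x‖
      ≤ ‖ζ‖ * (2 * |s|) * (ε * weight ε s x) * ‖u x‖ := by
  rw [norm_smul, norm_smul, Real.norm_eq_abs]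
  have h1 := mul_le_mul_of_nonneg_left (abs_weight_deriv_le hε s j x)
    (by positivity : 0 ≤ ‖ζ‖ * ‖u x‖)
  linarith

theorem partialDeriv_smul_mulOp_weight_apply (ε s : ℝ) (ζ : ℂ) (j : Fin n)
    (u : SchwartzSpinor n N) (x : EuclideanSpace ℝ (Fin n)) :
    partialDeriv j (ζ • mulOp (weight ε s) u) x = ζ • weight ε s x • partialDeriv j u x
      + ζ • (2 * s * (ε ^ 2 * x j * weight ε (s - 1) x)) • u x := by
  rw [map_smul, smul_apply, partialDeriv_mulOp_weight_apply, smul_add]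

theorem re_inner_smul_smul_self (z : ℂ) (r : ℝ) (v : EuclideanSpace ℂ (Fin N)) :
    (inner ℂ v (z • r • v)).re = r * (z.re * ‖v‖ ^ 2) := by
  rw [smul_comm, inner_smul_right_eq_smul, Complex.smul_re, re_inner_smul_self, smul_eq_mul]

theorem le_sum_re_inner_partialDeriv_weight {ε : ℝ} (hε : 0 ≤ ε) (s : ℝ) (ζ : ℂ)
    (u : SchwartzSpinor n N) (x : EuclideanSpace ℝ (Fin n)) :
    weight ε s x * (ζ.re * gradSq u x)
        - ‖ζ‖ * (2 * |s|) * (ε * weight ε s x) * (n + 1) * (gradSq u x + ‖u x‖ ^ 2)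
      ≤ ∑ j, (inner ℂ (partialDeriv j u x)
          (partialDeriv j (ζ • mulOp (weight ε s) u) x)).re := by
  have hW := weight_pos ε s x
  simp only [partialDeriv_smul_mulOp_weight_apply, inner_add_right, Complex.add_re,
    re_inner_smul_smul_self, Finset.sum_add_distrib, ← Finset.mul_sum]
  have h1 := neg_le_sum_re_inner (fun j => partialDeriv j u x) _ (u x)
    (by positivity) (fun j => norm_weight_deriv_smul_le hε s ζ j u x)
  simp only [gradSq]
  linarith

theorem norm_smul_mulOp_weight (ε s : ℝ) (ζ : ℂ) (u : SchwartzSpinor n N)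
    (x : EuclideanSpace ℝ (Fin n)) :
    ‖(ζ • mulOp (weight ε s) u) x‖ = ‖ζ‖ * weight ε s x * ‖u x‖ := by
  rw [smul_apply, mulOp_apply (hasTemperateGrowth_weight ε s), norm_smul, norm_smul,
    Real.norm_of_nonneg (weight_pos ε s x).le, mul_assoc]

theorem norm_partialDeriv_weight_le {ε : ℝ} (hε : 0 ≤ ε) (hε1 : ε ≤ 1) (s : ℝ) (ζ : ℂ)
    (j : Fin n) (u : SchwartzSpinor n N) (x : EuclideanSpace ℝ (Fin n)) :
    ‖partialDeriv j (ζ • mulOp (weight ε s) u) x‖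
      ≤ ‖ζ‖ * weight ε s x * ‖partialDeriv j u x‖
        + ‖ζ‖ * (2 * |s|) * weight ε s x * ‖u x‖ := by
  have hW := weight_pos ε s x
  rw [partialDeriv_smul_mulOp_weight_apply]
  refine (norm_add_le _ _).trans
    (add_le_add ?_ ((norm_weight_deriv_smul_le hε s ζ j u x).trans ?_))
  · rw [norm_smul, norm_smul, Real.norm_of_nonneg hW.le, mul_assoc]
  · have : ε * weight ε s x ≤ weight ε s x := by nlinarith
    gcongr

theorem norm_sum_partialDeriv_weight_le {ε : ℝ} (hε : 0 ≤ ε) (hε1 : ε ≤ 1) (s : ℝ) (ζ : ℂ)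
    (u : SchwartzSpinor n N) (x : EuclideanSpace ℝ (Fin n)) {l : ℝ} (hl : 0 ≤ l) :
    ∑ j, ‖partialDeriv j (ζ • mulOp (weight ε s) u) x‖ + l * ‖(ζ • mulOp (weight ε s) u) x‖
      ≤ ‖ζ‖ * (1 + 2 * |s| * n + l) * (weight ε s x * jetNorm u x) := by
  have hW := weight_pos ε s x
  have h2 := Finset.sum_le_sum fun j (_ : j ∈ Finset.univ) =>
    norm_partialDeriv_weight_le hε hε1 s ζ j u x
  rw [Finset.sum_add_distrib, ← Finset.mul_sum] at h2
  simp only [Finset.sum_const, Finset.card_univ, Fintype.card_fin, nsmul_eq_mul] at h2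
  have h4 : 0 ≤ ‖ζ‖ * (2 * |s| * n + l) * weight ε s x * ∑ j, ‖partialDeriv j u x‖ := by
    positivity
  have h5 : 0 ≤ ‖ζ‖ * weight ε s x * ‖u x‖ := by positivity
  rw [norm_smul_mulOp_weight]
  unfold jetNorm
  linarith

theorem re_inner_le_of_norm_le (ε s : ℝ) (u : SchwartzSpinor n N) (x : EuclideanSpace ℝ (Fin n))
    {a b : EuclideanSpace ℂ (Fin N)} {K : ℝ}
    (hb : ‖b‖ ≤ K * (weight ε s x * √(1 + ε ^ 2 * ‖x‖ ^ 2) * jetNorm u x)) :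
    (inner ℂ a b).re
      ≤ K * (weight ε s x * √(1 + ε ^ 2 * ‖x‖ ^ 2) * (‖a‖ * jetNorm u x)) := by
  have h1 := (abs_le.mp (abs_re_inner_le a b)).2
  have h2 := mul_le_mul_of_nonneg_left hb (norm_nonneg a)
  linarith

theorem weight_mul_jetNorm_le (ε s : ℝ) (u : SchwartzSpinor n N)
    (x : EuclideanSpace ℝ (Fin n)) :
    weight ε s x * jetNorm u x
      ≤ weight ε s x * √(1 + ε ^ 2 * ‖x‖ ^ 2) * jetNorm u x :=
  mul_le_mul_of_nonneg_right
    (le_mul_of_one_le_right (weight_pos ε s x).le (weight_scale ε s x).1) (jetNorm_nonneg u x)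

variable {α : Fin n → Matrix (Fin N) (Fin N) ℂ} {β : Matrix (Fin N) (Fin N) ℂ}

/-- Testing the equation against `ζ (1 + ε²|x|²)^s u`. -/
theorem energyBound_test
    (hαh : ∀ j, (α j).IsHermitian) (hβh : β.IsHermitian)
    (hα2 : ∀ j, α j * α j = 1) (hβ2 : β * β = 1)
    (hαα : ∀ j k, j ≠ k → α j * α k + α k * α j = 0)
    (hαβ : ∀ j, α j * β + β * α j = 0) (m : ℝ) (lam : ℂ) (s : ℝ) (ζ : ℂ) :
    EnergyBound (abstractDirac partialDeriv (fun j => matrixOp (α j)) (matrixOp β) m - lam • 1)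
      s ζ.re (-(starRingEnd ℂ (lam ^ 2 - (m : ℂ) ^ 2) * ζ).re) := by
  have hnorm := norm_abstractDirac_apply_le (n := n) hαh hβh hα2 hβ2 m
  have hfac := (isDiracSystem (n := n) hαh hβh hα2 hβ2 hαα hαβ).factorization m lam
  generalize abstractDirac (partialDeriv (n := n)) (fun j => matrixOp (α j)) (matrixOp β) m = D
    at *
  generalize starRingEnd ℂ (lam ^ 2 - (m : ℂ) ^ 2) = μ at *
  refine ⟨‖ζ‖ * (2 * |s|) * (n + 1), by positivity, fun ε hε hε1 =>
    ⟨‖ζ‖ * (1 + 2 * |s| * n + (|m| + ‖lam‖)), by positivity, fun u => ?_⟩⟩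
  have hgrad := le_sum_re_inner_partialDeriv_weight hε.le s ζ u
  have hsum := fun x => norm_sum_partialDeriv_weight_le hε.le hε1 s ζ u x
    (by positivity : 0 ≤ |m| + ‖lam‖)
  have hmass : ∀ x, (inner ℂ (u x) ((μ • ζ • mulOp (weight ε s) u) x)).re
      = weight ε s x * ((μ * ζ).re * ‖u x‖ ^ 2) := fun x => by
    rw [smul_smul, smul_apply, mulOp_apply (hasTemperateGrowth_weight ε s),
      re_inner_smul_smul_self]
  generalize ζ • mulOp (weight ε s) u = v at *
  have hint : Integrable (fun x => ∑ j, (inner ℂ (partialDeriv j u x) (partialDeriv j v x)).re) :=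
    integrable_finsetSum _ fun j _ => integrable_re_inner _ _
  have hint' : Integrable (fun x => ∑ j, (inner ℂ (partialDeriv j u x) (partialDeriv j v x)).re
      - (inner ℂ (u x) ((μ • v) x)).re) := hint.sub (integrable_re_inner _ _)
  refine ⟨fun x => ∑ j, (inner ℂ (partialDeriv j u x) (partialDeriv j v x)).re
    - (inner ℂ (u x) ((μ • v) x)).re
    - (inner ℂ ((D - lam • 1) u x) ((D v + (starRingEnd ℂ lam) • v) x)).re,
    hint'.sub (integrable_re_inner _ _), ?_, fun x => ?_⟩
  · rw [integral_sub hint' (integrable_re_inner _ _), integral_sub hint (integrable_re_inner _ _),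
      integral_finsetSum _ (fun j _ => integrable_re_inner _ _)]
    simp only [integral_re_inner]
    have h := congrArg Complex.re (hfac u v)
    rw [Complex.sub_re, Complex.re_sum, ← smul_eq_mul, ← map_smul] at h
    have h' : (D - lam • 1) u = D u - lam • u := rfl
    rw [h', h, sub_self]
  · have hDv : ‖(D v + (starRingEnd ℂ lam) • v) x‖
        ≤ ‖ζ‖ * (1 + 2 * |s| * n + (|m| + ‖lam‖))
          * (weight ε s x * √(1 + ε ^ 2 * ‖x‖ ^ 2) * jetNorm u x) := by
      rw [add_apply, smul_apply]
      calc _ ≤ ‖D v x‖ + ‖(starRingEnd ℂ lam) • v x‖ := norm_add_le _ _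
        _ ≤ ∑ j, ‖partialDeriv j v x‖ + |m| * ‖v x‖ + ‖lam‖ * ‖v x‖ := by
          rw [norm_smul, RCLike.norm_conj]
          exact add_le_add_left (hnorm v x) _
        _ ≤ _ := by rw [add_assoc, ← add_mul]; exact hsum x
        _ ≤ _ := mul_le_mul_of_nonneg_left (weight_mul_jetNorm_le ε s u x) (by positivity)
    have hT := re_inner_le_of_norm_le ε s u x (a := (D - lam • 1) u x) hDv
    have hg := hgrad x
    beta_reduce
    rw [hmass]
    linarith

end Test

end SchwartzSpinor

namespace SchwartzSpinor

section Virial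

variable {n N : ℕ}

/-- The symmetrized generator of the flow along `radialField`, without the factor `i`. -/
def radialGen (ε s : ℝ) : Module.End ℂ (SchwartzSpinor n N) :=
  (1 / 2 : ℂ) • ∑ k, (mulOp (radialField ε s k) * partialDeriv k
    + partialDeriv k * mulOp (radialField ε s k))

/-- The commutator of `partialDeriv j` and `radialGen`. -/
def radialComm (ε s : ℝ) (j : Fin n) : Module.End ℂ (SchwartzSpinor n N) :=
  (1 / 2 : ℂ) • ∑ k, (mulOp (radialJacobian ε s j k) * partialDeriv k
    + partialDeriv k * mulOp (radialJacobian ε s j k))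

theorem form_radialGen (ε s : ℝ) (u v : SchwartzSpinor n N) :
    form (radialGen ε s u) v = -form u (radialGen ε s v) := by
  have h : ∀ k, form (mulOp (radialField ε s k) (partialDeriv k u)) v
      + form (partialDeriv k (mulOp (radialField ε s k) u)) v
      = -(form u (mulOp (radialField ε s k) (partialDeriv k v))
        + form u (partialDeriv k (mulOp (radialField ε s k) v))) := fun k => by
    have hg := hasTemperateGrowth_radialField ε s k
    rw [form_mulOp hg, form_partialDeriv, form_partialDeriv, form_mulOp hg]
    ring
  have h2 : starRingEnd ℂ (1 / 2) = 1 / 2 := by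
    rw [map_div₀, map_one, map_ofNat]
  simp only [radialGen, LinearMap.smul_apply, LinearMap.sum_apply, LinearMap.add_apply,
    Module.End.mul_apply, map_sum, map_add, LinearMap.map_smulₛₗ, h2, h, RingHom.id_apply,
    Finset.sum_neg_distrib, smul_neg]

theorem matrixOp_radialGen (ε s : ℝ) (M : Matrix (Fin N) (Fin N) ℂ) :
    matrixOp M * radialGen (n := n) ε s = radialGen ε s * matrixOp M := by
  simp only [radialGen, mul_smul_comm, smul_mul_assoc, Finset.mul_sum, Finset.sum_mul]
  congr 1
  refine Finset.sum_congr rfl fun k _ => ?_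
  have hX := matrixOp_mulOp (hasTemperateGrowth_radialField ε s k) M
  have hP := partialDeriv_matrixOp k M
  rw [mul_add, add_mul, ← mul_assoc, hX, mul_assoc, ← hP, ← mul_assoc, ← mul_assoc, ← hP,
    mul_assoc (partialDeriv k), hX, ← mul_assoc]

theorem partialDeriv_radialGen (ε s : ℝ) (j : Fin n) (u : SchwartzSpinor n N) :
    partialDeriv j (radialGen ε s u) = radialGen ε s (partialDeriv j u) + radialComm ε s j u := by
  have hP : ∀ k (v : SchwartzSpinor n N), partialDeriv j (partialDeriv k v)
      = partialDeriv k (partialDeriv j v) := fun k v =>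
    LinearMap.congr_fun (partialDeriv_comm j k) v
  have hX : ∀ k (v : SchwartzSpinor n N), partialDeriv j (mulOp (radialField ε s k) v)
      = mulOp (radialField ε s k) (partialDeriv j v) + mulOp (radialJacobian ε s j k) v :=
    fun k v => partialDeriv_mulOp (hasTemperateGrowth_radialField ε s k)
      (hasTemperateGrowth_radialJacobian ε s j k) j (fderiv_radialField ε s j k) v
  simp only [radialGen, radialComm, LinearMap.smul_apply, LinearMap.sum_apply,
    LinearMap.add_apply, Module.End.mul_apply, map_smul, map_sum, map_add, ← smul_add,
    ← Finset.sum_add_distrib]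
  congr 1
  refine Finset.sum_congr rfl fun k _ => ?_
  rw [hX, hP k, hP k, hX, map_add]
  abel

theorem half_smul_sum_add_add (p q : Fin n → EuclideanSpace ℂ (Fin N)) :
    (1 / 2 : ℂ) • ∑ k, (p k + (p k + q k)) = ∑ k, p k + (1 / 2 : ℂ) • ∑ k, q k := by
  rw [Finset.sum_add_distrib, Finset.sum_add_distrib, ← add_assoc, ← two_smul ℂ (∑ k, p k),
    smul_add, smul_smul]
  norm_num

theorem radialGen_apply (ε s : ℝ) (u : SchwartzSpinor n N) (x : EuclideanSpace ℝ (Fin n)) :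
    radialGen ε s u x = ∑ k, radialField ε s k x • partialDeriv k u x
      + (1 / 2 : ℂ) • ∑ k, radialJacobian ε s k k x • u x := by
  rw [← half_smul_sum_add_add]
  have hX : ∀ k, partialDeriv k (mulOp (radialField ε s k) u)
      = mulOp (radialField ε s k) (partialDeriv k u) + mulOp (radialJacobian ε s k k) u :=
    fun k => partialDeriv_mulOp (hasTemperateGrowth_radialField ε s k)
      (hasTemperateGrowth_radialJacobian ε s k k) k (fderiv_radialField ε s k k) u
  simp only [radialGen, LinearMap.smul_apply, LinearMap.sum_apply, LinearMap.add_apply,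
    Module.End.mul_apply, smul_apply, sum_apply, add_apply, hX,
    mulOp_apply (hasTemperateGrowth_radialField ε s _),
    mulOp_apply (hasTemperateGrowth_radialJacobian ε s _ _)]

theorem radialComm_apply (ε s : ℝ) (j : Fin n) (u : SchwartzSpinor n N)
    (x : EuclideanSpace ℝ (Fin n)) :
    radialComm ε s j u x = ∑ k, radialJacobian ε s j k x • partialDeriv k u x
      + (1 / 2 : ℂ) • ∑ k, radialHessian ε s j k x • u x := by
  rw [← half_smul_sum_add_add]
  have hX : ∀ k, partialDeriv k (mulOp (radialJacobian ε s j k) u)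
      = mulOp (radialJacobian ε s j k) (partialDeriv k u) + mulOp (radialHessian ε s j k) u :=
    fun k => partialDeriv_mulOp (hasTemperateGrowth_radialJacobian ε s j k)
      (hasTemperateGrowth_radialHessian ε s j k) k (fderiv_radialJacobian ε s j k) u
  simp only [radialComm, LinearMap.smul_apply, LinearMap.sum_apply, LinearMap.add_apply,
    Module.End.mul_apply, smul_apply, sum_apply, add_apply, hX,
    mulOp_apply (hasTemperateGrowth_radialJacobian ε s _ _),
    mulOp_apply (hasTemperateGrowth_radialHessian ε s _ _)]

theorem norm_half_smul_sum_smul_le (g : Fin n → ℝ) {c : ℝ} (hg : ∀ k, |g k| ≤ c)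
    (v : EuclideanSpace ℂ (Fin N)) :
    ‖(1 / 2 : ℂ) • ∑ k, g k • v‖ ≤ n * c * ‖v‖ := by
  have h := norm_sum_smul_le (fun _ => v) g hg
  simp only [Finset.sum_const, Finset.card_univ, Fintype.card_fin, nsmul_eq_mul] at h
  have h0 := norm_nonneg (∑ k, g k • v)
  rw [norm_smul]
  norm_num
  linarith

theorem norm_radialGen_apply_le {ε : ℝ} (hε : 0 < ε) (s : ℝ) (u : SchwartzSpinor n N)
    (x : EuclideanSpace ℝ (Fin n)) :
    ‖radialGen ε s u x‖ ≤ (ε⁻¹ + n * (1 + 2 * |s|))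
      * (weight ε s x * √(1 + ε ^ 2 * ‖x‖ ^ 2) * jetNorm u x) := by
  have hW := weight_pos ε s x
  have hh := (weight_scale ε s x).1
  have hWh : weight ε s x ≤ weight ε s x * √(1 + ε ^ 2 * ‖x‖ ^ 2) :=
    le_mul_of_one_le_right hW.le hh
  have h1 := norm_sum_smul_le (fun k => partialDeriv k u x) _
    (fun k => abs_radialField_le hε s k x)
  have h2 := norm_half_smul_sum_smul_le _ (fun k => (abs_radialJacobian_le hε.le s k k x).trans
    (mul_le_mul_of_nonneg_left hWh (by positivity))) (u x)
  rw [radialGen_apply]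
  refine (norm_add_le _ _).trans ((add_le_add h1 h2).trans ?_)
  generalize weight ε s x * √(1 + ε ^ 2 * ‖x‖ ^ 2) = w at *
  have hw : 0 ≤ w := hW.le.trans hWh
  have h3 : 0 ≤ ε⁻¹ * (w * ‖u x‖) := by positivity
  have h4 : 0 ≤ n * (1 + 2 * |s|) * (w * ∑ k, ‖partialDeriv k u x‖) := by positivity
  unfold jetNorm
  linarith

theorem norm_half_smul_hessian_le {ε : ℝ} (hε : 0 ≤ ε) (s : ℝ) (j : Fin n)
    (u : SchwartzSpinor n N) (x : EuclideanSpace ℝ (Fin n)) :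
    ‖(1 / 2 : ℂ) • ∑ k, radialHessian ε s j k x • u x‖
      ≤ n * (2 * |s| * (3 + 2 * |s - 1|) * (ε * weight ε s x)) * ‖u x‖ :=
  norm_half_smul_sum_smul_le _ (fun k => abs_radialHessian_le hε s j k x) (u x)

theorem norm_radialComm_apply_le {ε : ℝ} (hε : 0 < ε) (hε1 : ε ≤ 1) (s : ℝ) (j : Fin n)
    (u : SchwartzSpinor n N) (x : EuclideanSpace ℝ (Fin n)) :
    ‖radialComm ε s j u x‖ ≤ (1 + 2 * |s| + n * (2 * |s| * (3 + 2 * |s - 1|)))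
      * (weight ε s x * √(1 + ε ^ 2 * ‖x‖ ^ 2) * jetNorm u x) := by
  have hW := weight_pos ε s x
  have hwy := weight_mul_jetNorm_le ε s u x
  have h1 := norm_sum_smul_le (fun k => partialDeriv k u x) _
    (fun k => abs_radialJacobian_le hε.le s j k x)
  have h2 := norm_half_smul_hessian_le hε.le s j u x
  have hεW : ε * weight ε s x ≤ weight ε s x := by nlinarith
  have h3 : n * (2 * |s| * (3 + 2 * |s - 1|) * (ε * weight ε s x)) * ‖u x‖
      ≤ n * (2 * |s| * (3 + 2 * |s - 1|) * weight ε s x) * ‖u x‖ := by gcongr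
  rw [radialComm_apply]
  refine (norm_add_le _ _).trans ((add_le_add h1 (h2.trans h3)).trans ?_)
  refine le_trans ?_ (mul_le_mul_of_nonneg_left hwy (by positivity))
  have h4 : 0 ≤ (1 + 2 * |s|) * (weight ε s x * ‖u x‖) := by positivity
  have h5 : 0 ≤ n * (2 * |s| * (3 + 2 * |s - 1|))
      * (weight ε s x * ∑ k, ‖partialDeriv k u x‖) := by positivity
  unfold jetNorm
  linarith

theorem le_sum_re_inner_radialComm {ε : ℝ} (hε : 0 ≤ ε) (s : ℝ) (u : SchwartzSpinor n N)
    (x : EuclideanSpace ℝ (Fin n)) :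
    min 1 (1 + 2 * s) * (weight ε s x * gradSq u x)
      - n * (2 * |s| * (3 + 2 * |s - 1|) * (ε * weight ε s x)) * (n + 1)
        * (gradSq u x + ‖u x‖ ^ 2)
      ≤ ∑ j, (inner ℂ (partialDeriv j u x) (radialComm ε s j u x)).re := by
  have hW := weight_pos ε s x
  have h1 := le_sum_radialJacobian_inner ε s x (fun j => partialDeriv j u x)
  have h2 := neg_le_sum_re_inner (fun j => partialDeriv j u x) _ (u x)
    (by positivity) (fun j => norm_half_smul_hessian_le hε s j u x)
  simp only [radialComm_apply, inner_add_right, Complex.add_re, Finset.sum_add_distrib]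
  simp only [gradSq]
  linarith

variable {α : Fin n → Matrix (Fin N) (Fin N) ℂ} {β : Matrix (Fin N) (Fin N) ℂ}

theorem energyBound_virial
    (hαh : ∀ j, (α j).IsHermitian) (hβh : β.IsHermitian)
    (hα2 : ∀ j, α j * α j = 1) (hβ2 : β * β = 1)
    (hαα : ∀ j k, j ≠ k → α j * α k + α k * α j = 0)
    (hαβ : ∀ j, α j * β + β * α j = 0) (m lam s : ℝ) :
    EnergyBound
      (abstractDirac partialDeriv (fun j => matrixOp (α j)) (matrixOp β) m - (lam : ℂ) • 1)
      s (min 1 (1 + 2 * s)) 0 := by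
  set CH := 2 * |s| * (3 + 2 * |s - 1|) with hCH
  have hCH0 : 0 ≤ CH := by positivity
  refine ⟨n * CH * (n + 1), by positivity, fun ε hε hε1 =>
    ⟨2 * |lam| * (ε⁻¹ + n * (1 + 2 * |s|)) + n * (1 + 2 * |s| + n * CH),
      by positivity, fun u => ?_⟩⟩
  have hvir := (isDiracSystem (n := n) hαh hβh hα2 hβ2 hαα hαβ).virial m lam (radialGen ε s)
    (form_radialGen ε s) (fun j => matrixOp_radialGen ε s (α j)) (matrixOp_radialGen ε s β)
    u (fun j => radialComm ε s j u) (fun j => partialDeriv_radialGen ε s j u)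
  generalize abstractDirac (partialDeriv (n := n)) (fun j => matrixOp (α j)) (matrixOp β) m = D
    at *
  set g := (2 * lam : ℂ) • radialGen ε s u
    + (-Complex.I) • ∑ j, matrixOp (α j) (radialComm ε s j u) with hg
  have hint : Integrable
      (fun x => ∑ j, (inner ℂ (partialDeriv j u x) (radialComm ε s j u x)).re) :=
    integrable_finsetSum _ fun j _ => integrable_re_inner _ _
  refine ⟨fun x => ∑ j, (inner ℂ (partialDeriv j u x) (radialComm ε s j u x)).re
    - (inner ℂ ((D - (lam : ℂ) • 1) u x) (g x)).re,
    hint.sub (integrable_re_inner _ _), ?_, fun x => ?_⟩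
  · rw [integral_sub hint (integrable_re_inner _ _),
      integral_finsetSum _ (fun j _ => integrable_re_inner _ _)]
    simp only [integral_re_inner]
    have h' : (D - (lam : ℂ) • 1) u = D u - (lam : ℂ) • u := rfl
    rw [h', ← hvir, Complex.re_sum, sub_self]
  · have hgx : ‖g x‖ ≤ (2 * |lam| * (ε⁻¹ + n * (1 + 2 * |s|)) + n * (1 + 2 * |s| + n * CH))
        * (weight ε s x * √(1 + ε ^ 2 * ‖x‖ ^ 2) * jetNorm u x) := by
      have h1 := mul_le_mul_of_nonneg_left (norm_radialGen_apply_le hε s u x)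
        (by positivity : 0 ≤ 2 * |lam|)
      have h2 := Finset.sum_le_sum fun j (_ : j ∈ Finset.univ) =>
        norm_radialComm_apply_le hε hε1 s j u x
      simp only [Finset.sum_const, Finset.card_univ, Fintype.card_fin, nsmul_eq_mul] at h2
      have h3 : ‖(2 * lam : ℂ) • radialGen ε s u x‖ = 2 * |lam| * ‖radialGen ε s u x‖ := by
        rw [norm_smul]; simp
      have h4 : ‖(-Complex.I) • ∑ j, matrixOp (α j) (radialComm ε s j u) x‖
          ≤ ∑ j, ‖radialComm ε s j u x‖ := by
        rw [norm_smul, norm_neg, Complex.norm_I, one_mul]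
        exact norm_sum_le_of_le _ fun j _ => (norm_toEuclideanLin_apply (hαh j) (hα2 j) _).le
      rw [hg, add_apply, smul_apply, smul_apply, sum_apply]
      refine (norm_add_le _ _).trans ?_
      rw [h3]
      linarith
    have hT := re_inner_le_of_norm_le ε s u x (a := (D - (lam : ℂ) • 1) u x) hgx
    have hc := le_sum_re_inner_radialComm hε.le s u x
    rw [← hCH] at hc
    linarith

end Virial

end SchwartzSpinor

namespace SchwartzSpinor

section Coercive

variable {n N : ℕ} {α : Fin n → Matrix (Fin N) (Fin N) ℂ} {β : Matrix (Fin N) (Fin N) ℂ}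

theorem exists_energyBound_pos
    (hαh : ∀ j, (α j).IsHermitian) (hβh : β.IsHermitian)
    (hα2 : ∀ j, α j * α j = 1) (hβ2 : β * β = 1)
    (hαα : ∀ j k, j ≠ k → α j * α k + α k * α j = 0)
    (hαβ : ∀ j, α j * β + β * α j = 0) {m : ℝ} {lam : ℂ}
    (hlam : lam ≠ m) (hlam' : lam ≠ -m) {s : ℝ} (hs : -(1 / 2 : ℝ) < s) :
    ∃ p q, 0 < p ∧ 0 < q ∧ EnergyBound
      (abstractDirac (partialDeriv (n := n)) (fun j => matrixOp (α j)) (matrixOp β) m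
        - lam • 1) s p q := by
  have htest := energyBound_test hαh hβh hα2 hβ2 hαα hαβ m lam s
  have hμ : lam ^ 2 - (m : ℂ) ^ 2 ≠ 0 := by
    rw [sq_sub_sq]
    exact mul_ne_zero (by rwa [← sub_neg_eq_add, sub_ne_zero]) (sub_ne_zero.mpr hlam)
  set μ := lam ^ 2 - (m : ℂ) ^ 2 with hμdef
  by_cases him : μ.im = 0
  · have hre : μ.re ≠ 0 := fun h => hμ (Complex.ext h him)
    rcases lt_or_gt_of_ne hre with hneg | hpos
    · exact ⟨_, _, by norm_num, by simpa using hneg, htest 1⟩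
    · have him' : lam.im = 0 := by
        have h1 : 2 * lam.re * lam.im = 0 := by
          have : μ.im = 2 * lam.re * lam.im := by simp [hμdef, pow_two]; ring
          rw [← this, him]
        have h2 : μ.re = lam.re ^ 2 - lam.im ^ 2 - m ^ 2 := by simp [hμdef, pow_two]
        by_contra hne
        have h3 : lam.re = 0 := by simpa [hne] using h1
        rw [h2, h3] at hpos
        nlinarith [sq_nonneg lam.im, sq_nonneg m]
      have hvir := energyBound_virial hαh hβh hα2 hβ2 hαα hαβ m lam.re s
      rw [(Complex.ext rfl (by simp [him']) : ((lam.re : ℝ) : ℂ) = lam)] at hvir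
      have hκ : 0 < min 1 (1 + 2 * s) := lt_min one_pos (by linarith)
      refine ⟨_, _, ?_, ?_, hvir.const_mul_add (htest (-1))
        (c := 2 / min 1 (1 + 2 * s)) (by positivity)⟩
      · rw [div_mul_cancel₀ _ hκ.ne']
        norm_num
      · simpa using hpos
  · refine ⟨_, _, ?_, ?_, htest ⟨1, -(μ.re + 1) / μ.im⟩⟩
    · exact one_pos
    · simp only [Complex.mul_re, Complex.conj_re, Complex.conj_im, mul_one]
      field_simp
      linarith

theorem integrable_weight_mul_norm_sq (ε t : ℝ) (f : SchwartzSpinor n N) :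
    Integrable (fun x => weight ε t x * ‖f x‖ ^ 2) := by
  have h := integrable_re_inner f (mulOp (weight ε t) f)
  refine h.congr (.of_forall fun x => ?_)
  have h1 := re_inner_smul_smul_self 1 (weight ε t x) (f x)
  simpa [mulOp_apply (hasTemperateGrowth_weight ε t)] using h1

theorem integrable_weight_mul_energy (ε t : ℝ) (u : SchwartzSpinor n N) :
    Integrable (fun x => weight ε t x * (gradSq u x + ‖u x‖ ^ 2)) := by
  simp only [gradSq, mul_add, Finset.mul_sum]
  exact (integrable_finsetSum _ fun j _ => integrable_weight_mul_norm_sq ε t _).add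
    (integrable_weight_mul_norm_sq ε t u)

theorem EnergyBound.integral_le {T : Module.End ℂ (SchwartzSpinor n N)} {s p q : ℝ}
    (h : EnergyBound T s p q) (hp : 0 < p) (hq : 0 < q) :
    ∃ ε C : ℝ, 0 < ε ∧ ε ≤ 1 ∧ 0 ≤ C ∧ ∀ u : SchwartzSpinor n N,
      ∫ x, weight ε s x * (gradSq u x + ‖u x‖ ^ 2)
        ≤ C * ∫ x, weight ε (s + 1) x * ‖T u x‖ ^ 2 := by
  obtain ⟨C, hC, h⟩ := h
  set κ := min p q with hκdef
  have hκ : 0 < κ := lt_min hp hq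
  set ε := min 1 (κ / (2 * (C + 1))) with hεdef
  have hε : 0 < ε := lt_min one_pos (by positivity)
  have hCε : C * ε ≤ κ / 2 := by
    calc C * ε ≤ (C + 1) * (κ / (2 * (C + 1))) := by
          gcongr
          · linarith
          · exact min_le_right _ _
      _ = κ / 2 := by field_simp
  obtain ⟨K, hK, h⟩ := h ε hε (min_le_left _ _)
  set δ : ℝ := κ / (8 * (n + 1)) with hδdef
  have hδ : 0 < δ := by positivity
  refine ⟨ε, 4 / κ * (K ^ 2 / (4 * δ)), hε, min_le_left _ _, by positivity, fun u => ?_⟩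
  obtain ⟨G, hG, hG0, h⟩ := h u
  have hE := integrable_weight_mul_energy ε s u
  have hT := integrable_weight_mul_norm_sq ε (s + 1) (T u)
  have hle : ∀ x, κ / 4 * (weight ε s x * (gradSq u x + ‖u x‖ ^ 2))
      - K ^ 2 / (4 * δ) * (weight ε (s + 1) x * ‖T u x‖ ^ 2) ≤ G x := fun x => by
    refine le_trans ?_ (h x)
    have hW := weight_pos ε s x
    have hS := gradSq_nonneg u x
    have hy := jetNorm_sq_le u x
    have hb : 0 ≤ ‖u x‖ ^ 2 := by positivity
    have hh : √(1 + ε ^ 2 * ‖x‖ ^ 2) ^ 2 = 1 + ε ^ 2 * ‖x‖ ^ 2 := Real.sq_sqrt (by positivity)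
    rw [weight_add_one]
    generalize √(1 + ε ^ 2 * ‖x‖ ^ 2) = r, ‖T u x‖ = t, jetNorm u x = y,
      weight ε s x = W, gradSq u x = S, ‖u x‖ ^ 2 = b at *
    rw [← hh]
    have h1 : κ * (S + b) ≤ p * S + q * b := by
      have := mul_le_mul_of_nonneg_right (min_le_left p q) hS
      have := mul_le_mul_of_nonneg_right (min_le_right p q) hb
      linarith
    have h2 : C * ε * (S + b) ≤ κ / 2 * (S + b) := by gcongr
    have h3 : K * r * t * y ≤ κ / 4 * (S + b) + K ^ 2 / (4 * δ) * (r ^ 2 * t ^ 2) := by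
      have h4 : δ * y ^ 2 ≤ κ / 4 * (S + b) := by
        calc δ * y ^ 2 ≤ δ * (2 * (n + 1) * (S + b)) := by gcongr
          _ = κ / 4 * (S + b) := by rw [hδdef]; field_simp; ring
      have h5 : 0 ≤ (2 * δ * y - K * r * t) ^ 2 / (4 * δ) := by positivity
      have h6 : (2 * δ * y - K * r * t) ^ 2 / (4 * δ)
          = δ * y ^ 2 + K ^ 2 / (4 * δ) * (r ^ 2 * t ^ 2) - K * r * t * y := by
        field_simp
        ring
      linarith
    have h7 : W * (κ / 4 * (S + b) - K ^ 2 / (4 * δ) * (r ^ 2 * t ^ 2))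
        ≤ W * (p * S + q * b - C * ε * (S + b) - K * r * t * y) := by
      refine mul_le_mul_of_nonneg_left ?_ hW.le
      linarith
    linarith
  have hint := integral_mono ((hE.const_mul _).sub (hT.const_mul _)) hG hle
  have hsub : ∫ x, (κ / 4 * (weight ε s x * (gradSq u x + ‖u x‖ ^ 2))
      - K ^ 2 / (4 * δ) * (weight ε (s + 1) x * ‖T u x‖ ^ 2))
      = κ / 4 * (∫ x, weight ε s x * (gradSq u x + ‖u x‖ ^ 2))
        - K ^ 2 / (4 * δ) * ∫ x, weight ε (s + 1) x * ‖T u x‖ ^ 2 := by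
    rw [integral_sub (hE.const_mul _) (hT.const_mul _), integral_const_mul, integral_const_mul]
  have hint' : κ / 4 * (∫ x, weight ε s x * (gradSq u x + ‖u x‖ ^ 2))
        - K ^ 2 / (4 * δ) * ∫ x, weight ε (s + 1) x * ‖T u x‖ ^ 2 ≤ 0 := by
    rw [← hsub, ← hG0]
    exact hint
  rw [mul_assoc, div_mul_eq_mul_div, le_div_iff₀ hκ]
  linarith

theorem norm_sq_le_sum_norm_sq
    (L : EuclideanSpace ℝ (Fin n) →L[ℝ] EuclideanSpace ℂ (Fin N)) :
    ‖L‖ ^ 2 ≤ ∑ j, ‖L (EuclideanSpace.single j 1)‖ ^ 2 := by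
  have h : ‖L‖ ≤ √(∑ j, ‖L (EuclideanSpace.single j 1)‖ ^ 2) := by
    refine L.opNorm_le_bound (Real.sqrt_nonneg _) fun x => ?_
    have hx : L x = ∑ j, x j • L (EuclideanSpace.single j 1) := by
      conv_lhs => rw [← (EuclideanSpace.basisFun (Fin n) ℝ).sum_repr x]
      simp
    have h1 := Real.le_sqrt_of_sq_le
      (norm_sum_coord_smul_sq_le x fun j => L (EuclideanSpace.single j 1))
    rw [← hx, Real.sqrt_mul (sq_nonneg _), Real.sqrt_sq (norm_nonneg _)] at h1
    linarith
  calc ‖L‖ ^ 2 ≤ √(∑ j, ‖L (EuclideanSpace.single j 1)‖ ^ 2) ^ 2 := by gcongr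
    _ = _ := Real.sq_sqrt (by positivity)

theorem mulOp_weight_jet_le (s : ℝ) (u : SchwartzSpinor n N) (x : EuclideanSpace ℝ (Fin n)) :
    ‖mulOp (weight 1 (s / 2)) u x‖ ^ 2 + ‖fderiv ℝ (mulOp (weight 1 (s / 2)) u) x‖ ^ 2
      ≤ (3 + 2 * n * s ^ 2) * (weight 1 s x * (gradSq u x + ‖u x‖ ^ 2)) := by
  have hw : weight 1 (s / 2) x ^ 2 = weight 1 s x := by
    rw [weight, weight, ← Real.rpow_mul_natCast (by positivity)]
    congr 1
    push_cast
    ring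
  have hS := gradSq_nonneg u x
  have hW := weight_pos 1 s x
  have h1 : ∀ j, ‖fderiv ℝ (mulOp (weight 1 (s / 2)) u) x (EuclideanSpace.single j 1)‖ ^ 2
      ≤ 2 * weight 1 s x * ‖partialDeriv j u x‖ ^ 2 + 2 * s ^ 2 * weight 1 s x * ‖u x‖ ^ 2 :=
    fun j => by
      have h2 := norm_partialDeriv_weight_le zero_le_one le_rfl (s / 2) 1 j u x
      rw [one_smul, partialDeriv_apply, norm_one, one_mul, one_mul, abs_div, Nat.abs_ofNat,
        mul_div_cancel₀ _ two_ne_zero] at h2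
      have h3 := pow_le_pow_left₀ (norm_nonneg _) h2 2
      refine h3.trans (add_sq_le.trans (le_of_eq ?_))
      rw [mul_pow, mul_pow, mul_pow, sq_abs, hw]
      ring
  have h4 := (norm_sq_le_sum_norm_sq _).trans
    (Finset.sum_le_sum fun j (_ : j ∈ Finset.univ) => h1 j)
  rw [Finset.sum_add_distrib, ← Finset.mul_sum] at h4
  simp only [Finset.sum_const, Finset.card_univ, Fintype.card_fin, nsmul_eq_mul] at h4
  have h5 : ‖mulOp (weight 1 (s / 2)) u x‖ ^ 2 = weight 1 s x * ‖u x‖ ^ 2 := by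
    rw [mulOp_apply (hasTemperateGrowth_weight _ _), norm_smul, mul_pow, Real.norm_eq_abs,
      sq_abs, hw]
  have h6 : 0 ≤ (1 + 2 * n * s ^ 2) * (weight 1 s x * gradSq u x) := by positivity
  have h7 : 0 ≤ 2 * (weight 1 s x * ‖u x‖ ^ 2) := by positivity
  rw [h5]
  rw [gradSq] at h6 ⊢
  linarith

theorem weight_one_le {ε : ℝ} (hε : 0 < ε) (hε1 : ε ≤ 1) (s : ℝ) (x : EuclideanSpace ℝ (Fin n)) :
    weight 1 s x ≤ (1 + ((ε ^ 2)⁻¹) ^ s) * weight ε s x := by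
  have hW := weight_pos ε s x
  have hε2 : 0 < ((ε ^ 2)⁻¹) ^ s := by positivity
  have hsq : ε ^ 2 ≤ 1 := pow_le_one₀ hε.le hε1
  rcases le_total 0 s with hs | hs
  · have h1 : weight 1 s x ≤ ((ε ^ 2)⁻¹) ^ s * weight ε s x := by
      rw [weight, weight, ← Real.mul_rpow (by positivity) (by positivity)]
      refine Real.rpow_le_rpow (by positivity) ?_ hs
      rw [inv_mul_eq_div, le_div_iff₀ (by positivity)]
      nlinarith [sq_nonneg ‖x‖]
    linarith
  · have h1 : weight 1 s x ≤ weight ε s x := by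
      refine Real.rpow_le_rpow_of_nonpos (by positivity) ?_ hs
      gcongr
    have := mul_pos hε2 hW
    linarith

end Coercive

end SchwartzSpinor

/-- Lemma A.8 (Berthier–Georgescu Hardy-type inequality, `n ≥ 2`): away from the thresholds
`±m`, the weighted `H¹` norm `‖⟨x⟩^s u‖_{H¹}` is bounded by `c ‖⟨x⟩^{s+1}(D_m − λ)u‖_{L²}`,
for Schwartz `u` and `s > −1/2`. -/
theorem dirac_hardy_inequality
    (n N : ℕ) (hn : 2 ≤ n) (m : ℝ) (hm : 0 < m)
    (α : Fin n → Matrix (Fin N) (Fin N) ℂ) (β : Matrix (Fin N) (Fin N) ℂ)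
    (hαh : ∀ j, (α j).IsHermitian) (hβh : β.IsHermitian)
    (hα2 : ∀ j, α j * α j = 1) (hβ2 : β * β = 1)
    (hαα : ∀ j k, j ≠ k → α j * α k + α k * α j = 0)
    (hαβ : ∀ j, α j * β + β * α j = 0)
    (lam : ℂ) (hlam : lam ≠ (m : ℂ)) (hlam' : lam ≠ (-m : ℂ))
    (s : ℝ) (hs : -(1 / 2 : ℝ) < s) :
    ∃ c : ℝ, ∀ u : SchwartzMap (EuclideanSpace ℝ (Fin n)) (EuclideanSpace ℂ (Fin N)),
      ∫ x, (‖((1 + ‖x‖ ^ 2 : ℝ) ^ (s / 2)) • u x‖ ^ 2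
            + ‖fderiv ℝ (fun y => ((1 + ‖y‖ ^ 2 : ℝ) ^ (s / 2)) • u y) x‖ ^ 2)
        ≤ c ^ 2 * ∫ x, (1 + ‖x‖ ^ 2) ^ (s + 1) * ‖diracOp m α β (⇑u) x - lam • u x‖ ^ 2 := by
  obtain ⟨p, q, hp, hq, hE⟩ :=
    SchwartzSpinor.exists_energyBound_pos hαh hβh hα2 hβ2 hαα hαβ hlam hlam' hs
  obtain ⟨ε, C, hε, hε1, hC, hbound⟩ := hE.integral_le hp hq
  set R := (3 + 2 * n * s ^ 2) * (1 + ((ε ^ 2)⁻¹) ^ s) with hR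
  have hR0 : 0 ≤ R := by positivity
  refine ⟨√(R * C), fun u => ?_⟩
  rw [Real.sq_sqrt (by positivity)]
  have hweight : ∀ (t : ℝ) (x : EuclideanSpace ℝ (Fin n)),
      (1 + ‖x‖ ^ 2 : ℝ) ^ t = weight 1 t x := fun t x => by simp [weight]
  set f := (abstractDirac (SchwartzSpinor.partialDeriv (n := n))
    (fun j => SchwartzSpinor.matrixOp (α j)) (SchwartzSpinor.matrixOp β) m - lam • 1) u with hf
  have hfx : ∀ x, diracOp m α β u x - lam • u x = f x := fun x => by
    rw [← SchwartzSpinor.abstractDirac_apply]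
    rfl
  have hv : (fun x => weight 1 (s / 2) x • u x) = SchwartzSpinor.mulOp (weight 1 (s / 2)) u :=
    funext fun x => (SchwartzSpinor.mulOp_apply (hasTemperateGrowth_weight 1 (s / 2)) u x).symm
  simp only [hweight, hfx, hv]
  simp only [← SchwartzSpinor.mulOp_apply (hasTemperateGrowth_weight 1 (s / 2)) u]
  calc ∫ x, (‖SchwartzSpinor.mulOp (weight 1 (s / 2)) u x‖ ^ 2
        + ‖fderiv ℝ (SchwartzSpinor.mulOp (weight 1 (s / 2)) u) x‖ ^ 2)
      ≤ ∫ x, R * (weight ε s x * (SchwartzSpinor.gradSq u x + ‖u x‖ ^ 2)) := by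
        refine integral_mono_of_nonneg (.of_forall fun x => by positivity)
          ((SchwartzSpinor.integrable_weight_mul_energy ε s u).const_mul R)
          (.of_forall fun x => (SchwartzSpinor.mulOp_weight_jet_le s u x).trans ?_)
        have h1 := SchwartzSpinor.gradSq_nonneg u x
        have h2 := mul_le_mul_of_nonneg_right (SchwartzSpinor.weight_one_le hε hε1 s x)
          (by positivity : 0 ≤ SchwartzSpinor.gradSq u x + ‖u x‖ ^ 2)
        have h3 := mul_le_mul_of_nonneg_left h2 (by positivity : 0 ≤ 3 + 2 * n * s ^ 2)
        refine h3.trans (le_of_eq ?_)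
        ring
    _ ≤ R * (C * ∫ x, weight ε (s + 1) x * ‖f x‖ ^ 2) := by
        rw [integral_const_mul]
        exact mul_le_mul_of_nonneg_left (hbound u) hR0
    _ ≤ R * C * ∫ x, weight 1 (s + 1) x * ‖f x‖ ^ 2 := by
        rw [mul_assoc R]
        refine mul_le_mul_of_nonneg_left (mul_le_mul_of_nonneg_left ?_ hC) hR0
        refine integral_mono (SchwartzSpinor.integrable_weight_mul_norm_sq ε (s + 1) f)
          (SchwartzSpinor.integrable_weight_mul_norm_sq 1 (s + 1) f) fun x => ?_
        refine mul_le_mul_of_nonneg_right ?_ (by positivity)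
        refine Real.rpow_le_rpow (by positivity) ?_ (by linarith)
        gcongr
end
end
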